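/- Existence of minimizing geodesics: let γ₀, γ₁ ∈ 𝓜 lie in the same path component of 𝓜 (equivalently, d_G(γ₀,γ₁) < ∞). Then there exists a path Γ ∈ H¹([0,1], H^s(𝕋,ℝⁿ)) with Γ(t) ∈ 𝓜 for all t ∈ [0,1], Γ(0) = γ₀, Γ(1) = γ₁, which minimizes the path energy 𝓔(Γ) = ½ ∫₀¹ G_{Γ(t)}(Γ̇(t),Γ̇(t)) dt among all such paths; this minimizer has constant speed and its length ∫₀¹ √(G_{Γ(t)}(Γ̇(t),Γ̇(t))) dt equals d_G(γ₀,γ₁), i.e., it is a length-minimizing geodesic from γ₀ to γ₁. -/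

import Mathlib

open MeasureTheory Real Filter Set
open scoped ENNReal Topology RealInnerProductSpace

noncomputable section

/-- Euclidean space `ℝⁿ`. -/
abbrev En (n : ℕ) : Type := EuclideanSpace ℝ (Fin n)

/-- A fundamental domain for the circle `𝕋 = ℝ/ℤ`. -/
def I01 : Set ℝ := Set.Ico (0 : ℝ) 1

/-- The intrinsic distance on `𝕋 = ℝ/ℤ`, expressed for real representatives. -/
def dT (x y : ℝ) : ℝ := ⨅ k : ℤ, |x - y - (k : ℝ)|

/-- Supremum norm of a (periodic) function on the circle. -/
def supNorm {E : Type*} [NormedAddCommGroup E] (f : ℝ → E) : ℝ := ⨆ x : ℝ, ‖f x‖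

/-- The squared Gagliardo seminorm `[v]_{H^σ}²` of a function on the circle, valued in `[0,∞]`. -/
def gagliardoSqE {E : Type*} [NormedAddCommGroup E] (σ : ℝ) (v : ℝ → E) : ℝ≥0∞ :=
  ∫⁻ x in I01, ∫⁻ y in I01, ENNReal.ofReal (‖v y - v x‖ ^ 2 / dT x y ^ (2 * σ + 1))

/-- Membership in the Sobolev–Slobodeckij space `H^s(𝕋, ℝⁿ)`; for `s ∈ (3/2,2)` such
functions have a `C¹` representative, which we take as the defining data. -/
def InHs {n : ℕ} (s : ℝ) (u : ℝ → En n) : Prop :=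
  Function.Periodic u 1 ∧ ContDiff ℝ 1 u ∧ gagliardoSqE (s - 1) (deriv u) < ⊤

/-- The squared `H^s` norm `‖u‖²_{L²} + ‖u'‖²_{L²} + [u']²_{H^{s-1}}`. -/
def HsNormSq {n : ℕ} (s : ℝ) (u : ℝ → En n) : ℝ :=
  (∫ x in I01, ‖u x‖ ^ 2) + (∫ x in I01, ‖deriv u x‖ ^ 2) +
    (gagliardoSqE (s - 1) (deriv u)).toReal

/-- The `H^s` norm. -/
def HsNorm {n : ℕ} (s : ℝ) (u : ℝ → En n) : ℝ := Real.sqrt (HsNormSq s u)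

/-- The `H^s` inner product. -/
def HsInner {n : ℕ} (s : ℝ) (u v : ℝ → En n) : ℝ :=
  (∫ x in I01, ⟪u x, v x⟫) + (∫ x in I01, ⟪deriv u x, deriv v x⟫) +
    ∫ x in I01, ∫ y in I01,
      ⟪deriv u y - deriv u x, deriv v y - deriv v x⟫ / dT x y ^ (2 * (s - 1) + 1)

/-- The manifold `𝓜` of embedded closed curves of class `H^s`: injective (on the circle)
immersions. -/
def InM {n : ℕ} (s : ℝ) (γ : ℝ → En n) : Prop :=
  InHs s γ ∧ Set.InjOn γ I01 ∧ ∀ x, deriv γ x ≠ 0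

/-- The length `L(γ)`. -/
def arcLen {n : ℕ} (γ : ℝ → En n) : ℝ := ∫ x in I01, ‖deriv γ x‖

/-- The arc-length distance `d_γ(x,y)`: the length of the shorter of the two arcs of `γ`
between `x` and `y`. -/
def arcDist {n : ℕ} (γ : ℝ → En n) (x y : ℝ) : ℝ :=
  ⨅ k : ℤ, |∫ t in x..(y + (k : ℝ)), ‖deriv γ t‖|

/-- Derivative with respect to arc length, `D_γ u = u' / |γ'|`. -/
def Dg {n : ℕ} (γ u : ℝ → En n) (x : ℝ) : En n := ‖deriv γ x‖⁻¹ • deriv u x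

/-- `𝒟_γ u (x)`, the pointwise linear map `w ↦ |γ'(x)|⁻² ⟪γ'(x), w⟫ u'(x)`. -/
def DDg {n : ℕ} (γ u : ℝ → En n) (x : ℝ) (w : En n) : En n :=
  ((‖deriv γ x‖ ^ 2)⁻¹ * ⟪deriv γ x, w⟫) • deriv u x

/-- The operator `R^s_γ`. -/
def Rop {n : ℕ} (s : ℝ) (γ u : ℝ → En n) (x y : ℝ) : En n :=
  (‖γ y - γ x‖ ^ s)⁻¹ • (u y - u x - DDg γ u x (γ y - γ x))

/-- Density of the measure `μ_γ` with respect to `λ ⊗ λ` on `𝕋 × 𝕋`. -/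
def muW {n : ℕ} (γ : ℝ → En n) (x y : ℝ) : ℝ :=
  ‖deriv γ x‖ * ‖deriv γ y‖ / ‖γ y - γ x‖

/-- Density of the measure `ν_γ` with respect to `λ ⊗ λ` on `𝕋 × 𝕋`. -/
def nuW {n : ℕ} (γ : ℝ → En n) (x y : ℝ) : ℝ :=
  ‖deriv γ x‖ * ‖deriv γ y‖ / arcDist γ x y

/-- The tangent-point energy, valued in `[0,∞]`. -/
def EtpE {n : ℕ} (s : ℝ) (γ : ℝ → En n) : ℝ≥0∞ :=
  ∫⁻ x in I01, ∫⁻ y in I01, ENNReal.ofReal (‖Rop s γ γ x y‖ ^ 2 * muW γ x y)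

/-- The tangent-point energy, real-valued (finite on `𝓜`). -/
def Etp {n : ℕ} (s : ℝ) (γ : ℝ → En n) : ℝ := (EtpE s γ).toReal

/-- `‖R^s_γ u‖²_{L²(ν_γ)}`, valued in `[0,∞]`. -/
def RnuSqE {n : ℕ} (s : ℝ) (γ u : ℝ → En n) : ℝ≥0∞ :=
  ∫⁻ x in I01, ∫⁻ y in I01, ENNReal.ofReal (‖Rop s γ u x y‖ ^ 2 * nuW γ x y)

/-- `‖R^s_γ u‖²_{L²(ν_γ)}`, real-valued. -/
def RnuSq {n : ℕ} (s : ℝ) (γ u : ℝ → En n) : ℝ := (RnuSqE s γ u).toReal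

/-- The squared `γ`-dependent seminorm `[u]²_{H^s(γ)}`, valued in `[0,∞]`. -/
def gagGammaSqE {n : ℕ} (s : ℝ) (γ u : ℝ → En n) : ℝ≥0∞ :=
  ∫⁻ x in I01, ∫⁻ y in I01,
    ENNReal.ofReal (‖Dg γ u y - Dg γ u x‖ ^ 2 / arcDist γ x y ^ (2 * (s - 1)) * nuW γ x y)

/-- The squared `γ`-dependent seminorm `[u]²_{H^s(γ)}`, real-valued. -/
def gagGammaSq {n : ℕ} (s : ℝ) (γ u : ℝ → En n) : ℝ := (gagGammaSqE s γ u).toReal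

/-- The inner product `⟨u,v⟩_{L²(γ)}`. -/
def innerL2g {n : ℕ} (γ u v : ℝ → En n) : ℝ := ∫ x in I01, ⟪u x, v x⟫ * ‖deriv γ x‖

/-- The inner product `⟨u,v⟩_{H¹(γ)}`. -/
def innerH1g {n : ℕ} (γ u v : ℝ → En n) : ℝ :=
  ∫ x in I01, ⟪Dg γ u x, Dg γ v x⟫ * ‖deriv γ x‖

/-- The squared `γ`-dependent norm `‖u‖²_{H^s(γ)}`. -/
def HsGammaNormSq {n : ℕ} (s : ℝ) (γ u : ℝ → En n) : ℝ :=
  innerL2g γ u u + innerH1g γ u u + gagGammaSq s γ u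

/-- The `γ`-dependent norm `‖u‖_{H^s(γ)}`. -/
def HsGammaNorm {n : ℕ} (s : ℝ) (γ u : ℝ → En n) : ℝ := Real.sqrt (HsGammaNormSq s γ u)

/-- The bilinear form `B¹_γ`. -/
def B1 {n : ℕ} (s : ℝ) (γ u v : ℝ → En n) : ℝ :=
  ∫ x in I01, ∫ y in I01, ⟪Rop s γ u x y, Rop s γ v x y⟫ * muW γ x y

/-- The bilinear form `B²_γ`. -/
def B2 {n : ℕ} (s : ℝ) (γ u v : ℝ → En n) : ℝ :=
  ∫ x in I01, ∫ y in I01,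
    ‖Rop s γ γ x y‖ ^ 2 * (⟪u y - u x, v y - v x⟫ / ‖γ y - γ x‖ ^ 2) * muW γ x y

/-- The bilinear form `B³_γ`. -/
def B3 {n : ℕ} (s : ℝ) (γ u v : ℝ → En n) : ℝ :=
  ∫ x in I01, ∫ y in I01,
    ‖Rop s γ γ x y‖ ^ 2 * (⟪Dg γ u x, Dg γ v x⟫ + ⟪Dg γ u y, Dg γ v y⟫) * muW γ x y

/-- The Riemannian metric `G_γ(u,v)`. -/
def Gmet {n : ℕ} (s : ℝ) (γ u v : ℝ → En n) : ℝ :=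
  2 * B1 s γ u v + (2 * s + 1) * B2 s γ u v + B3 s γ u v + innerH1g γ u v + innerL2g γ u v

/-- The distortion `distor(γ) = sup_{x ≠ y} d_γ(x,y)/|γ(y) − γ(x)|`, valued in `[0,∞]`. -/
def distorE {n : ℕ} (γ : ℝ → En n) : ℝ≥0∞ :=
  ⨆ (x ∈ I01) (y ∈ I01) (_ : x ≠ y), ENNReal.ofReal (arcDist γ x y / ‖γ y - γ x‖)

/-- The distortion, real-valued. -/
def distor {n : ℕ} (γ : ℝ → En n) : ℝ := (distorE γ).toReal

/-- A `C¹` path `[0,1] → 𝓜 ⊂ H^s(𝕋,ℝⁿ)` (with respect to the `H^s` topology), recorded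
together with its velocity field `V`. -/
structure C1Path (s : ℝ) (n : ℕ) where
  Γ : ℝ → ℝ → En n
  V : ℝ → ℝ → En n
  mem : ∀ t ∈ Set.Icc (0 : ℝ) 1, InM s (Γ t)
  memV : ∀ t ∈ Set.Icc (0 : ℝ) 1, InHs s (V t)
  isDeriv : ∀ t ∈ Set.Icc (0 : ℝ) 1,
    Tendsto (fun h : ℝ => HsNorm s fun x => h⁻¹ • (Γ (t + h) x - Γ t x) - V t x)
      (𝓝[{h : ℝ | t + h ∈ Set.Icc (0 : ℝ) 1 ∧ h ≠ 0}] 0) (𝓝 0)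
  contV : ∀ t ∈ Set.Icc (0 : ℝ) 1,
    Tendsto (fun τ : ℝ => HsNorm s fun x => V τ x - V t x) (𝓝[Set.Icc (0 : ℝ) 1] t) (𝓝 0)

/-- Length of a path with respect to `G`. -/
def pathLen {s : ℝ} {n : ℕ} (P : C1Path s n) : ℝ :=
  ∫ t in (0 : ℝ)..1, Real.sqrt (Gmet s (P.Γ t) (P.V t) (P.V t))

/-- The path (Dirichlet) energy of a path with respect to `G`. -/
def pathEnergy {s : ℝ} {n : ℕ} (P : C1Path s n) : ℝ :=
  (1 / 2) * ∫ t in (0 : ℝ)..1, Gmet s (P.Γ t) (P.V t) (P.V t)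

/-- The geodesic distance induced by `G`, valued in `[0,∞]` (`∞` if there is no path). -/
def geodDist (s : ℝ) {n : ℕ} (γ₀ γ₁ : ℝ → En n) : ℝ≥0∞ :=
  ⨅ (P : C1Path s n) (_ : P.Γ 0 = γ₀ ∧ P.Γ 1 = γ₁), ENNReal.ofReal (pathLen P)

/-- `U ⊆ 𝓜` is bounded with respect to the geodesic distance `d_G`. -/
def GBounded (s : ℝ) {n : ℕ} (U : Set (ℝ → En n)) : Prop :=
  (∀ γ ∈ U, InM s γ) ∧
    ∃ γ₀, InM s γ₀ ∧ ∃ R : ℝ, ∀ γ ∈ U, geodDist s γ γ₀ ≤ ENNReal.ofReal R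

/-- Weak convergence in the Hilbert space `H^s(𝕋,ℝⁿ)`. -/
def WeakHsTendsto {n : ℕ} (s : ℝ) (γk : ℕ → ℝ → En n) (γ : ℝ → En n) : Prop :=
  ∀ v : ℝ → En n, InHs s v →
    Tendsto (fun k => HsInner s (γk k) v) atTop (𝓝 (HsInner s γ v))

/-- Directional derivative of `γ ↦ G_γ(u,v)` at `γ` in direction `w`. -/
def DGdir {n : ℕ} (s : ℝ) (γ w u v : ℝ → En n) : ℝ :=
  deriv (fun t : ℝ => Gmet s (fun x => γ x + t • w x) u v) 0

/-- `F'` is the derivative of the path `F` with respect to the `H^s` norm, on `S`. -/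
def IsHsDerivOn {n : ℕ} (s : ℝ) (F F' : ℝ → ℝ → En n) (S : Set ℝ) : Prop :=
  ∀ t ∈ S,
    Tendsto (fun h : ℝ => HsNorm s fun x => h⁻¹ • (F (t + h) x - F t x) - F' t x)
      (𝓝[{h : ℝ | t + h ∈ S ∧ h ≠ 0}] 0) (𝓝 0)

/-- The path `F` is continuous on `S` with respect to the `H^s` norm. -/
def HsContOn {n : ℕ} (s : ℝ) (F : ℝ → ℝ → En n) (S : Set ℝ) : Prop :=
  ∀ t ∈ S, Tendsto (fun τ : ℝ => HsNorm s fun x => F τ x - F t x) (𝓝[S] t) (𝓝 0)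

/-- A solution of the geodesic initial value problem on `[0,∞)`, recorded as a triple
(position `Γ`, velocity `V`, acceleration `W`); the geodesic equation
`Γ̈ + A_Γ(Γ̇)Γ̇ = 0` is expressed weakly via the Koszul formula for the
Christoffel operator `A`. -/
def GeodesicSol {n : ℕ} (s : ℝ) (γ₀ v₀ : ℝ → En n) (Γ V W : ℝ → ℝ → En n) : Prop :=
  (∀ t ∈ Set.Ici (0 : ℝ), InM s (Γ t) ∧ InHs s (V t) ∧ InHs s (W t)) ∧
  Γ 0 = γ₀ ∧ V 0 = v₀ ∧
  IsHsDerivOn s Γ V (Set.Ici 0) ∧ IsHsDerivOn s V W (Set.Ici 0) ∧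
  HsContOn s V (Set.Ici 0) ∧ HsContOn s W (Set.Ici 0) ∧
  ∀ t ∈ Set.Ici (0 : ℝ), ∀ w : ℝ → En n, InHs s w →
    Gmet s (Γ t) (W t) w + DGdir s (Γ t) (V t) (V t) w
      - (1 / 2) * DGdir s (Γ t) w (V t) (V t) = 0

/-! ### Part 1: basics -/

def mu1 : Measure ℝ := volume.restrict I01
def mu2 : Measure (ℝ × ℝ) := mu1.prod mu1

instance : IsProbabilityMeasure mu1 := ⟨by simp [mu1, I01]⟩
instance : IsProbabilityMeasure mu2 := by unfold mu2; infer_instance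

theorem dT_eq (x y : ℝ) : dT x y = |(x - y) - round (x - y)| := by
  unfold dT
  apply le_antisymm
  · exact ciInf_le ⟨0, by rintro _ ⟨k, rfl⟩; exact abs_nonneg _⟩ (round (x - y))
  · exact le_ciInf fun k => round_le _ _

theorem dT_nonneg (x y : ℝ) : 0 ≤ dT x y := by rw [dT_eq]; exact abs_nonneg _

theorem dT_le (x y : ℝ) (k : ℤ) : dT x y ≤ |x - y - k| := by rw [dT_eq]; exact round_le _ _

theorem dT_le_abs (x y : ℝ) : dT x y ≤ |y - x| := by
  have := dT_le x y 0
  simpa [abs_sub_comm] using this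

theorem dT_le_half (x y : ℝ) : dT x y ≤ 1 / 2 := by rw [dT_eq]; exact abs_sub_round _

theorem dT_exists (x y : ℝ) : ∃ k : ℤ, dT x y = |x - y - k| := ⟨_, dT_eq x y⟩

theorem dT_comm (x y : ℝ) : dT x y = dT y x := by
  apply le_antisymm
  · obtain ⟨k, hk⟩ := dT_exists y x
    rw [hk]; refine (dT_le x y (-k)).trans (le_of_eq ?_)
    rw [abs_sub_comm]; push_cast; congr 1; ring
  · obtain ⟨k, hk⟩ := dT_exists x y
    rw [hk]; refine (dT_le y x (-k)).trans (le_of_eq ?_)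
    rw [abs_sub_comm]; push_cast; congr 1; ring

theorem dT_add_int_right (x y : ℝ) (m : ℤ) : dT x (y + m) = dT x y := by
  rw [dT_eq, dT_eq]
  have : x - (y + m) = x - y - m := by ring
  rw [this, round_sub_intCast]; push_cast; congr 1; ring

theorem dT_add_int_left (x y : ℝ) (m : ℤ) : dT (x + m) y = dT x y := by
  rw [dT_comm, dT_add_int_right, dT_comm]

theorem dT_eq_abs {x y : ℝ} (h : |y - x| ≤ 1 / 2) : dT x y = |y - x| := by
  apply le_antisymm (dT_le_abs x y)
  obtain ⟨k, hk⟩ := dT_exists x y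
  rw [hk]
  by_cases h0 : k = 0
  · subst h0; simp [abs_sub_comm]
  · have h1 : (1 : ℝ) ≤ |(k : ℝ)| := by exact_mod_cast Int.one_le_abs h0
    have h2 : |(k : ℝ)| ≤ |x - y - k| + |y - x| := by
      have := abs_sub (x - y - k) (x - y)
      have e : x - y - k - (x - y) = -(k : ℝ) := by ring
      rw [e, abs_neg, abs_sub_comm x y] at this
      exact this
    linarith

theorem dT_pos {x y : ℝ} (hx : x ∈ I01) (hy : y ∈ I01) (h : x ≠ y) : 0 < dT x y := by
  refine lt_of_le_of_ne (dT_nonneg x y) fun h0 => ?_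
  obtain ⟨k, hk⟩ := dT_exists x y
  rw [← h0] at hk
  have h1 : x - y - k = 0 := abs_eq_zero.1 hk.symm
  obtain ⟨hx0, hx1⟩ := hx
  obtain ⟨hy0, hy1⟩ := hy
  have h2 : (k : ℝ) < 1 := by linarith
  have h3 : (-1 : ℝ) < k := by linarith
  have h4 : k < 1 := by exact_mod_cast h2
  have h5 : -1 < k := by exact_mod_cast h3
  have : k = 0 := by omega
  subst this
  apply h; simp at h1; linarith

theorem measurable_dT : Measurable fun z : ℝ × ℝ => dT z.1 z.2 := by
  simp only [dT_eq]
  have h : Measurable (fun x : ℝ => ((round x : ℤ) : ℝ)) := by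
    have : Measurable (round : ℝ → ℤ) := by
      rw [show (round : ℝ → ℤ) = fun x => ⌊x + 1 / 2⌋ from funext round_eq]
      exact Int.measurable_floor.comp (measurable_id.add_const _)
    exact measurable_from_top.comp this
  have h1 : Measurable (fun z : ℝ × ℝ => z.1 - z.2) := measurable_fst.sub measurable_snd
  exact (h1.sub (h.comp h1)).norm

theorem per_lint {F : ℝ → ℝ≥0∞} (hF : Function.Periodic F 1) (a : ℝ) :
    ∫⁻ y in I01, F y = ∫⁻ y in Ioc a (a + 1), F y := by
  have key : ∀ t : ℝ, ∫⁻ y in Ioc t (t + 1), F y = ∫⁻ b : UnitAddCircle, hF.lift b := by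
    intro t
    rw [← UnitAddCircle.lintegral_preimage t]
    rfl
  rw [key a, ← key 0, I01, zero_add]
  rw [restrict_Ico_eq_restrict_Ioc]

theorem per_lint_shift {F : ℝ → ℝ≥0∞} (hF : Function.Periodic F 1) (x : ℝ) :
    ∫⁻ y in I01, F y = ∫⁻ h in Ioc (-(1/2) : ℝ) (1/2), F (x + h) := by
  rw [per_lint hF (x - 1/2)]
  have hm := (measurePreserving_add_left (volume : Measure ℝ) x).setLIntegral_comp_preimage_emb
    (MeasurableEquiv.addLeft x).measurableEmbedding F (Ioc (x - 1/2) (x - 1/2 + 1))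
  rw [← hm]
  congr 2
  ext h
  simp only [mem_Ioc, mem_preimage]
  constructor <;> rintro ⟨h1, h2⟩ <;> constructor <;> linarith

theorem per_lint2_le {F : ℝ → ℝ → ℝ≥0∞} (h1 : ∀ y, Function.Periodic (fun x => F x y) 1)
    (h2 : ∀ x, Function.Periodic (F x) 1) {A B : Set ℝ} {a b : ℝ}
    (hA : A ⊆ Ioc a (a + 1)) (hB : B ⊆ Ioc b (b + 1)) :
    ∫⁻ x in A, ∫⁻ y in B, F x y ≤ ∫⁻ x in I01, ∫⁻ y in I01, F x y := by
  calc ∫⁻ x in A, ∫⁻ y in B, F x y ≤ ∫⁻ x in Ioc a (a + 1), ∫⁻ y in B, F x y :=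
        lintegral_mono_set hA
    _ ≤ ∫⁻ x in Ioc a (a + 1), ∫⁻ y in I01, F x y := by
        refine lintegral_mono fun x => ?_
        rw [per_lint (h2 x) b]
        exact lintegral_mono_set hB
    _ = ∫⁻ x in I01, ∫⁻ y in I01, F x y := by
        rw [← per_lint]
        intro x
        refine lintegral_congr fun y => h1 y x

theorem mu2_iter {F : ℝ → ℝ → ℝ≥0∞} (hF : Measurable (Function.uncurry F)) :
    ∫⁻ x in I01, ∫⁻ y in I01, F x y = ∫⁻ z, F z.1 z.2 ∂mu2 :=
  (lintegral_prod (μ := mu1) (ν := mu1) (fun z : ℝ × ℝ => F z.1 z.2) hF.aemeasurable).symm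

theorem mu2_swap {F : ℝ → ℝ → ℝ≥0∞} :
    ∫⁻ z, F z.2 z.1 ∂mu2 = ∫⁻ z, F z.1 z.2 ∂mu2 :=
  lintegral_prod_swap (μ := mu1) (ν := mu1) (fun z : ℝ × ℝ => F z.1 z.2)

theorem mu2_ae : ∀ᵐ z ∂mu2, z.1 ∈ I01 ∧ z.2 ∈ I01 ∧ z.1 ≠ z.2 := by
  have hI : ∀ᵐ x ∂mu1, x ∈ I01 := ae_restrict_mem measurableSet_Ico
  have h1 : ∀ᵐ z ∂mu2, z.1 ∈ I01 := Measure.quasiMeasurePreserving_fst.ae hI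
  have h2 : ∀ᵐ z ∂mu2, z.2 ∈ I01 := Measure.quasiMeasurePreserving_snd.ae hI
  have h3 : ∀ᵐ z ∂mu2, z.1 ≠ z.2 := by
    have hs : MeasurableSet {z : ℝ × ℝ | z.1 ≠ z.2} :=
      (measurableSet_eq_fun measurable_fst measurable_snd).compl
    refine (Measure.ae_prod_iff_ae_ae hs).2 (Eventually.of_forall fun x => ?_)
    have : ∀ᵐ y ∂mu1, y ≠ x := by
      unfold mu1
      exact ae_restrict_of_ae (Measure.ae_ne volume x)
    filter_upwards [this] with y hy using fun h => hy h.symm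
  filter_upwards [h1, h2, h3] with z a b c using ⟨a, b, c⟩

section L2
variable {F : Type*} [NormedAddCommGroup F] {α : Type*} [MeasurableSpace α] {μ : Measure α}

theorem eLpNorm_two_sq (f : α → F) :
    (eLpNorm f 2 μ) ^ 2 = ∫⁻ z, ENNReal.ofReal (‖f z‖ ^ 2) ∂μ := by
  rw [eLpNorm_eq_lintegral_rpow_enorm_toReal (by norm_num) (by norm_num)]
  rw [← ENNReal.rpow_natCast, ← ENNReal.rpow_mul]
  simp only [ENNReal.toReal_ofNat, Nat.cast_ofNat, one_div]
  rw [inv_mul_cancel₀ (by norm_num), ENNReal.rpow_one]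
  refine lintegral_congr fun z => ?_
  rw [ENNReal.ofReal_pow (norm_nonneg _), ofReal_norm, ← ENNReal.rpow_natCast]
  norm_num

theorem memL2_iff {f : α → F} (hf : AEStronglyMeasurable f μ) :
    MemLp f 2 μ ↔ ∫⁻ z, ENNReal.ofReal (‖f z‖ ^ 2) ∂μ < ⊤ := by
  rw [← eLpNorm_two_sq]
  constructor
  · intro h; exact ENNReal.pow_lt_top h.2
  · intro h; refine ⟨hf, ?_⟩
    by_contra h'
    rw [not_lt, top_le_iff] at h'
    rw [h'] at h; simp at h

theorem toLp_normsq {f : α → F} (hf : MemLp f 2 μ) :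
    ‖hf.toLp f‖ ^ 2 = (∫⁻ z, ENNReal.ofReal (‖f z‖ ^ 2) ∂μ).toReal := by
  rw [Lp.norm_toLp, ← ENNReal.toReal_pow, eLpNorm_two_sq]

theorem toLp_normsq' {f : α → F} (hf : MemLp f 2 μ) :
    ENNReal.ofReal (‖hf.toLp f‖ ^ 2) = ∫⁻ z, ENNReal.ofReal (‖f z‖ ^ 2) ∂μ := by
  rw [toLp_normsq, ENNReal.ofReal_toReal ((memL2_iff hf.1).1 hf).ne]

end L2

/-! ### Part 2: the space HS -/

abbrev W3 (n : ℕ) : Type := PiLp 2 (fun _ : Fin 3 => En n)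

def Jf {n : ℕ} (s : ℝ) (u : ℝ → En n) (z : ℝ × ℝ) : W3 n :=
  WithLp.toLp 2 ![u z.1, deriv u z.1, (dT z.1 z.2 ^ (s - 1/2))⁻¹ • (deriv u z.2 - deriv u z.1)]

theorem sq_rpow_half (a p : ℝ) (ha : 0 ≤ a) : (a ^ p) ^ 2 = a ^ (2 * p) := by
  rw [← Real.rpow_natCast, ← Real.rpow_mul ha]; congr 1; push_cast; ring

theorem Jf_normsq {n : ℕ} (s : ℝ) (u : ℝ → En n) (z : ℝ × ℝ) :
    ‖Jf s u z‖ ^ 2 = ‖u z.1‖ ^ 2 + ‖deriv u z.1‖ ^ 2 +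
      ‖deriv u z.2 - deriv u z.1‖ ^ 2 / dT z.1 z.2 ^ (2 * (s - 1) + 1) := by
  rw [PiLp.norm_sq_eq_of_L2, Fin.sum_univ_three]
  simp only [Jf, Matrix.cons_val_zero, Matrix.cons_val_one, Matrix.cons_val]
  congr 1
  rw [norm_smul, mul_pow, norm_inv, inv_pow, Real.norm_eq_abs, sq_abs,
    sq_rpow_half _ _ (dT_nonneg _ _), show 2 * (s - 1/2) = 2 * (s - 1) + 1 by ring,
    div_eq_inv_mul]

theorem Jf_cont {n : ℕ} (s : ℝ) {u : ℝ → En n} (hu : ContDiff ℝ 1 u) :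
    Measurable (Jf s u) := by
  have hc := hu.continuous
  have hd := hu.continuous_deriv le_rfl
  have : Measurable fun z : ℝ × ℝ => (![u z.1, deriv u z.1,
      (dT z.1 z.2 ^ (s - 1/2))⁻¹ • (deriv u z.2 - deriv u z.1)] : Fin 3 → En n) := by
    refine measurable_pi_iff.2 fun i => ?_
    fin_cases i
    · exact hc.measurable.comp measurable_fst
    · exact hd.measurable.comp measurable_fst
    · exact ((measurable_dT.pow_const _).inv).smul
        ((hd.measurable.comp measurable_snd).sub (hd.measurable.comp measurable_fst))
  exact (PiLp.continuous_toLp 2 _).measurable.comp this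

theorem meas_gag {n : ℕ} (p : ℝ) {v : ℝ → En n} (hv : Continuous v) :
    Measurable (Function.uncurry fun x y => ENNReal.ofReal (‖v y - v x‖ ^ 2 / dT x y ^ p)) := by
  refine ENNReal.measurable_ofReal.comp (Measurable.div ?_ ?_)
  · exact (((hv.measurable.comp measurable_snd).sub (hv.measurable.comp measurable_fst)).norm).pow_const 2
  · exact measurable_dT.pow_const _

theorem lint_cont {f : ℝ → ℝ} (hf : Continuous f) (h0 : ∀ x, 0 ≤ f x) :
    ∫⁻ z, ENNReal.ofReal (f z.1) ∂mu2 = ENNReal.ofReal (∫ x in I01, f x) := by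
  rw [← mu2_iter (F := fun x _ => ENNReal.ofReal (f x))
    (ENNReal.measurable_ofReal.comp (hf.measurable.comp measurable_fst))]
  simp only [lintegral_const]
  rw [ofReal_integral_eq_lintegral_ofReal]
  · simp [I01]
  · exact (hf.integrableOn_Icc (a := 0) (b := 1)).mono_set Ico_subset_Icc_self
  · exact Eventually.of_forall h0

theorem Jf_lint {n : ℕ} (s : ℝ) {u : ℝ → En n} (hu : ContDiff ℝ 1 u) :
    ∫⁻ z, ENNReal.ofReal (‖Jf s u z‖ ^ 2) ∂mu2 =
      ENNReal.ofReal (∫ x in I01, ‖u x‖ ^ 2) + ENNReal.ofReal (∫ x in I01, ‖deriv u x‖ ^ 2) +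
        gagliardoSqE (s - 1) (deriv u) := by
  have hc := hu.continuous
  have hd := hu.continuous_deriv le_rfl
  rw [← lint_cont (f := fun x => ‖u x‖ ^ 2) (hc.norm.pow 2) (fun x => by positivity),
    ← lint_cont (f := fun x => ‖deriv u x‖ ^ 2) (hd.norm.pow 2) (fun x => by positivity), gagliardoSqE, mu2_iter (meas_gag _ hd),
    ← lintegral_add_left, ← lintegral_add_left]
  · refine lintegral_congr fun z => ?_
    rw [Jf_normsq, ENNReal.ofReal_add, ENNReal.ofReal_add] <;> try positivity
    have := dT_nonneg z.1 z.2
    positivity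
  · exact (ENNReal.measurable_ofReal.comp ((hc.norm.pow 2).measurable.comp measurable_fst)).add
      (ENNReal.measurable_ofReal.comp ((hd.norm.pow 2).measurable.comp measurable_fst))
  · exact ENNReal.measurable_ofReal.comp ((hc.norm.pow 2).measurable.comp measurable_fst)

theorem Jf_mem_iff {n : ℕ} (s : ℝ) {u : ℝ → En n} (hu : ContDiff ℝ 1 u) :
    MemLp (Jf s u) 2 mu2 ↔ gagliardoSqE (s - 1) (deriv u) < ⊤ := by
  rw [memL2_iff (Jf_cont s hu).aestronglyMeasurable, Jf_lint s hu]
  simp [ENNReal.add_lt_top]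

theorem InHs.cd {n : ℕ} {s : ℝ} {u : ℝ → En n} (h : InHs s u) : ContDiff ℝ 1 u := h.2.1
theorem InHs.dif {n : ℕ} {s : ℝ} {u : ℝ → En n} (h : InHs s u) : Differentiable ℝ u :=
  h.2.1.differentiable one_ne_zero
theorem InHs.cont_deriv {n : ℕ} {s : ℝ} {u : ℝ → En n} (h : InHs s u) : Continuous (deriv u) :=
  h.2.1.continuous_deriv le_rfl
theorem InHs.jmem {n : ℕ} {s : ℝ} {u : ℝ → En n} (h : InHs s u) : MemLp (Jf s u) 2 mu2 :=
  (Jf_mem_iff s h.cd).2 h.2.2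

theorem deriv_add_fn {n : ℕ} {u v : ℝ → En n} (hu : Differentiable ℝ u) (hv : Differentiable ℝ v)
    (x : ℝ) : deriv (u + v) x = deriv u x + deriv v x := deriv_add (hu x) (hv x)
theorem deriv_smul_fn {n : ℕ} {u : ℝ → En n} (hu : Differentiable ℝ u) (c : ℝ)
    (x : ℝ) : deriv (c • u) x = c • deriv u x := deriv_const_smul c (hu x)

theorem Jf_add {n : ℕ} (s : ℝ) {u v : ℝ → En n} (hu : Differentiable ℝ u)
    (hv : Differentiable ℝ v) : Jf s (u + v) = Jf s u + Jf s v := by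
  funext z
  refine PiLp.ext fun i => ?_
  fin_cases i <;> simp [Jf, deriv_add_fn hu hv]
  rw [← smul_add]; congr 1; abel

theorem Jf_smul {n : ℕ} (s : ℝ) (c : ℝ) {u : ℝ → En n} (hu : Differentiable ℝ u) :
    Jf s (c • u) = c • Jf s u := by
  funext z
  refine PiLp.ext fun i => ?_
  fin_cases i <;> simp [Jf, deriv_smul_fn hu]
  rw [← smul_sub, smul_comm]

def HSsub (s : ℝ) (n : ℕ) : Submodule ℝ (ℝ → En n) where
  carrier := {u | InHs s u}
  add_mem' {u v} hu hv := by
    have hcd : ContDiff ℝ 1 (u + v) := hu.cd.add hv.cd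
    refine ⟨hu.1.add hv.1, hcd, ?_⟩
    rw [← Jf_mem_iff s hcd, Jf_add s hu.dif hv.dif]
    exact hu.jmem.add hv.jmem
  zero_mem' := by
    refine ⟨fun x => rfl, contDiff_const, ?_⟩
    have : deriv (0 : ℝ → En n) = fun _ => 0 := by funext x; simp
    rw [this]; simp [gagliardoSqE]
  smul_mem' c u hu := by
    have hcd : ContDiff ℝ 1 (c • u) := contDiff_const.smul hu.cd
    refine ⟨fun x => by simp [hu.1 x], hcd, ?_⟩
    rw [← Jf_mem_iff s hcd, Jf_smul s c hu.dif]
    exact hu.jmem.const_smul c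

def HS (s : ℝ) (n : ℕ) : Type := ↥(HSsub s n)

instance (s : ℝ) (n : ℕ) : AddCommGroup (HS s n) := inferInstanceAs (AddCommGroup ↥(HSsub s n))
instance (s : ℝ) (n : ℕ) : Module ℝ (HS s n) := inferInstanceAs (Module ℝ ↥(HSsub s n))

def HS.f {s : ℝ} {n : ℕ} (u : HS s n) : ℝ → En n := u.1
def HS.mk {s : ℝ} {n : ℕ} (u : ℝ → En n) (h : InHs s u) : HS s n := ⟨u, h⟩
theorem HS.mem {s : ℝ} {n : ℕ} (u : HS s n) : InHs s u.f := u.2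
@[simp] theorem HS.mk_f {s : ℝ} {n : ℕ} (u : ℝ → En n) (h : InHs s u) : (HS.mk u h).f = u := rfl
@[simp] theorem HS.add_f {s : ℝ} {n : ℕ} (u v : HS s n) : (u + v).f = u.f + v.f := rfl
@[simp] theorem HS.sub_f {s : ℝ} {n : ℕ} (u v : HS s n) : (u - v).f = u.f - v.f := rfl
@[simp] theorem HS.smul_f {s : ℝ} {n : ℕ} (c : ℝ) (u : HS s n) : (c • u).f = c • u.f := rfl
theorem HS.ext' {s : ℝ} {n : ℕ} {u v : HS s n} (h : u.f = v.f) : u = v := Subtype.ext h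
theorem HS.dadd {s : ℝ} {n : ℕ} (u v : HS s n) (x : ℝ) :
    deriv (u + v).f x = deriv u.f x + deriv v.f x := deriv_add_fn u.mem.dif v.mem.dif x
theorem HS.dsmul {s : ℝ} {n : ℕ} (c : ℝ) (u : HS s n) (x : ℝ) :
    deriv (c • u).f x = c • deriv u.f x := deriv_smul_fn u.mem.dif c x
theorem HS.dsub {s : ℝ} {n : ℕ} (u v : HS s n) (x : ℝ) :
    deriv (u - v).f x = deriv u.f x - deriv v.f x := deriv_sub (u.mem.dif x) (v.mem.dif x)

def HSJ (s : ℝ) (n : ℕ) : HS s n →ₗ[ℝ] Lp (W3 n) 2 mu2 where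
  toFun u := u.mem.jmem.toLp (Jf s u.f)
  map_add' u v := by
    rw [← MemLp.toLp_add]
    exact MemLp.toLp_congr _ _ (by rw [HS.add_f, Jf_add s u.mem.dif v.mem.dif])
  map_smul' c u := by
    rw [RingHom.id_apply, ← MemLp.toLp_const_smul]
    exact MemLp.toLp_congr _ _ (by rw [HS.smul_f, Jf_smul s c u.mem.dif])

theorem HsNormSq_eq {s : ℝ} {n : ℕ} (u : HS s n) : HsNormSq s u.f = ‖HSJ s n u‖ ^ 2 := by
  change _ = ‖u.mem.jmem.toLp (Jf s u.f)‖ ^ 2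
  have h1 : 0 ≤ ∫ x in I01, ‖u.f x‖ ^ 2 := integral_nonneg fun x => by positivity
  have h2 : 0 ≤ ∫ x in I01, ‖deriv u.f x‖ ^ 2 := integral_nonneg fun x => by positivity
  rw [toLp_normsq, Jf_lint s u.mem.cd, ENNReal.toReal_add, ENNReal.toReal_add,
    ENNReal.toReal_ofReal h1, ENNReal.toReal_ofReal h2]
  · rfl
  all_goals first | exact ENNReal.ofReal_ne_top | exact u.mem.2.2.ne | simp

theorem cont_per_zero {n : ℕ} {u : ℝ → En n} (hc : Continuous u) (hp : Function.Periodic u 1)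
    (h : ∫ x in I01, ‖u x‖ ^ 2 = 0) : u = 0 := by
  have hi : IntegrableOn (fun x => ‖u x‖ ^ 2) I01 :=
    ((hc.norm.pow 2).integrableOn_Icc (a := 0) (b := 1)).mono_set Ico_subset_Icc_self
  rw [setIntegral_eq_zero_iff_of_nonneg_ae (Eventually.of_forall fun x => by positivity) hi] at h
  have h2 : ∀ x ∈ Ioo (0 : ℝ) 1, u x = 0 := by
    have h3 : (fun x => ‖u x‖ ^ 2) =ᵐ[volume.restrict (Ioo (0:ℝ) 1)] fun _ => 0 :=
      ae_restrict_of_ae_restrict_of_subset Ioo_subset_Ico_self h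
    have := Measure.eqOn_open_of_ae_eq h3 isOpen_Ioo (hc.norm.pow 2).continuousOn continuousOn_const
    intro x hx
    simpa using this hx
  have h4 : ∀ x ∈ Icc (0 : ℝ) 1, u x = 0 := by
    have hcl : IsClosed {x | u x = 0} := isClosed_eq hc continuous_const
    have : closure (Ioo (0 : ℝ) 1) ⊆ {x | u x = 0} := hcl.closure_subset_iff.2 h2
    rwa [closure_Ioo (by norm_num)] at this
  funext x
  have := hp.sub_int_mul_eq (x := x) ⌊x⌋
  rw [Pi.zero_apply, ← this, mul_one]
  exact h4 _ ⟨by linarith [Int.floor_le x], by linarith [Int.lt_floor_add_one x]⟩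

theorem HSJ_inj (s : ℝ) (n : ℕ) : Function.Injective (HSJ s n) := by
  rw [injective_iff_map_eq_zero]
  intro u hu
  have h := HsNormSq_eq u
  rw [hu, norm_zero] at h
  have h1 : 0 ≤ ∫ x in I01, ‖u.f x‖ ^ 2 := integral_nonneg fun x => by positivity
  have h2 : 0 ≤ ∫ x in I01, ‖deriv u.f x‖ ^ 2 := integral_nonneg fun x => by positivity
  have h3 : 0 ≤ (gagliardoSqE (s - 1) (deriv u.f)).toReal := ENNReal.toReal_nonneg
  unfold HsNormSq at h
  exact HS.ext' (cont_per_zero u.mem.cd.continuous u.mem.1 (by linarith))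

instance (s : ℝ) (n : ℕ) : NormedAddCommGroup (HS s n) :=
  NormedAddCommGroup.induced _ _ (HSJ s n) (HSJ_inj s n)
instance (s : ℝ) (n : ℕ) : NormedSpace ℝ (HS s n) := NormedSpace.induced ℝ _ _ (HSJ s n)

theorem HS.norm_eq {s : ℝ} {n : ℕ} (u : HS s n) : ‖u‖ = HsNorm s u.f := by
  rw [HsNorm, HsNormSq_eq, Real.sqrt_sq (norm_nonneg _)]; rfl

theorem HS.normsq_lint {s : ℝ} {n : ℕ} (u : HS s n) :
    ENNReal.ofReal (‖u‖ ^ 2) = ∫⁻ z, ENNReal.ofReal (‖Jf s u.f z‖ ^ 2) ∂mu2 :=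
  toLp_normsq' u.mem.jmem

theorem HS.gag_le {s : ℝ} {n : ℕ} (u : HS s n) :
    gagliardoSqE (s - 1) (deriv u.f) ≤ ENNReal.ofReal (‖u‖ ^ 2) := by
  rw [HS.normsq_lint, Jf_lint s u.mem.cd]; exact le_add_self
theorem HS.l2_le {s : ℝ} {n : ℕ} (u : HS s n) : ∫ x in I01, ‖u.f x‖ ^ 2 ≤ ‖u‖ ^ 2 := by
  rw [← ENNReal.ofReal_le_ofReal_iff (by positivity), HS.normsq_lint, Jf_lint s u.mem.cd, add_assoc]
  exact le_self_add
theorem HS.l2d_le {s : ℝ} {n : ℕ} (u : HS s n) : ∫ x in I01, ‖deriv u.f x‖ ^ 2 ≤ ‖u‖ ^ 2 := by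
  rw [← ENNReal.ofReal_le_ofReal_iff (by positivity), HS.normsq_lint, Jf_lint s u.mem.cd]
  exact le_self_add.trans' le_add_self

/-! ### Part 3: Morrey -/

theorem morrey_good {n : ℕ} {ν : Measure ℝ} [SFinite ν] {φ : ℝ → ℝ} {v : ℝ → En n}
    (hφ : StrictMono φ) (hν : ∀ a b, a ≤ b → ν (Ioc a b) = ENNReal.ofReal (φ b - φ a))
    (hv : Continuous v) {α M a b : ℝ} (hα : 0 < α) (hM : 0 ≤ M) (hab : a < b)
    (h : ∫⁻ x in Ioc a b, ∫⁻ y in Ioc a b,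
      ENNReal.ofReal (‖v y - v x‖ ^ 2 / |φ y - φ x| ^ (2 * α + 2)) ∂ν ∂ν ≤ ENNReal.ofReal M) :
    ∃ ξ ∈ Ioc a b, ∫⁻ y in Ioc a b, ENNReal.ofReal (‖v y - v ξ‖ ^ 2) ∂ν ≤
      ENNReal.ofReal ((φ b - φ a) ^ (2 * α + 1) * M) := by
  have hr : 0 < φ b - φ a := sub_pos.2 (hφ hab)
  have hm : Measurable (Function.uncurry fun x y => ENNReal.ofReal (‖v y - v x‖ ^ 2)) := by
    refine ENNReal.measurable_ofReal.comp ?_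
    exact (((hv.measurable.comp measurable_snd).sub
      (hv.measurable.comp measurable_fst)).norm).pow_const 2
  have hm1 : Measurable fun x => ∫⁻ y in Ioc a b, ENNReal.ofReal (‖v y - v x‖ ^ 2) ∂ν :=
    hm.lintegral_prod_right'
  obtain ⟨ξ, hξ, hle⟩ := exists_le_setLAverage (μ := ν) (s := Ioc a b)
    (by rw [hν a b hab.le]; simpa using hr) (by rw [hν a b hab.le]; simp) hm1.aemeasurable
  refine ⟨ξ, hξ, hle.trans ?_⟩
  rw [setLAverage_eq, hν a b hab.le]
  refine ENNReal.div_le_of_le_mul ?_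
  rw [← ENNReal.ofReal_mul (by positivity)]
  have h1 : ∫⁻ x in Ioc a b, ∫⁻ y in Ioc a b, ENNReal.ofReal (‖v y - v x‖ ^ 2) ∂ν ∂ν ≤
      ∫⁻ x in Ioc a b, ∫⁻ y in Ioc a b, ENNReal.ofReal ((φ b - φ a) ^ (2 * α + 2)) *
        ENNReal.ofReal (‖v y - v x‖ ^ 2 / |φ y - φ x| ^ (2 * α + 2)) ∂ν ∂ν := by
    refine setLIntegral_mono' measurableSet_Ioc fun x hx => ?_
    refine setLIntegral_mono' measurableSet_Ioc fun y hy => ?_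
    rw [← ENNReal.ofReal_mul (by positivity)]
    refine ENNReal.ofReal_le_ofReal ?_
    rcases eq_or_ne x y with rfl | hne
    · simp
    have hpos : 0 < |φ y - φ x| := abs_pos.2 (sub_ne_zero.2 (hφ.injective.ne hne.symm))
    have hle : |φ y - φ x| ≤ φ b - φ a := by
      have h1 := hφ hx.1; have h2 := hφ hy.1
      have h3 := hφ.monotone hx.2; have h4 := hφ.monotone hy.2
      rw [abs_le]; constructor <;> linarith
    rw [mul_div_assoc', le_div_iff₀ (by positivity), mul_comm]
    gcongr
  refine h1.trans ?_
  have h2 : ∀ x, ∫⁻ y in Ioc a b, ENNReal.ofReal ((φ b - φ a) ^ (2 * α + 2)) *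
        ENNReal.ofReal (‖v y - v x‖ ^ 2 / |φ y - φ x| ^ (2 * α + 2)) ∂ν =
      ENNReal.ofReal ((φ b - φ a) ^ (2 * α + 2)) * ∫⁻ y in Ioc a b, 
        ENNReal.ofReal (‖v y - v x‖ ^ 2 / |φ y - φ x| ^ (2 * α + 2)) ∂ν := fun x =>
    lintegral_const_mul' _ _ ENNReal.ofReal_ne_top
  simp_rw [h2]
  rw [lintegral_const_mul' _ _ ENNReal.ofReal_ne_top]
  refine (mul_le_mul_right h _).trans ?_
  rw [← ENNReal.ofReal_mul (by positivity)]
  refine ENNReal.ofReal_le_ofReal (le_of_eq ?_)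
  rw [show 2 * α + 2 = (2 * α + 1) + 1 by ring, Real.rpow_add_one hr.ne']; ring

theorem morrey_step {n : ℕ} {ν : Measure ℝ} {φ : ℝ → ℝ} {v : ℝ → En n}
    (hν : ∀ a b, a ≤ b → ν (Ioc a b) = ENNReal.ofReal (φ b - φ a))
    (hv : Continuous v) {α M r a b a' b' ξ ξ' : ℝ} (hα : 0 < α) (hM : 0 ≤ M) (hr : 0 < r)
    (ha : a ≤ a') (hb : b' ≤ b) (hab' : a' ≤ b') (hr' : φ b' - φ a' = r / 2)
    (h : ∫⁻ y in Ioc a b, ENNReal.ofReal (‖v y - v ξ‖ ^ 2) ∂ν ≤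
      ENNReal.ofReal (r ^ (2 * α + 1) * M))
    (h' : ∫⁻ y in Ioc a' b', ENNReal.ofReal (‖v y - v ξ'‖ ^ 2) ∂ν ≤
      ENNReal.ofReal ((r / 2) ^ (2 * α + 1) * M)) :
    ‖v ξ - v ξ'‖ ≤ √(8 * M) * r ^ α := by
  have h1 : ENNReal.ofReal (‖v ξ - v ξ'‖ ^ 2) * ENNReal.ofReal (r / 2) ≤
      ENNReal.ofReal 2 * (∫⁻ y in Ioc a' b', ENNReal.ofReal (‖v y - v ξ‖ ^ 2) ∂ν) +
      ENNReal.ofReal 2 * ∫⁻ y in Ioc a' b', ENNReal.ofReal (‖v y - v ξ'‖ ^ 2) ∂ν := by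
    rw [← hr', ← hν a' b' hab', ← setLIntegral_const, ← lintegral_const_mul' _ _ (by simp),
      ← lintegral_const_mul' _ _ (by simp), ← lintegral_add_left (by fun_prop)]
    refine lintegral_mono fun y => ?_
    rw [← ENNReal.ofReal_mul (by positivity),
      ← ENNReal.ofReal_mul (by positivity), ← ENNReal.ofReal_add (by positivity) (by positivity)]
    refine ENNReal.ofReal_le_ofReal ?_
    have : ‖v ξ - v ξ'‖ ≤ ‖v y - v ξ‖ + ‖v y - v ξ'‖ := by
      rw [show v ξ - v ξ' = (v y - v ξ') - (v y - v ξ) by abel, add_comm]; exact norm_sub_le _ _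
    have h0 := norm_nonneg (v ξ - v ξ')
    nlinarith [sq_nonneg (‖v y - v ξ‖ - ‖v y - v ξ'‖)]
  have h2 : (∫⁻ y in Ioc a' b', ENNReal.ofReal (‖v y - v ξ‖ ^ 2) ∂ν) ≤ 
      ENNReal.ofReal (r ^ (2 * α + 1) * M) :=
    (lintegral_mono_set (Ioc_subset_Ioc ha hb)).trans h
  have h3 : ENNReal.ofReal ((r / 2) ^ (2 * α + 1) * M) ≤ ENNReal.ofReal (r ^ (2 * α + 1) * M) := by
    refine ENNReal.ofReal_le_ofReal ?_
    gcongr; linarith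
  have h4 := h1.trans (add_le_add (mul_le_mul_right h2 _) (mul_le_mul_right (h'.trans h3) _))
  rw [← ENNReal.ofReal_mul (by positivity),
      ← ENNReal.ofReal_mul (by positivity), ← ENNReal.ofReal_add (by positivity) (by positivity),
      ENNReal.ofReal_le_ofReal_iff (by positivity), Real.rpow_add_one hr.ne'] at h4
  have h5 : ‖v ξ - v ξ'‖ ^ 2 ≤ (√(8 * M) * r ^ α) ^ 2 := by
    rw [mul_pow, Real.sq_sqrt (by positivity), sq_rpow_half _ _ hr.le]
    have : ‖v ξ - v ξ'‖ ^ 2 * r ≤ 8 * M * r ^ (2 * α) * r := by nlinarith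
    exact le_of_mul_le_mul_right this hr
  exact le_of_sq_le_sq h5 (by positivity)

theorem morrey_chain {n : ℕ} {ν : Measure ℝ} [SFinite ν] {φ : ℝ → ℝ} {v : ℝ → En n}
    (hφ : StrictMono φ) (hφc : Continuous φ)
    (hν : ∀ a b, a ≤ b → ν (Ioc a b) = ENNReal.ofReal (φ b - φ a))
    (hv : Continuous v) {α M a b x ξ : ℝ} (hα : 0 < α) (hM : 0 ≤ M) (hab : a < b)
    (h : ∫⁻ x in Ioc a b, ∫⁻ y in Ioc a b,
      ENNReal.ofReal (‖v y - v x‖ ^ 2 / |φ y - φ x| ^ (2 * α + 2)) ∂ν ∂ν ≤ ENNReal.ofReal M)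
    (hx : x ∈ Icc a b) (hξ : ξ ∈ Ioc a b) 
    (hg : ∫⁻ y in Ioc a b, ENNReal.ofReal (‖v y - v ξ‖ ^ 2) ∂ν ≤
      ENNReal.ofReal ((φ b - φ a) ^ (2 * α + 1) * M)) (N : ℕ) :
    ∃ a' b' ξ', a ≤ a' ∧ b' ≤ b ∧ a' ≤ x ∧ x ≤ b' ∧ ξ' ∈ Ioc a' b' ∧
      φ b' - φ a' = (φ b - φ a) / 2 ^ N ∧ 
      (∫⁻ y in Ioc a' b', ENNReal.ofReal (‖v y - v ξ'‖ ^ 2) ∂ν ≤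
        ENNReal.ofReal ((φ b' - φ a') ^ (2 * α + 1) * M)) ∧ 
      ‖v ξ - v ξ'‖ ≤ √(8 * M) * (φ b - φ a) ^ α * ∑ j ∈ Finset.range N, ((1 / 2 : ℝ) ^ α) ^ j := by
  have hr : 0 < φ b - φ a := sub_pos.2 (hφ hab)
  induction N with
  | zero => exact ⟨a, b, ξ, le_rfl, le_rfl, hx.1, hx.2, hξ, by simp, hg, by simp⟩
  | succ N ih =>
    obtain ⟨a', b', ξ', h1, h2, h3, h4, h5, h6, h7, h8⟩ := ih
    have hab' : a' < b' := h5.1.trans_le h5.2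
    have hmid : (φ a' + φ b') / 2 ∈ Icc (φ a') (φ b') := by
      have := hφ hab'; constructor <;> linarith
    obtain ⟨m, hm, hm2⟩ := intermediate_value_Icc hab'.le hφc.continuousOn hmid
    have key : ∀ a'' b'', a' ≤ a'' → b'' ≤ b' → a'' ≤ x → x ≤ b'' → 
        φ b'' - φ a'' = (φ b' - φ a') / 2 → ∃ ξ' , ξ' ∈ Ioc a'' b'' ∧ 
      φ b'' - φ a'' = (φ b - φ a) / 2 ^ (N + 1) ∧ 
      (∫⁻ y in Ioc a'' b'', ENNReal.ofReal (‖v y - v ξ'‖ ^ 2) ∂ν ≤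
        ENNReal.ofReal ((φ b'' - φ a'') ^ (2 * α + 1) * M)) ∧ 
      ‖v ξ - v ξ'‖ ≤ √(8 * M) * (φ b - φ a) ^ α * 
        ∑ j ∈ Finset.range (N + 1), ((1 / 2 : ℝ) ^ α) ^ j := by
      intro a'' b'' ha hb hax hbx hh
      have hpos : 0 < φ b' - φ a' := sub_pos.2 (hφ hab')
      have hlt : a'' < b'' := hφ.lt_iff_lt.1 (by linarith)
      have hsub : Ioc a'' b'' ⊆ Ioc a b := Ioc_subset_Ioc (h1.trans ha) (hb.trans h2)
      obtain ⟨ξ'', k1, k2⟩ := morrey_good hφ hν hv hα hM hlt (le_trans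
        ((lintegral_mono fun x => lintegral_mono_set hsub).trans (lintegral_mono_set hsub)) h)
      refine ⟨ξ'', k1, ?_, k2, ?_⟩
      · rw [hh, h6, pow_succ]; field_simp
      · rw [hh] at k2
        have := morrey_step hν hv hα hM hpos ha hb hlt.le hh h7 k2
        rw [h6, Real.div_rpow hr.le (by positivity)] at this
        have e : (((2:ℝ) ^ N) ^ α)⁻¹ = ((1 / 2 : ℝ) ^ α) ^ N := by
          rw [← Real.rpow_natCast, ← Real.rpow_natCast, ← Real.rpow_mul (by norm_num),
            ← Real.rpow_mul (by norm_num), one_div, Real.inv_rpow (by norm_num), mul_comm]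
        rw [div_eq_mul_inv, e] at this
        rw [Finset.sum_range_succ, mul_add]
        calc ‖v ξ - v ξ''‖ ≤ ‖v ξ - v ξ'‖ + ‖v ξ' - v ξ''‖ := norm_sub_le_norm_sub_add_norm_sub _ _ _
          _ ≤ _ := add_le_add h8 (by rw [mul_assoc]; exact this)
    rcases le_total x m with hxm | hxm
    · obtain ⟨ξ'', k⟩ := key a' m le_rfl hm.2 h3 hxm (by rw [hm2]; ring)
      exact ⟨a', m, ξ'', h1, hm.2.trans h2, h3, hxm, k⟩
    · obtain ⟨ξ'', k⟩ := key m b' hm.1 le_rfl hxm h4 (by rw [hm2]; ring)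
      exact ⟨m, b', ξ'', h1.trans hm.1, h2, hxm, h4, k⟩

/-- Morrey constant -/
def CM (α : ℝ) : ℝ := 2 * √8 / (1 - (1 / 2 : ℝ) ^ α)

theorem CM_den {α : ℝ} (hα : 0 < α) : 0 < 1 - (1 / 2 : ℝ) ^ α := 
  sub_pos.2 (Real.rpow_lt_one (by norm_num) (by norm_num) hα)

theorem CM_pos {α : ℝ} (hα : 0 < α) : 0 < CM α := by
  have := CM_den hα
  unfold CM; positivity

theorem morrey {n : ℕ} {ν : Measure ℝ} [SFinite ν] {φ : ℝ → ℝ} {v : ℝ → En n}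
    (hφ : StrictMono φ) (hφc : Continuous φ)
    (hν : ∀ a b, a ≤ b → ν (Ioc a b) = ENNReal.ofReal (φ b - φ a))
    (hv : Continuous v) {α M a b : ℝ} (hα : 0 < α) (hM : 0 ≤ M) (hab : a ≤ b)
    (h : ∫⁻ x in Ioc a b, ∫⁻ y in Ioc a b,
      ENNReal.ofReal (‖v y - v x‖ ^ 2 / |φ y - φ x| ^ (2 * α + 2)) ∂ν ∂ν ≤ ENNReal.ofReal M) :
    ‖v b - v a‖ ≤ CM α * √M * (φ b - φ a) ^ α := by
  rcases hab.eq_or_lt with rfl | hab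
  · have := CM_pos hα
    simp only [sub_self, norm_zero]; positivity
  have hr : 0 < φ b - φ a := sub_pos.2 (hφ hab)
  obtain ⟨ξ, hξ, hg⟩ := morrey_good hφ hν hv hα hM hab h
  set q : ℝ := (1 / 2 : ℝ) ^ α
  have hq0 : 0 ≤ q := by positivity
  have hq1 : 0 < 1 - q := CM_den hα
  have key : ∀ x ∈ Icc a b, ‖v ξ - v x‖ ≤ √(8 * M) * (φ b - φ a) ^ α * (1 - q)⁻¹ := by
    intro x hx
    refine le_of_forall_pos_le_add fun ε hε => ?_
    obtain ⟨δ, hδ, hcont⟩ := Metric.continuousAt_iff.1 (hv.continuousAt (x := x)) ε hε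
    have hη : 0 < min (φ (x + δ) - φ x) (φ x - φ (x - δ)) :=
      lt_min (sub_pos.2 (hφ (by linarith))) (sub_pos.2 (hφ (by linarith)))
    obtain ⟨N, hN⟩ := exists_pow_lt_of_lt_one (div_pos hη hr) (show (1/2 : ℝ) < 1 by norm_num)
    obtain ⟨a', b', ξ', h1, h2, h3, h4, h5, h6, h7, h8⟩ :=
      morrey_chain hφ hφc hν hv hα hM hab h hx hξ hg N
    have hsmall : φ b' - φ a' < min (φ (x + δ) - φ x) (φ x - φ (x - δ)) := by
      rw [h6]; rw [lt_div_iff₀ hr] at hN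
      calc _ = (1/2 : ℝ)^N * (φ b - φ a) := by rw [one_div, inv_pow]; field_simp
        _ < _ := hN
    have hb' : b' < x + δ := hφ.lt_iff_lt.1 (by
      have := hφ.monotone h3; have := hsmall.trans_le (min_le_left _ _); linarith)
    have ha' : x - δ < a' := hφ.lt_iff_lt.1 (by
      have := hφ.monotone h4; have := hsmall.trans_le (min_le_right _ _); linarith)
    have hd : dist (v ξ') (v x) < ε := hcont (by
      rw [Real.dist_eq, abs_lt]; constructor <;> linarith [h5.1, h5.2])
    rw [dist_eq_norm] at hd
    have hs : ∑ j ∈ Finset.range N, q ^ j ≤ (1 - q)⁻¹ := by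
      rw [← tsum_geometric_of_lt_one hq0 (by linarith)]
      exact (summable_geometric_of_lt_one hq0 (by linarith)).sum_le_tsum _ (fun _ _ => by positivity)
    calc ‖v ξ - v x‖ ≤ ‖v ξ - v ξ'‖ + ‖v ξ' - v x‖ := norm_sub_le_norm_sub_add_norm_sub _ _ _
      _ ≤ _ := add_le_add (h8.trans (mul_le_mul_of_nonneg_left hs (by positivity))) hd.le
  calc ‖v b - v a‖ ≤ ‖v b - v ξ‖ + ‖v ξ - v a‖ := norm_sub_le_norm_sub_add_norm_sub _ _ _
    _ ≤ _ := add_le_add ((norm_sub_rev _ _).trans_le (key b ⟨hab.le, le_rfl⟩)) (key a ⟨le_rfl, hab.le⟩)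
    _ = _ := by
      rw [CM, Real.sqrt_mul (by norm_num)]
      have : (1 : ℝ) - (1 / 2) ^ α ≠ 0 := hq1.ne'
      change √8 * √M * _ * (1 - (1 / 2) ^ α)⁻¹ + √8 * √M * _ * (1 - (1 / 2) ^ α)⁻¹ = _
      field_simp; ring

/-! ### Part 4: HS embeds in C^{1,α}; compactness; completeness -/

theorem per_deriv {n : ℕ} {u : ℝ → En n} (h : Function.Periodic u 1) :
    Function.Periodic (deriv u) 1 := fun x => by
  rw [← deriv_comp_add_const u 1 x, show (fun x => u (x + 1)) = u from funext h]

theorem per_int {n : ℕ} {u : ℝ → En n} (h : Function.Periodic u 1) (x : ℝ) (k : ℤ) :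
    u (x + k) = u x := by have := h.int_mul k x; rwa [mul_one] at this

/-- for every `x, y` there is a shifted `y'` realizing the circle distance -/
theorem dT_shift (x y : ℝ) : ∃ k : ℤ, |y + k - x| = dT x y ∧ |y + k - x| ≤ 1 / 2 := by
  obtain ⟨k, hk⟩ := dT_exists x y
  refine ⟨k, ?_, ?_⟩
  · rw [hk, ← abs_neg]; congr 1; ring
  · rw [show |y + k - x| = dT x y by rw [hk, ← abs_neg]; congr 1; ring]; exact dT_le_half x y

theorem HS.hol0 {s : ℝ} {n : ℕ} (hs : s ∈ Ioo (3 / 2 : ℝ) 2) (u : HS s n) {a b : ℝ} (hab : a ≤ b)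
    (h : b - a ≤ 1 / 2) :
    ‖deriv u.f b - deriv u.f a‖ ≤ CM (s - 3/2) * ‖u‖ * (b - a) ^ (s - 3/2) := by
  have hp := per_deriv u.mem.1
  have := morrey (ν := volume) (φ := id) (v := deriv u.f) (α := s - 3/2) (M := ‖u‖ ^ 2)
    (a := a) (b := b) strictMono_id
    continuous_id (fun a b _ => by simp) u.mem.cont_deriv (by linarith [hs.1]) (by positivity) hab ?_
  · rwa [Real.sqrt_sq (norm_nonneg _)] at this
  · refine le_trans ?_ u.gag_le
    have hsub : Ioc a b ⊆ Ioc a (a + 1) := Ioc_subset_Ioc le_rfl (by linarith)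
    rw [gagliardoSqE]
    refine le_trans (le_of_eq ?_) (per_lint2_le (F := fun x y => ENNReal.ofReal
      (‖deriv u.f y - deriv u.f x‖ ^ 2 / dT x y ^ (2 * (s - 1) + 1))) ?_ ?_ hsub hsub)
    · refine setLIntegral_congr_fun measurableSet_Ioc fun x hx => ?_
      refine setLIntegral_congr_fun measurableSet_Ioc fun y hy => ?_
      rw [dT_eq_abs, show 2 * (s - 1) + 1 = 2 * (s - 3/2) + 2 by ring]; rfl
      rw [abs_le]; constructor <;> linarith [hx.1, hx.2, hy.1, hy.2]
    · intro y x
      have := dT_add_int_left x y 1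
      simp only [Int.cast_one] at this
      simp only [this, hp x]
    · intro x y
      have := dT_add_int_right x y 1
      simp only [Int.cast_one] at this
      simp only [this, hp y]

/-- Sobolev constant -/
def Cs (s : ℝ) : ℝ := 2 + CM (s - 3/2)

theorem Cs_ge {s : ℝ} (hs : s ∈ Ioo (3 / 2 : ℝ) 2) : 2 ≤ Cs s := by
  have := CM_pos (show 0 < s - 3/2 by linarith [hs.1]); unfold Cs; linarith

theorem HS.hol {s : ℝ} {n : ℕ} (hs : s ∈ Ioo (3 / 2 : ℝ) 2) (u : HS s n) (x y : ℝ) :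
    ‖deriv u.f y - deriv u.f x‖ ≤ Cs s * ‖u‖ * dT x y ^ (s - 3/2) := by
  obtain ⟨k, h1, h2⟩ := dT_shift x y
  have h3 : deriv u.f (y + k) = deriv u.f y := per_int (per_deriv u.mem.1) y k
  rw [← h3, ← h1]
  have hC : CM (s - 3/2) ≤ Cs s := by unfold Cs; linarith
  rcases le_total x (y + k) with h | h
  · rw [abs_of_nonneg (sub_nonneg.2 h)] at h2 ⊢
    refine (u.hol0 hs h h2).trans ?_
    have : 0 ≤ y + k - x := sub_nonneg.2 h
    gcongr
  · rw [abs_sub_comm, abs_of_nonneg (sub_nonneg.2 h)] at h2 ⊢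
    rw [norm_sub_rev]
    refine (u.hol0 hs h h2).trans ?_
    have : 0 ≤ x - (y + k) := sub_nonneg.2 h
    gcongr

theorem exists_sq_le {n : ℕ} {u : ℝ → En n} (hc : Continuous u) :
    ∃ x, ‖u x‖ ^ 2 ≤ ∫ x in I01, ‖u x‖ ^ 2 := by
  have hi : IntegrableOn (fun x => ‖u x‖ ^ 2) I01 :=
    ((hc.norm.pow 2).integrableOn_Icc (a := 0) (b := 1)).mono_set Ico_subset_Icc_self
  exact exists_le_integral (μ := mu1) (f := fun x => ‖u x‖ ^ 2) hi

theorem dT_pow_le_one (x y : ℝ) {α : ℝ} (hα : 0 < α) : dT x y ^ α ≤ 1 :=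
  Real.rpow_le_one (dT_nonneg _ _) ((dT_le_half x y).trans (by norm_num)) hα.le

theorem HS.sup_d' {s : ℝ} {n : ℕ} (hs : s ∈ Ioo (3 / 2 : ℝ) 2) (u : HS s n) (x : ℝ) :
    ‖deriv u.f x‖ ≤ (1 + CM (s - 3/2)) * ‖u‖ := by
  have hα : 0 < s - 3/2 := by linarith [hs.1]
  have := CM_pos hα
  obtain ⟨x0, h0⟩ := exists_sq_le u.mem.cont_deriv
  have h0 := abs_le_of_sq_le_sq (h0.trans u.l2d_le) (norm_nonneg _)
  obtain ⟨k, h1, h2⟩ := dT_shift x x0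
  have h3 : deriv u.f (x0 + k) = deriv u.f x0 := per_int (per_deriv u.mem.1) x0 k
  rw [abs_of_nonneg (norm_nonneg _), ← h3] at h0
  have h4 : ‖deriv u.f x - deriv u.f (x0 + k)‖ ≤ CM (s - 3/2) * ‖u‖ := by
    rcases le_total x (x0 + k) with h | h
    · rw [abs_of_nonneg (sub_nonneg.2 h)] at h2
      rw [norm_sub_rev]
      refine (u.hol0 hs h h2).trans (mul_le_of_le_one_right (by positivity) ?_)
      exact Real.rpow_le_one (by linarith) (by linarith) hα.le
    · rw [abs_sub_comm, abs_of_nonneg (sub_nonneg.2 h)] at h2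
      refine (u.hol0 hs h h2).trans (mul_le_of_le_one_right (by positivity) ?_)
      exact Real.rpow_le_one (by linarith) (by linarith) hα.le
  have := norm_le_norm_add_norm_sub' (deriv u.f x) (deriv u.f (x0 + k))
  linarith

theorem HS.sup_d {s : ℝ} {n : ℕ} (hs : s ∈ Ioo (3 / 2 : ℝ) 2) (u : HS s n) (x : ℝ) :
    ‖deriv u.f x‖ ≤ Cs s * ‖u‖ := by
  refine (u.sup_d' hs x).trans ?_
  unfold Cs; gcongr; norm_num

theorem HS.lip' {s : ℝ} {n : ℕ} (hs : s ∈ Ioo (3 / 2 : ℝ) 2) (u : HS s n) (x y : ℝ) :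
    ‖u.f y - u.f x‖ ≤ (1 + CM (s - 3/2)) * ‖u‖ * dT x y := by
  obtain ⟨k, h1, h2⟩ := dT_shift x y
  have h3 : u.f (y + k) = u.f y := per_int u.mem.1 y k
  rw [← h3, ← h1, ← Real.norm_eq_abs]
  exact Convex.norm_image_sub_le_of_norm_deriv_le (s := univ) (fun x _ => u.mem.dif x)
    (fun x _ => u.sup_d' hs x) convex_univ trivial trivial

theorem HS.lip {s : ℝ} {n : ℕ} (hs : s ∈ Ioo (3 / 2 : ℝ) 2) (u : HS s n) (x y : ℝ) :
    ‖u.f y - u.f x‖ ≤ Cs s * ‖u‖ * dT x y := by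
  refine (u.lip' hs x y).trans ?_
  have := dT_nonneg x y
  unfold Cs; gcongr; norm_num

theorem HS.sup_f {s : ℝ} {n : ℕ} (hs : s ∈ Ioo (3 / 2 : ℝ) 2) (u : HS s n) (x : ℝ) :
    ‖u.f x‖ ≤ Cs s * ‖u‖ := by
  obtain ⟨x0, h0⟩ := exists_sq_le u.mem.cd.continuous
  have h0 := abs_le_of_sq_le_sq (h0.trans u.l2_le) (norm_nonneg _)
  rw [abs_of_nonneg (norm_nonneg _)] at h0
  have h1 := u.lip' hs x0 x
  have hC := CM_pos (show 0 < s - 3/2 by linarith [hs.1])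
  have h2 : (1 + CM (s - 3/2)) * ‖u‖ * dT x0 x ≤ (1 + CM (s - 3/2)) * ‖u‖ :=
    mul_le_of_le_one_right (by positivity) ((dT_le_half _ _).trans (by norm_num))
  have := norm_le_norm_add_norm_sub' (u.f x) (u.f x0)
  unfold Cs; linarith

theorem HS.compact {s : ℝ} {n : ℕ} (hs : s ∈ Ioo (3 / 2 : ℝ) 2) {A : ℝ} {U : ℕ → HS s n}
    (hA : ∀ k, ‖U k‖ ≤ A) {u w : ℝ → En n}
    (hu : ∀ x, Tendsto (fun k => (U k).f x) atTop (𝓝 (u x)))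
    (hw : ∀ x, Tendsto (fun k => deriv (U k).f x) atTop (𝓝 (w x))) :
    ∃ V : HS s n, V.f = u ∧ deriv u = w ∧ ‖V‖ ≤ A := by
  have hα : 0 < s - 3/2 := by linarith [hs.1]
  have hC := Cs_ge hs
  have hA0 : 0 ≤ A := (norm_nonneg _).trans (hA 0)
  have hwc : Continuous w := by
    have hb : ∀ x y, ‖w y - w x‖ ≤ Cs s * A * |y - x| ^ (s - 3/2) := fun x y => by
      refine le_of_tendsto ((hw y).sub (hw x)).norm (Eventually.of_forall fun k => ?_)
      refine ((U k).hol hs x y).trans ?_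
      have := dT_nonneg x y
      have := dT_le_abs x y
      have := hA k
      gcongr
    rw [continuous_iff_continuousAt]
    intro x
    rw [ContinuousAt, tendsto_iff_norm_sub_tendsto_zero]
    refine squeeze_zero (fun _ => norm_nonneg _) (fun y => hb x y) ?_
    have : Continuous fun y : ℝ => Cs s * A * |y - x| ^ (s - 3/2) := by
      refine continuous_const.mul (Continuous.rpow_const (by fun_prop) fun y => Or.inr hα.le)
    have := this.tendsto x
    simpa [Real.zero_rpow hα.ne'] using this
  have hint : ∀ x, u x = u 0 + ∫ t in (0:ℝ)..x, w t := fun x => by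
    have h1 : Tendsto (fun k => ∫ t in (0:ℝ)..x, deriv (U k).f t) atTop
        (𝓝 (∫ t in (0:ℝ)..x, w t)) := by
      refine intervalIntegral.tendsto_integral_filter_of_dominated_convergence
        (fun _ => Cs s * A) (Eventually.of_forall fun k => ?_) (Eventually.of_forall fun k => ?_)
        (by simp) (Eventually.of_forall fun x _ => hw x)
      · exact (U k).mem.cont_deriv.aestronglyMeasurable
      · exact Eventually.of_forall fun x _ => ((U k).sup_d hs x).trans (by gcongr; exact hA k)
    have h2 : (fun k => ∫ t in (0:ℝ)..x, deriv (U k).f t) = fun k => (U k).f x - (U k).f 0 := by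
      funext k
      exact intervalIntegral.integral_deriv_eq_sub (fun t _ => (U k).mem.dif t)
        ((U k).mem.cont_deriv.intervalIntegrable _ _)
    rw [h2] at h1
    have := tendsto_nhds_unique h1 ((hu x).sub (hu 0))
    rw [this]; abel
  have hder : ∀ x, HasDerivAt u (w x) x := fun x => by
    rw [funext hint]
    exact (intervalIntegral.integral_hasDerivAt_right (hwc.intervalIntegrable _ _)
      (hwc.stronglyMeasurableAtFilter _ _) hwc.continuousAt).const_add _
  have hdu : deriv u = w := funext fun x => (hder x).deriv
  have hcd : ContDiff ℝ 1 u := by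
    rw [contDiff_one_iff_deriv, hdu]
    exact ⟨fun x => (hder x).differentiableAt, hwc⟩
  have hper : Function.Periodic u 1 := fun x => by
    have h1 := hu (x + 1)
    simp only [(U _).mem.1 x] at h1
    exact tendsto_nhds_unique h1 (hu x)
  have hF : ∫⁻ z, ENNReal.ofReal (‖Jf s u z‖ ^ 2) ∂mu2 ≤ ENNReal.ofReal (A ^ 2) := by
    have hlim : ∀ z, Tendsto (fun k => ENNReal.ofReal (‖Jf s (U k).f z‖ ^ 2)) atTop
        (𝓝 (ENNReal.ofReal (‖Jf s u z‖ ^ 2))) := fun z => by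
      refine ENNReal.tendsto_ofReal ?_
      simp only [Jf_normsq, hdu]
      exact (((hu _).norm.pow 2).add ((hw _).norm.pow 2)).add
        ((((hw _).sub (hw _)).norm.pow 2).div_const _)
    calc _ = ∫⁻ z, liminf (fun k => ENNReal.ofReal (‖Jf s (U k).f z‖ ^ 2)) atTop ∂mu2 :=
          lintegral_congr fun z => (hlim z).liminf_eq.symm
      _ ≤ liminf (fun k => ∫⁻ z, ENNReal.ofReal (‖Jf s (U k).f z‖ ^ 2) ∂mu2) atTop :=
          lintegral_liminf_le fun k =>
            ENNReal.measurable_ofReal.comp ((Jf_cont s (U k).mem.cd).norm.pow_const 2)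
      _ ≤ liminf (fun _ : ℕ => ENNReal.ofReal (A ^ 2)) atTop := by
          refine liminf_le_liminf (Eventually.of_forall fun k => ?_)
          rw [← HS.normsq_lint]
          refine ENNReal.ofReal_le_ofReal ?_
          have := hA k
          gcongr
      _ = _ := by simp
  have hmem : InHs s u := by
    refine ⟨hper, hcd, ?_⟩
    rw [Jf_lint s hcd] at hF
    exact (le_add_self.trans hF).trans_lt ENNReal.ofReal_lt_top
  refine ⟨HS.mk u hmem, rfl, hdu, ?_⟩
  have := (HS.mk u hmem).normsq_lint
  rw [HS.mk_f] at this
  rw [← this, ENNReal.ofReal_le_ofReal_iff (by positivity)] at hF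
  exact le_of_sq_le_sq hF hA0

theorem HS.complete {s : ℝ} {n : ℕ} (hs : s ∈ Ioo (3 / 2 : ℝ) 2) : CompleteSpace (HS s n) := by
  refine Metric.complete_of_cauchySeq_tendsto fun U hU => ?_
  have hC := Cs_ge hs
  have h1 : ∀ x, ∃ l, Tendsto (fun k => (U k).f x) atTop (𝓝 l) := fun x => by
    refine cauchySeq_tendsto_of_complete ?_
    rw [Metric.cauchySeq_iff'] at hU ⊢
    intro ε hε
    obtain ⟨N, hN⟩ := hU (ε / Cs s) (by positivity)
    refine ⟨N, fun k hk => ?_⟩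
    have := (U k - U N).sup_f hs x
    rw [HS.sub_f, Pi.sub_apply, ← dist_eq_norm, ← dist_eq_norm] at this
    have h2 := hN k hk
    rw [lt_div_iff₀ (by positivity)] at h2; linarith
  have h2 : ∀ x, ∃ l, Tendsto (fun k => deriv (U k).f x) atTop (𝓝 l) := fun x => by
    refine cauchySeq_tendsto_of_complete ?_
    rw [Metric.cauchySeq_iff'] at hU ⊢
    intro ε hε
    obtain ⟨N, hN⟩ := hU (ε / Cs s) (by positivity)
    refine ⟨N, fun k hk => ?_⟩
    have := (U k - U N).sup_d hs x
    rw [HS.dsub, ← dist_eq_norm, ← dist_eq_norm] at this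
    have h2 := hN k hk
    rw [lt_div_iff₀ (by positivity)] at h2; linarith
  choose u hu using h1
  choose w hw using h2
  obtain ⟨R, hR⟩ := hU.norm_bddAbove
  obtain ⟨V, hV, hdV, -⟩ := HS.compact hs (fun k => hR ⟨k, rfl⟩) hu hw
  refine ⟨V, ?_⟩
  rw [Metric.tendsto_atTop]
  intro ε hε
  rw [Metric.cauchySeq_iff] at hU
  obtain ⟨N, hN⟩ := hU (ε / 2) (by positivity)
  refine ⟨N, fun k hk => ?_⟩
  obtain ⟨V', hV', -, hle⟩ := HS.compact hs (U := fun m => U (m + N) - U k) (A := ε / 2)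
    (u := u - (U k).f) (w := w - deriv (U k).f)
    (fun m => by rw [← dist_eq_norm]; exact (hN _ (by simp) _ hk).le)
    (fun x => by
      simp only [HS.sub_f, Pi.sub_apply]
      exact ((tendsto_add_atTop_iff_nat N).2 (hu x)).sub tendsto_const_nhds)
    (fun x => by
      simp only [HS.dsub, Pi.sub_apply]
      exact ((tendsto_add_atTop_iff_nat N).2 (hw x)).sub tendsto_const_nhds)
  have : V' = V - U k := HS.ext' (by rw [hV', HS.sub_f, hV])
  rw [dist_comm, dist_eq_norm, ← this]; linarith

/-! ### Part 5: Hardy -/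

/-- signed circle difference -/
def hT (x y : ℝ) : ℝ := (y - x) - round (y - x)

theorem hT_abs (x y : ℝ) : |hT x y| = dT x y := by rw [dT_comm, dT_eq]; rfl

theorem hT_sq (x y : ℝ) : hT x y ^ 2 = dT x y ^ 2 := by rw [← hT_abs, sq_abs]

theorem hT_per {n : ℕ} {u : ℝ → En n} (h : Function.Periodic u 1) (x y : ℝ) :
    u (x + hT x y) = u y := by
  rw [← per_int h (x + hT x y) (round (y - x))]; congr 1; unfold hT; ring

theorem measurable_hT : Measurable fun z : ℝ × ℝ => hT z.1 z.2 := by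
  have h : Measurable (fun x : ℝ => ((round x : ℤ) : ℝ)) := by
    have : Measurable (round : ℝ → ℤ) := by
      rw [show (round : ℝ → ℤ) = fun x => ⌊x + 1 / 2⌋ from funext round_eq]
      exact Int.measurable_floor.comp (measurable_id.add_const _)
    exact measurable_from_top.comp this
  have h1 : Measurable (fun z : ℝ × ℝ => z.2 - z.1) := measurable_snd.sub measurable_fst
  exact h1.sub (h.comp h1)

theorem hT_small {x h : ℝ} (hh : h ∈ Ioo (-(1/2) : ℝ) (1/2)) : hT x (x + h) = h := by
  have : round (x + h - x) = 0 := by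
    rw [add_sub_cancel_left, round_eq_zero_iff]; exact ⟨hh.1.le, hh.2⟩
  unfold hT; rw [this]; simp

theorem hT_add_one (x y : ℝ) : hT x (y + 1) = hT x y := by
  unfold hT
  rw [show y + 1 - x = (y - x) + 1 by ring, round_add_one]; push_cast; ring

def nf {n : ℕ} (s : ℝ) (u : ℝ → En n) (z : ℝ × ℝ) : En n :=
  (dT z.1 z.2 ^ (s + 1/2))⁻¹ • (u z.2 - u z.1 - hT z.1 z.2 • deriv u z.1)

theorem nf_meas {n : ℕ} (s : ℝ) {u : ℝ → En n} (hu : ContDiff ℝ 1 u) : Measurable (nf s u) := by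
  have hc := hu.continuous.measurable
  have hd := (hu.continuous_deriv le_rfl).measurable
  exact ((measurable_dT.pow_const _).inv).smul (((hc.comp measurable_snd).sub
    (hc.comp measurable_fst)).sub (measurable_hT.smul (hd.comp measurable_fst)))

theorem sq_integral_le {g : ℝ → ℝ} (hg : Continuous g) :
    (∫ t in (0:ℝ)..1, g t) ^ 2 ≤ ∫ t in (0:ℝ)..1, g t ^ 2 := by
  set c := ∫ t in (0:ℝ)..1, g t
  have h0 : 0 ≤ ∫ t in (0:ℝ)..1, (g t - c) ^ 2 :=
    intervalIntegral.integral_nonneg (by norm_num) fun t _ => by positivity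
  have h1 : ∫ t in (0:ℝ)..1, (g t - c) ^ 2 = (∫ t in (0:ℝ)..1, g t ^ 2) - 2 * c * c + c ^ 2 := by
    have : ∀ t, (g t - c) ^ 2 = g t ^ 2 - 2 * c * g t + c ^ 2 := fun t => by ring
    simp only [this]
    rw [intervalIntegral.integral_add, intervalIntegral.integral_sub,
      intervalIntegral.integral_const_mul]
    · simp [c]
    all_goals exact Continuous.intervalIntegrable (by fun_prop) _ _
  nlinarith

theorem nf_ptw {n : ℕ} (s : ℝ) {u : ℝ → En n} (hu : ContDiff ℝ 1 u) (x : ℝ) {h : ℝ} 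
    (hh : h ∈ Ioo (-(1/2) : ℝ) (1/2)) :
    ENNReal.ofReal (‖nf s u (x, x + h)‖ ^ 2) ≤ ∫⁻ θ in Ioc (0:ℝ) 1,
      ENNReal.ofReal (‖deriv u (x + θ * h) - deriv u x‖ ^ 2 / |h| ^ (2 * (s - 1) + 1)) := by
  have hd := hu.continuous_deriv le_rfl
  rcases eq_or_ne h 0 with rfl | h0
  · have := hT_small (x := x) hh
    rw [add_zero] at this
    simp [nf, this]
  have hpos : 0 < |h| := abs_pos.2 h0
  have e1 : u (x + h) - u x - h • deriv u x = h • ∫ θ in (0:ℝ)..1, (deriv u (x + θ * h) - deriv u x) := by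
    have h1 : ∫ θ in (0:ℝ)..1, h • (deriv u (x + θ * h)) = u (x + 1 * h) - u (x + 0 * h) := by
      refine intervalIntegral.integral_eq_sub_of_hasDerivAt (f := fun θ => u (x + θ * h))
        (fun θ _ => ?_) (Continuous.intervalIntegrable (by fun_prop) _ _)
      have := ((hu.differentiable one_ne_zero) (x + θ * h)).hasDerivAt.scomp θ
        (((hasDerivAt_id θ).mul_const h).const_add x)
      simpa [Function.comp_def] using this
    rw [intervalIntegral.integral_sub (Continuous.intervalIntegrable (by fun_prop) _ _)
      (by simp), smul_sub, ← intervalIntegral.integral_smul, h1]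
    simp
  have hdT : dT x (x + h) = |h| := by rw [← hT_abs, hT_small hh]
  rw [← ofReal_integral_eq_lintegral_ofReal, ← intervalIntegral.integral_of_le zero_le_one]
  rotate_left
  · exact (Continuous.integrableOn_Icc (by fun_prop)).mono_set Ioc_subset_Icc_self
  · exact Eventually.of_forall fun θ => by positivity
  refine ENNReal.ofReal_le_ofReal ?_
  rw [intervalIntegral.integral_div]
  simp only [nf, hT_small hh, e1, hdT]
  rw [norm_smul, norm_smul, mul_pow, mul_pow, norm_inv, inv_pow, Real.norm_eq_abs, sq_abs,
    sq_rpow_half _ _ hpos.le, Real.norm_eq_abs]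
  have e2 : (|h| ^ (2 * (s + 1/2)))⁻¹ * |h| ^ 2 = (|h| ^ (2 * (s - 1) + 1))⁻¹ := by
    rw [show 2 * (s + 1/2) = (2 * (s - 1) + 1) + 2 by ring, Real.rpow_add hpos, Real.rpow_two]
    field_simp
  rw [← mul_assoc, e2, inv_mul_eq_div]
  gcongr
  have h3 : ‖∫ θ in (0:ℝ)..1, (deriv u (x + θ * h) - deriv u x)‖ ≤ 
      ∫ θ in (0:ℝ)..1, ‖deriv u (x + θ * h) - deriv u x‖ :=
    intervalIntegral.norm_integral_le_integral_norm zero_le_one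
  calc _ ≤ (∫ θ in (0:ℝ)..1, ‖deriv u (x + θ * h) - deriv u x‖) ^ 2 := by gcongr
    _ ≤ _ := sq_integral_le (by fun_prop)

theorem scale_lint {F : ℝ → ℝ≥0∞} {θ p : ℝ} (hθ : θ ∈ Ioc (0:ℝ) 1) (hp : 1 ≤ p) :
    ENNReal.ofReal (θ ^ p) * ∫⁻ h in Ioc (-(1/2) : ℝ) (1/2), F (θ * h) ≤
      ∫⁻ h in Ioc (-(1/2) : ℝ) (1/2), F h := by
  have h0 := hθ.1.ne'
  have hmap : Measure.map (θ * ·) (volume.restrict (Ioc (-(1/2) : ℝ) (1/2))) =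
      (ENNReal.ofReal |θ⁻¹| • volume).restrict (Ioc (-(θ/2)) (θ/2)) := by
    rw [← Real.map_volume_mul_left h0, Measure.restrict_map (measurable_const_mul θ) measurableSet_Ioc]
    congr 2
    ext h
    have := hθ.1
    simp only [mem_Ioc, mem_preimage]
    constructor
    · rintro ⟨h1, h2⟩; constructor <;> nlinarith
    · rintro ⟨h1, h2⟩; constructor <;> nlinarith
  have h1 : ∫⁻ h in Ioc (-(1/2) : ℝ) (1/2), F (θ * h) = 
      ENNReal.ofReal |θ⁻¹| * ∫⁻ h in Ioc (-(θ/2)) (θ/2), F h := by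
    have := (Homeomorph.mulLeft₀ θ h0).measurableEmbedding.lintegral_map
      (μ := volume.restrict (Ioc (-(1/2) : ℝ) (1/2))) F
    change ∫⁻ h, F h ∂(Measure.map (θ * ·) _) = ∫⁻ h in Ioc (-(1/2) : ℝ) (1/2), F (θ * h) at this
    rw [← this, hmap, Measure.restrict_smul, lintegral_smul_measure]; rfl
  rw [h1, ← mul_assoc, ← ENNReal.ofReal_mul (by have := hθ.1; positivity)]
  have h2 : θ ^ p * |θ⁻¹| ≤ 1 := by
    rw [abs_of_nonneg (inv_nonneg.2 hθ.1.le), ← div_eq_mul_inv, div_le_one hθ.1]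
    calc θ ^ p ≤ θ ^ (1:ℝ) := Real.rpow_le_rpow_of_exponent_ge hθ.1 hθ.2 hp
      _ = θ := Real.rpow_one θ
  calc _ ≤ 1 * ∫⁻ h in Ioc (-(θ/2)) (θ/2), F h := by
        gcongr; rw [← ENNReal.ofReal_one]; exact ENNReal.ofReal_le_ofReal h2
    _ ≤ _ := by
        rw [one_mul]
        exact lintegral_mono_set (Ioc_subset_Ioc (by linarith [hθ.2]) (by linarith [hθ.2]))

theorem swap3 {G : ℝ → ℝ → ℝ → ℝ≥0∞} {μ ν κ : Measure ℝ} [SFinite μ] [SFinite ν] [SFinite κ]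
    (hG : Measurable fun w : ℝ × ℝ × ℝ => G w.1 w.2.1 w.2.2) :
    ∫⁻ x, ∫⁻ h, ∫⁻ θ, G x h θ ∂κ ∂ν ∂μ = ∫⁻ θ, ∫⁻ x, ∫⁻ h, G x h θ ∂ν ∂μ ∂κ := by
  have h1 : ∀ x, ∫⁻ h, ∫⁻ θ, G x h θ ∂κ ∂ν = ∫⁻ θ, ∫⁻ h, G x h θ ∂ν ∂κ := fun x => by
    have h3 : Measurable fun w : ℝ × ℝ => (x, w.1, w.2) := measurable_prodMk_left
    exact lintegral_lintegral_swap (hG.comp h3).aemeasurable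
  simp only [h1]
  refine lintegral_lintegral_swap (Measurable.aemeasurable ?_)
  have h3 : Measurable fun w : (ℝ × ℝ) × ℝ => (w.1.1, w.2, w.1.2) :=
    measurable_fst.fst.prodMk (measurable_snd.prodMk measurable_fst.snd)
  exact Measurable.lintegral_prod_right' (hG.comp h3)

theorem hardy {s : ℝ} {n : ℕ} (hs : s ∈ Ioo (3 / 2 : ℝ) 2) (u : HS s n) :
    ∫⁻ z, ENNReal.ofReal (‖nf s u.f z‖ ^ 2) ∂mu2 ≤ ENNReal.ofReal (‖u‖ ^ 2) := by
  have hd := u.mem.cont_deriv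
  have hp := per_deriv u.mem.1
  set p := 2 * (s - 1) + 1
  have hp1 : 1 ≤ p := by simp only [p]; linarith [hs.1]
  have hm : Measurable (Function.uncurry fun x y => ENNReal.ofReal (‖nf s u.f (x, y)‖ ^ 2)) :=
    ENNReal.measurable_ofReal.comp ((nf_meas s u.mem.cd).norm.pow_const 2)
  have e0 := mu2_iter hm
  rw [← e0]
  have hG : Measurable fun w : ℝ × ℝ × ℝ =>
    ENNReal.ofReal (‖deriv u.f (w.1 + w.2.2 * w.2.1) - deriv u.f w.1‖ ^ 2 / |w.2.1| ^ p) := by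
    refine ENNReal.measurable_ofReal.comp (Measurable.div ?_ ?_)
    · exact Continuous.measurable (by fun_prop)
    · exact (Continuous.measurable (by fun_prop)).pow_const _
  calc _ ≤ ∫⁻ x in I01, ∫⁻ h in Ioc (-(1/2) : ℝ) (1/2), ∫⁻ θ in Ioc (0:ℝ) 1,
      ENNReal.ofReal (‖deriv u.f (x + θ * h) - deriv u.f x‖ ^ 2 / |h| ^ p) := by
        refine lintegral_mono fun x => ?_
        rw [per_lint_shift (F := fun y => ENNReal.ofReal (‖nf s u.f (x, y)‖ ^ 2)) ?_ x]
        · rw [← restrict_Ioo_eq_restrict_Ioc]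
          exact setLIntegral_mono' measurableSet_Ioo fun h hh => nf_ptw s u.mem.cd x hh
        · intro y
          have := dT_add_int_right x y 1
          simp only [Int.cast_one] at this
          simp only [nf, this, hT_add_one, u.mem.1 y]
    _ = ∫⁻ θ in Ioc (0:ℝ) 1, ∫⁻ x in I01, ∫⁻ h in Ioc (-(1/2) : ℝ) (1/2),
      ENNReal.ofReal (‖deriv u.f (x + θ * h) - deriv u.f x‖ ^ 2 / |h| ^ p) := 
        swap3 (G := fun x h θ => ENNReal.ofReal (‖deriv u.f (x + θ * h) - deriv u.f x‖ ^ 2 / |h| ^ p)) hG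
    _ ≤ ∫⁻ θ in Ioc (0:ℝ) 1, ENNReal.ofReal (‖u‖ ^ 2) := by
        refine setLIntegral_mono' measurableSet_Ioc fun θ hθ => le_trans ?_ u.gag_le
        rw [gagliardoSqE]
        refine lintegral_mono fun x => ?_
        rw [per_lint_shift (F := fun y => ENNReal.ofReal
          (‖deriv u.f y - deriv u.f x‖ ^ 2 / dT x y ^ (2 * (s - 1) + 1))) ?_ x]
        · refine le_trans (le_of_eq ?_) (scale_lint hθ hp1)
          rw [← lintegral_const_mul' _ _ ENNReal.ofReal_ne_top]
          refine setLIntegral_congr_fun measurableSet_Ioc fun h hh => ?_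
          have h1 : |x + θ * h - x| = θ * |h| := by
            rw [add_sub_cancel_left, abs_mul, abs_of_pos hθ.1]
          have h2 : dT x (x + θ * h) = θ * |h| := by
            rw [dT_eq_abs, h1]
            rw [h1]
            have : |h| ≤ 1/2 := abs_le.2 ⟨hh.1.le, hh.2⟩
            have := abs_nonneg h
            nlinarith [hθ.2, hθ.1]
          have hθp : 0 < θ ^ p := Real.rpow_pos_of_pos hθ.1 _
          simp only [h2]
          rw [← ENNReal.ofReal_mul hθp.le]
          congr 1
          rw [Real.mul_rpow hθ.1.le (abs_nonneg h)]
          change _ = θ ^ p * (_ / (θ ^ p * |h| ^ p))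
          field_simp
        · intro y
          have := dT_add_int_right x y 1
          simp only [Int.cast_one] at this
          simp only [this, hp y]
    _ = _ := by simp

set_option linter.unusedSectionVars false
/-! ### Part 6: the LB calculus and the map T -/

def LB {E : Type*} [NormedAddCommGroup E] (δ M : ℝ) (a b : E) : Prop :=
  ‖a‖ ≤ M ∧ ‖b‖ ≤ M ∧ ‖a - b‖ ≤ M * δ

section LBs
variable {E : Type*} [NormedAddCommGroup E] [InnerProductSpace ℝ E] {δ M M' : ℝ} {a b a' b' : E}

theorem LB.nn (h : LB δ M a b) : 0 ≤ M := (norm_nonneg _).trans h.1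

theorem LB.mono (hδ : 0 < δ) (h : LB δ M a b) (hM : M ≤ M') : LB δ M' a b :=
  ⟨h.1.trans hM, h.2.1.trans hM, h.2.2.trans (by gcongr)⟩

theorem LB.const (hδ : 0 < δ) (h : ‖a‖ ≤ M) : LB δ M a a :=
  ⟨h, h, by rw [sub_self, norm_zero]; have := (norm_nonneg _).trans h; positivity⟩

theorem LB.sub (h : LB δ M a b) (h' : LB δ M' a' b') : LB δ (M + M') (a - a') (b - b') := by
  refine ⟨(norm_sub_le _ _).trans (add_le_add h.1 h'.1),
    (norm_sub_le _ _).trans (add_le_add h.2.1 h'.2.1), ?_⟩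
  rw [show a - a' - (b - b') = (a - b) - (a' - b') by abel, add_mul]
  exact (norm_sub_le _ _).trans (add_le_add h.2.2 h'.2.2)

theorem LB.smul (hδ : 0 < δ) {x y : ℝ} (h : LB δ M x y) (h' : LB δ M' a b) :
    LB δ (2 * (M * M')) (x • a) (y • b) := by
  have := h.nn; have := h'.nn
  have hp : ∀ (x : ℝ) (a : E), ‖x‖ ≤ M → ‖a‖ ≤ M' → ‖x • a‖ ≤ 2 * (M * M') := fun x a h1 h2 => by
    have : 0 ≤ M * M' := by positivity
    calc ‖x • a‖ = ‖x‖ * ‖a‖ := norm_smul _ _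
      _ ≤ M * M' := by gcongr
      _ ≤ _ := by linarith
  refine ⟨hp _ _ h.1 h'.1, hp _ _ h.2.1 h'.2.1, ?_⟩
  rw [show x • a - y • b = (x - y) • a + y • (a - b) by rw [sub_smul, smul_sub]; abel]
  calc _ ≤ ‖x - y‖ * ‖a‖ + ‖y‖ * ‖a - b‖ := by
        rw [← norm_smul, ← norm_smul]; exact norm_add_le _ _
    _ ≤ (M * δ) * M' + M * (M' * δ) := add_le_add 
        (mul_le_mul h.2.2 h'.1 (norm_nonneg _) (by positivity))
        (mul_le_mul h.2.1 h'.2.2 (norm_nonneg _) (by positivity))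
    _ = _ := by ring

theorem LB.mul (hδ : 0 < δ) {x y x' y' : ℝ} (h : LB δ M x y) (h' : LB δ M' x' y') :
    LB δ (2 * (M * M')) (x * x') (y * y') := LB.smul hδ h h'

theorem LB.inner (hδ : 0 < δ) (h : LB δ M a b) (h' : LB δ M' a' b') :
    LB δ (2 * (M * M')) ⟪a, a'⟫ ⟪b, b'⟫ := by
  have := h.nn; have := h'.nn
  have hp : ∀ (x a : E), ‖x‖ ≤ M → ‖a‖ ≤ M' → ‖⟪x, a⟫‖ ≤ 2 * (M * M') := fun x a h1 h2 => by
    have : 0 ≤ M * M' := by positivity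
    calc ‖⟪x, a⟫‖ ≤ ‖x‖ * ‖a‖ := norm_inner_le_norm _ _
      _ ≤ M * M' := by gcongr
      _ ≤ _ := by linarith
  refine ⟨hp _ _ h.1 h'.1, hp _ _ h.2.1 h'.2.1, ?_⟩
  rw [show ⟪a, a'⟫ - ⟪b, b'⟫ = ⟪a - b, a'⟫ + ⟪b, a' - b'⟫ by
    rw [inner_sub_left, inner_sub_right]; ring]
  calc _ ≤ ‖a - b‖ * ‖a'‖ + ‖b‖ * ‖a' - b'‖ :=
        (norm_add_le _ _).trans (add_le_add (norm_inner_le_norm _ _) (norm_inner_le_norm _ _))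
    _ ≤ (M * δ) * M' + M * (M' * δ) := add_le_add 
        (mul_le_mul h.2.2 h'.1 (norm_nonneg _) (by positivity))
        (mul_le_mul h.2.1 h'.2.2 (norm_nonneg _) (by positivity))
    _ = _ := by ring

theorem LB.norm (h : LB δ M a b) : LB δ M ‖a‖ ‖b‖ := by
  refine ⟨by rw [norm_norm]; exact h.1, by rw [norm_norm]; exact h.2.1, ?_⟩
  exact (abs_norm_sub_norm_le _ _).trans h.2.2

end LBs

theorem rpow_lip (r : ℝ) {c B : ℝ} (hc : 0 < c) : ∃ K, 0 < K ∧ ∀ x ∈ Icc c B, ∀ y ∈ Icc c B,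
    |x ^ r| ≤ K ∧ |x ^ r - y ^ r| ≤ K * |x - y| := by
  have h1 : ContinuousOn (fun x : ℝ => x ^ r) (Icc c B) := fun x hx =>
    (Real.continuousAt_rpow_const _ _ (Or.inl (hc.trans_le hx.1).ne')).continuousWithinAt
  have h2 : ContinuousOn (fun x : ℝ => r * x ^ (r - 1)) (Icc c B) := fun x hx =>
    (continuousAt_const.mul (Real.continuousAt_rpow_const _ _
      (Or.inl (hc.trans_le hx.1).ne'))).continuousWithinAt
  obtain ⟨K1, hK1⟩ := isCompact_Icc.exists_bound_of_continuousOn h1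
  obtain ⟨K2, hK2⟩ := isCompact_Icc.exists_bound_of_continuousOn h2
  refine ⟨max (max K1 K2) 1, by positivity, fun x hx y hy => ⟨?_, ?_⟩⟩
  · exact (hK1 x hx).trans ((le_max_left _ _).trans (le_max_left _ _))
  · have := Convex.norm_image_sub_le_of_norm_hasDerivWithin_le (f := fun x : ℝ => x ^ r)
      (f' := fun x => r * x ^ (r - 1)) (s := Icc c B) (C := max (max K1 K2) 1)
      (fun x hx => (Real.hasDerivAt_rpow_const (Or.inl (hc.trans_le hx.1).ne')).hasDerivWithinAt)
      (fun x hx => (hK2 x hx).trans ((le_max_right _ _).trans (le_max_left _ _))) (convex_Icc _ _)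
      hy hx
    exact this

theorem LB.rpow (r : ℝ) {c M : ℝ} (hc : 0 < c) : ∃ K, 0 < K ∧ ∀ δ x y : ℝ, 0 < δ → LB δ M x y →
    c ≤ x → c ≤ y → LB δ K (x ^ r) (y ^ r) := by
  obtain ⟨K, hK, h⟩ := rpow_lip r (B := M) hc
  refine ⟨K * (1 + |M|), by positivity, fun δ x y hδ hxy hx hy => ?_⟩
  have hx' : x ∈ Icc c M := ⟨hx, (le_abs_self x).trans hxy.1⟩
  have hy' : y ∈ Icc c M := ⟨hy, (le_abs_self y).trans hxy.2.1⟩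
  have hM := hxy.nn
  have e : K ≤ K * (1 + |M|) := le_mul_of_one_le_right hK.le (by linarith [abs_nonneg M])
  refine ⟨(h x hx' x hx').1.trans e, (h y hy' y hy').1.trans e, ?_⟩
  refine (h x hx' y hy').2.trans ?_
  have h3 : |x - y| ≤ M * δ := hxy.2.2
  calc K * |x - y| ≤ K * (M * δ) := by gcongr
    _ ≤ K * ((1 + M) * δ) := by gcongr; linarith
    _ = _ := by rw [abs_of_nonneg hM]; ring

/-- sets of uniformly embedded curves -/
def KK (s : ℝ) (n : ℕ) (A c : ℝ) : Set (HS s n) :=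
  {γ | ‖γ‖ ≤ A ∧ ∀ x y, c * dT x y ≤ ‖γ.f y - γ.f x‖}

theorem KK.imm {s : ℝ} {n : ℕ} {A c : ℝ} {γ : HS s n} (h : γ ∈ KK s n A c) (x : ℝ) :
    c ≤ ‖deriv γ.f x‖ := by
  have h1 := (hasDerivAt_iff_tendsto_slope_zero.1 (γ.mem.dif x).hasDerivAt).norm
  refine ge_of_tendsto h1 ?_
  have h2 : ∀ᶠ t : ℝ in 𝓝[≠] 0, t ∈ Ioo (-(1/2) : ℝ) (1/2) :=
    nhdsWithin_le_nhds (Ioo_mem_nhds (by norm_num) (by norm_num))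
  filter_upwards [h2, self_mem_nhdsWithin] with t ht ht0
  have h3 := h.2 x (x + t)
  rw [← hT_abs, hT_small ht] at h3
  rw [norm_smul, norm_inv, Real.norm_eq_abs, inv_mul_eq_div, le_div_iff₀ (abs_pos.2 ht0)]
  exact h3

theorem KK.inM {s : ℝ} {n : ℕ} {A c : ℝ} (hc : 0 < c) {γ : HS s n} (h : γ ∈ KK s n A c) :
    InM s γ.f := by
  refine ⟨γ.mem, fun x hx y hy hxy => ?_, fun x h0 => ?_⟩
  · by_contra hne
    have h1 := h.2 x y
    rw [hxy, sub_self, norm_zero] at h1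
    have := dT_pos hx hy hne
    nlinarith
  · have := KK.imm h x
    rw [h0, norm_zero] at this; linarith

theorem KK.mono {s : ℝ} {n : ℕ} {A c A' c' : ℝ} {γ : HS s n} (h : γ ∈ KK s n A c) (hA : A ≤ A')
    (hc : c' ≤ c) : γ ∈ KK s n A' c' :=
  ⟨h.1.trans hA, fun x y => (mul_le_mul_of_nonneg_right hc (dT_nonneg x y)).trans (h.2 x y)⟩

theorem KK.pert {s : ℝ} {n : ℕ} (hs : s ∈ Ioo (3 / 2 : ℝ) 2) {A c ρ : ℝ} {γ γ' : HS s n}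
    (h : γ ∈ KK s n A c) (hρ : ‖γ' - γ‖ ≤ ρ) : γ' ∈ KK s n (A + ρ) (c - Cs s * ρ) := by
  have hC := Cs_ge hs
  refine ⟨?_, fun x y => ?_⟩
  · have := norm_le_norm_add_norm_sub' γ' γ
    linarith [h.1]
  · have h1 := (γ' - γ).lip hs x y
    rw [HS.sub_f, Pi.sub_apply, Pi.sub_apply] at h1
    have h2 := h.2 x y
    have hd := dT_nonneg x y
    have h3 : Cs s * ‖γ' - γ‖ * dT x y ≤ Cs s * ρ * dT x y := by gcongr
    have h4 : ‖γ.f y - γ.f x‖ ≤ ‖γ'.f y - γ'.f x‖ + ‖γ'.f y - γ.f y - (γ'.f x - γ.f x)‖ := by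
      rw [show γ.f y - γ.f x = (γ'.f y - γ'.f x) - (γ'.f y - γ.f y - (γ'.f x - γ.f x)) by abel]
      exact norm_sub_le _ _
    linarith

theorem tayl {s : ℝ} {n : ℕ} (hs : s ∈ Ioo (3 / 2 : ℝ) 2) (u : HS s n) (x y : ℝ) :
    ‖u.f y - u.f x - hT x y • deriv u.f x‖ ≤ Cs s * ‖u‖ * dT x y ^ (s - 3/2) * dT x y := by
  have hα : 0 < s - 3/2 := by linarith [hs.1]
  have hC := Cs_ge hs
  have h1 := Convex.norm_image_sub_le_of_norm_hasDerivWithin_le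
    (f := fun t => u.f t - t • deriv u.f x) (f' := fun t => deriv u.f t - deriv u.f x)
    (s := uIcc x (x + hT x y)) (C := Cs s * ‖u‖ * dT x y ^ (s - 3/2))
    (x := x) (y := x + hT x y) (fun t _ => ?_) (fun t ht => ?_) (convex_uIcc _ _)
    left_mem_uIcc right_mem_uIcc
  · rw [add_sub_cancel_left, Real.norm_eq_abs, hT_abs] at h1
    rw [hT_per u.mem.1] at h1
    have e : u.f y - (x + hT x y) • deriv u.f x - (u.f x - x • deriv u.f x) =
      u.f y - u.f x - hT x y • deriv u.f x := by rw [add_smul]; abel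
    rwa [e] at h1
  · have : HasDerivAt (fun t => u.f t - t • deriv u.f x) (deriv u.f t - (1:ℝ) • deriv u.f x) t :=
      (u.mem.dif t).hasDerivAt.sub ((hasDerivAt_id t).smul_const (deriv u.f x))
    rw [one_smul] at this
    exact this.hasDerivWithinAt
  · refine (u.hol hs x t).trans ?_
    have h2 : dT x t ≤ dT x y := (dT_le_abs x t).trans (by
      have := abs_sub_left_of_mem_uIcc ht
      rwa [add_sub_cancel_left, hT_abs] at this)
    have := dT_nonneg x t
    gcongr

set_option maxHeartbeats 1000000 in
theorem KK.exists {s : ℝ} {n : ℕ} (hs : s ∈ Ioo (3 / 2 : ℝ) 2) (γ : HS s n) (h : InM s γ.f) :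
    ∃ c, 0 < c ∧ γ ∈ KK s n ‖γ‖ c := by
  have hα : 0 < s - 3/2 := by linarith [hs.1]
  have hC := Cs_ge hs
  -- lower bound of derivative
  obtain ⟨x0, -, hx0⟩ := isCompact_Icc.exists_isMinOn (s := Icc (0:ℝ) 1) ⟨0, by simp⟩
    γ.mem.cont_deriv.norm.continuousOn
  set m := ‖deriv γ.f x0‖
  have hm : 0 < m := norm_pos_iff.2 (h.2.2 x0)
  have hfr : ∀ x : ℝ, Int.fract x ∈ Icc (0:ℝ) 1 := fun x =>
    ⟨Int.fract_nonneg x, (Int.fract_lt_one x).le⟩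
  have hmin : ∀ x, m ≤ ‖deriv γ.f x‖ := fun x => by
    have := per_int (per_deriv γ.mem.1) (Int.fract x) ⌊x⌋
    rw [Int.fract_add_floor] at this
    rw [this]; exact hx0 (hfr x)
  -- choose η
  have hη : ∃ η : ℝ, 0 < η ∧ Cs s * ‖γ‖ * η ^ (s - 3/2) ≤ m / 2 := by
    have : Tendsto (fun η : ℝ => Cs s * ‖γ‖ * η ^ (s - 3/2)) (𝓝[>] 0) (𝓝 0) := by
      have hc : Continuous fun η : ℝ => Cs s * ‖γ‖ * η ^ (s - 3/2) :=
        continuous_const.mul (Continuous.rpow_const continuous_id fun y => Or.inr hα.le)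
      have := hc.tendsto 0
      rw [Real.zero_rpow hα.ne', mul_zero] at this
      exact this.mono_left nhdsWithin_le_nhds
    obtain ⟨η, h1, h2⟩ := ((this.eventually (eventually_le_nhds (half_pos hm))).and
      self_mem_nhdsWithin).exists
    exact ⟨η, h2, h1⟩
  obtain ⟨η, hη0, hη⟩ := hη
  have hnear : ∀ x y, dT x y ≤ η → m / 2 * dT x y ≤ ‖γ.f y - γ.f x‖ := fun x y hxy => by
    have h1 := tayl hs γ x y
    have hd := dT_nonneg x y
    have h2 : Cs s * ‖γ‖ * dT x y ^ (s - 3/2) * dT x y ≤ m / 2 * dT x y := by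
      refine mul_le_mul_of_nonneg_right (le_trans ?_ hη) hd
      gcongr
    have h3 : ‖hT x y • deriv γ.f x‖ ≤ ‖γ.f y - γ.f x‖ +
        ‖γ.f y - γ.f x - hT x y • deriv γ.f x‖ := by
      nth_rw 1 [show hT x y • deriv γ.f x = (γ.f y - γ.f x) - 
        (γ.f y - γ.f x - hT x y • deriv γ.f x) by abel]
      exact norm_sub_le _ _
    rw [norm_smul, Real.norm_eq_abs, hT_abs] at h3
    nlinarith [hmin x]
  -- far part
  set S : Set (ℝ × ℝ) := {z | z ∈ Icc (0:ℝ) 1 ×ˢ Icc (0:ℝ) 1 ∧ η ≤ |z.2 - z.1| ∧ |z.2 - z.1| ≤ 1 - η}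
  have hS : IsCompact S := by
    refine (isCompact_Icc.prod isCompact_Icc).of_isClosed_subset ?_ fun z hz => hz.1
    have c1 : Continuous fun z : ℝ × ℝ => |z.2 - z.1| := by fun_prop
    exact (isClosed_Icc.prod isClosed_Icc).inter
      ((isClosed_le (continuous_const (y := η)) c1).inter
        (isClosed_le c1 (continuous_const (y := 1 - η))))
  have hfar : ∃ m' > 0, ∀ z ∈ S, m' ≤ ‖γ.f z.2 - γ.f z.1‖ := by
    rcases S.eq_empty_or_nonempty with he | hne
    · exact ⟨1, one_pos, by simp [he]⟩
    have hcf := γ.mem.cd.continuous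
    obtain ⟨z, hz, hzm⟩ := hS.exists_isMinOn hne
      (f := fun z : ℝ × ℝ => ‖γ.f z.2 - γ.f z.1‖) (by fun_prop)
    refine ⟨_, norm_pos_iff.2 (sub_ne_zero.2 fun heq => ?_), fun w hw => hzm hw⟩
    obtain ⟨⟨⟨h1, h2⟩, h3, h4⟩, h5, h6⟩ := hz
    -- reduce to I01
    have e1 : γ.f 1 = γ.f 0 := by have := γ.mem.1 0; rwa [zero_add] at this
    have red : ∀ x ∈ Icc (0:ℝ) 1, ∃ x' ∈ I01, γ.f x' = γ.f x ∧ (x' = x ∨ (x = 1 ∧ x' = 0)) := by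
      intro x hx
      rcases hx.2.eq_or_lt with rfl | hlt
      · exact ⟨0, by simp [I01], e1.symm, Or.inr ⟨rfl, rfl⟩⟩
      · exact ⟨x, ⟨hx.1, hlt⟩, rfl, Or.inl rfl⟩
    obtain ⟨a, ha, ha1, ha2⟩ := red z.1 ⟨h1, h2⟩
    obtain ⟨b, hb, hb1, hb2⟩ := red z.2 ⟨h3, h4⟩
    have hab : a = b := h.2.1 ha hb (by rw [ha1, hb1, heq])
    rcases ha2 with ha2 | ⟨ha2, ha3⟩ <;> rcases hb2 with hb2 | ⟨hb2, hb3⟩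
    · rw [← ha2, ← hb2, hab] at h5; simp at h5; linarith
    · rw [← ha2, hab, hb2, hb3] at h6; norm_num at h6; linarith
    · rw [ha2, ← hb2, ← hab, ha3] at h6; norm_num at h6; linarith
    · rw [ha2, hb2] at h5; norm_num at h5; linarith
  obtain ⟨m', hm', hfar⟩ := hfar
  refine ⟨min (m / 2) m', by positivity, le_rfl, fun x y => ?_⟩
  have hd := dT_nonneg x y
  rcases le_total (dT x y) η with hle | hle
  · exact (mul_le_mul_of_nonneg_right (min_le_left _ _) hd).trans (hnear x y hle)
  · have hx := per_int γ.mem.1 (Int.fract x) ⌊x⌋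
    have hy := per_int γ.mem.1 (Int.fract y) ⌊y⌋
    rw [Int.fract_add_floor] at hx hy
    have hdT : dT x y = dT (Int.fract x) (Int.fract y) := by
      conv_lhs => rw [← Int.fract_add_floor x, ← Int.fract_add_floor y]
      rw [dT_add_int_left, dT_add_int_right]
    rw [hx, hy]
    have h1 : (Int.fract x, Int.fract y) ∈ S := by
      refine ⟨⟨hfr x, hfr y⟩, ?_, ?_⟩
      · exact hle.trans (hdT ▸ dT_le_abs _ _)
      · dsimp only
        rcases le_total (Int.fract x) (Int.fract y) with h2 | h2
        · rw [abs_of_nonneg (by linarith)]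
          have h3 := dT_le (Int.fract x) (Int.fract y) (-1)
          rw [← hdT, abs_of_nonneg (by push_cast; linarith [(hfr x).1, (hfr y).2])] at h3
          push_cast at h3; linarith
        · rw [abs_of_nonpos (by linarith)]
          have h3 := dT_le (Int.fract x) (Int.fract y) 1
          rw [← hdT, abs_of_nonpos (by push_cast; linarith [(hfr x).2, (hfr y).1])] at h3
          push_cast at h3; linarith
    have h7 : m' ≤ ‖γ.f (Int.fract y) - γ.f (Int.fract x)‖ := hfar (Int.fract x, Int.fract y) h1
    refine le_trans ?_ h7
    clear h7 h1 hfar hnear hS hdT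
    have h5 := dT_le_half x y
    have h6 : min (m / 2) m' ≤ m' := min_le_right _ _
    calc min (m / 2) m' * dT x y ≤ m' * 1 := mul_le_mul h6 (by linarith) hd hm'.le
      _ = m' := mul_one _

/-! ### Part 7: the map T -/

abbrev W6 (n : ℕ) : Type := PiLp 2 (fun _ : Fin 6 => En n)

def tA {n : ℕ} (s : ℝ) (γ u : ℝ → En n) (x y : ℝ) : En n := √(muW γ x y) • Rop s γ u x y

def Tf {n : ℕ} (s : ℝ) (γ u : ℝ → En n) (z : ℝ × ℝ) : W6 n :=
  WithLp.toLp 2 ![√2 • tA s γ u z.1 z.2,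
    (√(2 * s + 1) * ‖tA s γ γ z.1 z.2‖ * ‖γ z.2 - γ z.1‖⁻¹) • (u z.2 - u z.1),
    ‖tA s γ γ z.1 z.2‖ • Dg γ u z.1, ‖tA s γ γ z.1 z.2‖ • Dg γ u z.2,
    √‖deriv γ z.1‖ • Dg γ u z.1, √‖deriv γ z.1‖ • u z.1]

def omg {n : ℕ} (s : ℝ) (γ : ℝ → En n) (x y : ℝ) : ℝ :=
  ‖deriv γ x‖ ^ (1/2 : ℝ) * ‖deriv γ y‖ ^ (1/2 : ℝ) *
    ‖(dT x y)⁻¹ • (γ y - γ x)‖ ^ (-(s + 1/2))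

theorem tA_nf {n : ℕ} (s : ℝ) (γ u : ℝ → En n) {x y : ℝ} (hd : 0 < dT x y) (hp : deriv γ x ≠ 0)
    (hg : γ y ≠ γ x) : tA s γ u x y = omg s γ x y • (nf s u (x, y) -
      (‖deriv γ x‖ ^ (-2 : ℝ) * ⟪deriv γ x, nf s γ (x, y)⟫) • deriv u x) := by
  have hp' : 0 < ‖deriv γ x‖ := norm_pos_iff.2 hp
  have hg' : 0 < ‖γ y - γ x‖ := norm_pos_iff.2 (sub_ne_zero.2 hg)
  set D := dT x y ^ (s + 1/2) with hD
  have hD0 : 0 < D := by positivity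
  have e1 : ∀ v : ℝ → En n, v y - v x = D • nf s v (x, y) + hT x y • deriv v x := fun v => by
    simp only [nf, ← hD, smul_inv_smul₀ hD0.ne']; abel
  have e2 : u y - u x - DDg γ u x (γ y - γ x) = D • (nf s u (x, y) -
      (‖deriv γ x‖ ^ (-2 : ℝ) * ⟪deriv γ x, nf s γ (x, y)⟫) • deriv u x) := by
    have : (‖deriv γ x‖ ^ 2)⁻¹ * ⟪deriv γ x, γ y - γ x⟫ =
        D * (‖deriv γ x‖ ^ (-2 : ℝ) * ⟪deriv γ x, nf s γ (x, y)⟫) + hT x y := by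
      rw [e1 γ, inner_add_right, inner_smul_right, inner_smul_right, real_inner_self_eq_norm_sq,
        Real.rpow_neg hp'.le]
      norm_cast
      field_simp
    rw [DDg, this, e1 u, smul_sub, add_smul, mul_smul]; abel
  rw [tA, Rop, e2, smul_smul, smul_smul]
  congr 1
  rw [omg, norm_smul, norm_inv, Real.norm_eq_abs, abs_of_pos hd, muW,
    Real.mul_rpow (by positivity) hg'.le, Real.sqrt_eq_rpow, Real.div_rpow (by positivity) hg'.le,
    Real.mul_rpow (by positivity) (by positivity), Real.inv_rpow hd.le, Real.rpow_neg hd.le,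
    inv_inv, Real.rpow_neg hg'.le, Real.rpow_add hg', ← hD]
  field_simp

theorem omg_nonneg {n : ℕ} (s : ℝ) (γ : ℝ → En n) (x y : ℝ) : 0 ≤ omg s γ x y := by
  unfold omg; positivity

/-- pointwise input data -/
structure PW (s : ℝ) (n : ℕ) (A c δ : ℝ) (γ γ' : HS s n) (x y : ℝ) : Prop where
  h1 : γ ∈ KK s n A c
  h2 : γ' ∈ KK s n A c
  hδ : 0 < δ
  hd : 0 < dT x y
  hl : Cs s * ‖γ - γ'‖ ≤ δ

section
variable {s : ℝ} {n : ℕ} {A c δ : ℝ} {γ γ' : HS s n} {x y : ℝ}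

theorem PW.p (hs : s ∈ Ioo (3 / 2 : ℝ) 2) (h : PW s n A c δ γ γ' x y) (t : ℝ) :
    LB δ (Cs s * A + 1) (deriv γ.f t) (deriv γ'.f t) := by
  have hC := Cs_ge hs
  have hδ := h.hδ
  have hA := (norm_nonneg _).trans h.h1.1
  refine ⟨?_, ?_, ?_⟩
  · refine (γ.sup_d hs t).trans ?_; nlinarith [h.h1.1]
  · refine (γ'.sup_d hs t).trans ?_; nlinarith [h.h2.1]
  · rw [← HS.dsub]; refine ((γ - γ').sup_d hs t).trans (h.hl.trans ?_)
    have : 0 ≤ Cs s * A * δ := by positivity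
    linarith

theorem lip_quot (hs : s ∈ Ioo (3 / 2 : ℝ) 2) (u : HS s n) (hd : 0 < dT x y) :
    ‖(dT x y)⁻¹ • (u.f y - u.f x)‖ ≤ Cs s * ‖u‖ := by
  rw [norm_smul, norm_inv, Real.norm_eq_abs, abs_of_pos hd, inv_mul_le_iff₀ hd]
  exact (u.lip hs x y).trans (by linarith)

theorem PW.e (hs : s ∈ Ioo (3 / 2 : ℝ) 2) (h : PW s n A c δ γ γ' x y) :
    LB δ (Cs s * A + 1) ((dT x y)⁻¹ • (γ.f y - γ.f x)) ((dT x y)⁻¹ • (γ'.f y - γ'.f x)) := by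
  have hC := Cs_ge hs
  have hδ := h.hδ
  have hA := (norm_nonneg _).trans h.h1.1
  refine ⟨?_, ?_, ?_⟩
  · refine (lip_quot hs γ h.hd).trans ?_; nlinarith [h.h1.1]
  · refine (lip_quot hs γ' h.hd).trans ?_; nlinarith [h.h2.1]
  · rw [← smul_sub, show γ.f y - γ.f x - (γ'.f y - γ'.f x) = (γ - γ').f y - (γ - γ').f x by
      simp only [HS.sub_f, Pi.sub_apply]; abel]
    refine (lip_quot hs (γ - γ') h.hd).trans (h.hl.trans ?_)
    have : 0 ≤ Cs s * A * δ := by positivity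
    linarith

theorem KK.e_ge (h : γ ∈ KK s n A c) (hd : 0 < dT x y) :
    c ≤ ‖(dT x y)⁻¹ • (γ.f y - γ.f x)‖ := by
  rw [norm_smul, norm_inv, Real.norm_eq_abs, abs_of_pos hd, le_inv_mul_iff₀ hd, mul_comm]
  exact h.2 x y

theorem KK.ne (hc : 0 < c) (h : γ ∈ KK s n A c) (hd : 0 < dT x y) : γ.f y ≠ γ.f x := fun he => by
  have := h.2 x y
  rw [he, sub_self, norm_zero] at this
  nlinarith

theorem KK.dne (hc : 0 < c) (h : γ ∈ KK s n A c) (x : ℝ) : deriv γ.f x ≠ 0 := fun he => by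
  have := KK.imm h x
  rw [he, norm_zero] at this
  linarith

def MN (s : ℝ) {n : ℕ} (δ : ℝ) (γ γ' : HS s n) (z : ℝ × ℝ) : ℝ :=
  ‖nf s γ.f z‖ + ‖nf s γ'.f z‖ + δ⁻¹ * ‖nf s (γ - γ').f z‖

theorem nf_sub (γ γ' : HS s n) (z : ℝ × ℝ) :
    nf s (γ - γ').f z = nf s γ.f z - nf s γ'.f z := by
  rw [nf, nf, nf, ← smul_sub, HS.dsub, HS.sub_f, Pi.sub_apply, Pi.sub_apply,
    smul_sub (hT z.1 z.2)]
  congr 1; abel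

theorem MN_nonneg (hδ : 0 < δ) (z : ℝ × ℝ) : 0 ≤ MN s δ γ γ' z := by unfold MN; positivity

theorem MN_LB (hδ : 0 < δ) (z : ℝ × ℝ) : LB δ (MN s δ γ γ' z) (nf s γ.f z) (nf s γ'.f z) := by
  have h0 : 0 ≤ δ⁻¹ * ‖nf s (γ - γ').f z‖ := by positivity
  have h1 := norm_nonneg (nf s γ.f z)
  have h2 := norm_nonneg (nf s γ'.f z)
  refine ⟨by unfold MN; linarith, by unfold MN; linarith, ?_⟩
  rw [← nf_sub, MN]
  calc _ = (δ⁻¹ * ‖nf s (γ - γ').f z‖) * δ := by field_simp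
    _ ≤ _ := by gcongr; linarith

theorem omg_LB (hs : s ∈ Ioo (3 / 2 : ℝ) 2) (hc : 0 < c) (A : ℝ) : ∃ K, 0 < K ∧
    ∀ (δ : ℝ) (γ γ' : HS s n) (x y : ℝ), PW s n A c δ γ γ' x y →
      LB δ K (omg s γ.f x y) (omg s γ'.f x y) := by
  obtain ⟨K1, hK1, f1⟩ := LB.rpow (1/2) (M := Cs s * A + 1) hc
  obtain ⟨K2, hK2, f2⟩ := LB.rpow (-(s + 1/2)) (M := Cs s * A + 1) hc
  refine ⟨2 * (2 * (K1 * K1) * K2), by positivity, fun δ γ γ' x y h => ?_⟩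
  exact LB.mul h.hδ (LB.mul h.hδ (f1 _ _ _ h.hδ (h.p hs x).norm (KK.imm h.h1 x) (KK.imm h.h2 x))
    (f1 _ _ _ h.hδ (h.p hs y).norm (KK.imm h.h1 y) (KK.imm h.h2 y)))
    (f2 _ _ _ h.hδ (h.e hs).norm (KK.e_ge h.h1 h.hd) (KK.e_ge h.h2 h.hd))

theorem tA_LB (hs : s ∈ Ioo (3 / 2 : ℝ) 2) (hc : 0 < c) (A : ℝ) : ∃ K, 0 < K ∧
    ∀ (δ : ℝ) (γ γ' : HS s n) (x y : ℝ), PW s n A c δ γ γ' x y →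
    ∀ (u u' : ℝ → En n) (B U : ℝ), LB δ B (nf s u (x, y)) (nf s u' (x, y)) →
      LB δ U (deriv u x) (deriv u' x) →
      LB δ (K * (B + MN s δ γ γ' (x, y) * U)) (tA s γ.f u x y) (tA s γ'.f u' x y) := by
  obtain ⟨K1, hK1, f1⟩ := omg_LB (n := n) hs hc A
  obtain ⟨K2, hK2, f2⟩ := LB.rpow (-2) (M := Cs s * A + 1) hc
  set M := Cs s * A + 1
  refine ⟨2 * (K1 * (1 + 2 * (2 * (K2 * (2 * |M|))))), by positivity,
    fun δ γ γ' x y h u u' B U hB hU => ?_⟩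
  rw [tA_nf s γ.f u h.hd (KK.dne hc h.h1 x) (KK.ne hc h.h1 h.hd),
    tA_nf s γ'.f u' h.hd (KK.dne hc h.h2 x) (KK.ne hc h.h2 h.hd)]
  have hM : 0 ≤ M := (h.p hs x).nn
  have hB0 := hB.nn
  have hU0 := hU.nn
  have hN0 : 0 ≤ MN s δ γ γ' (x, y) := MN_nonneg h.hδ _
  refine (LB.smul h.hδ (f1 δ γ γ' x y h) (LB.sub hB (LB.smul h.hδ (LB.mul h.hδ
    (f2 _ _ _ h.hδ (h.p hs x).norm (KK.imm h.h1 x) (KK.imm h.h2 x))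
    (LB.inner h.hδ (h.p hs x) (MN_LB h.hδ (x, y)))) hU))).mono h.hδ ?_
  rw [abs_of_nonneg hM]
  have : 0 ≤ K1 * (MN s δ γ γ' (x, y) * U) := by positivity
  have : 0 ≤ K1 * ((2 * (2 * (K2 * (2 * M)))) * B) := by positivity
  nlinarith

end

section
variable {s : ℝ} {n : ℕ} {A c δ : ℝ} {γ γ' : HS s n} {x y : ℝ}

theorem W6_norm (a : W6 n) : ‖a‖ ^ 2 = ∑ i, ‖a i‖ ^ 2 := PiLp.norm_sq_eq_of_L2 _ a

theorem W6_le {a : W6 n} {M : ℝ} (hM : 0 ≤ M) (h : ∀ i, ‖a i‖ ≤ M) : ‖a‖ ≤ 3 * M := by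
  refine abs_le_of_sq_le_sq' ?_ (by positivity) |>.2
  rw [W6_norm]
  calc ∑ i, ‖a i‖ ^ 2 ≤ ∑ _i : Fin 6, M ^ 2 := Finset.sum_le_sum fun i _ => by
        have := h i; gcongr
    _ = 6 * M ^ 2 := by simp
    _ ≤ _ := by nlinarith [sq_nonneg M]

theorem LB.W6 {a b : W6 n} {M : ℝ} (hδ : 0 < δ) (h : ∀ i, LB δ M (a i) (b i)) :
    LB δ (3 * M) a b := by
  have hM := (h 0).nn
  refine ⟨W6_le hM fun i => (h i).1, W6_le hM fun i => (h i).2.1, ?_⟩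
  rw [mul_assoc]
  exact W6_le (by positivity) fun i => (h i).2.2

def BB (s : ℝ) {n : ℕ} (δ : ℝ) (γ γ' u : HS s n) (z : ℝ × ℝ) : ℝ :=
  ‖nf s u.f z‖ + (MN s δ γ γ' z + 1) * (Cs s * ‖u‖)

theorem Tf_LB (hs : s ∈ Ioo (3 / 2 : ℝ) 2) (hc : 0 < c) (A : ℝ) : ∃ K, 0 < K ∧
    ∀ (δ : ℝ) (γ γ' : HS s n) (x y : ℝ), PW s n A c δ γ γ' x y → ∀ u : HS s n,
      LB δ (K * BB s δ γ γ' u (x, y)) (Tf s γ.f u.f (x, y)) (Tf s γ'.f u.f (x, y)) := by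
  obtain ⟨K1, hK1, f1⟩ := tA_LB (n := n) hs hc A
  obtain ⟨K2, hK2, f2⟩ := LB.rpow (-1) (M := Cs s * A + 1) hc
  obtain ⟨K3, hK3, f3⟩ := LB.rpow (1/2) (M := Cs s * A + 1) hc
  have hC := Cs_ge hs
  set M := Cs s * A + 1 with hM'
  set Kg := K1 * (1 + |M|) with hKg
  set k0 := 2 * (√2 * K1) with hk0
  set k1 := 2 * (2 * (2 * (√(2 * s + 1) * Kg) * K2)) with hk1
  set k2 := 2 * (Kg * (2 * K2)) with hk2
  set k3 := 2 * (K3 * (2 * K2)) with hk3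
  have hKg0 : 0 ≤ Kg := by positivity
  have hk00 : 0 ≤ k0 := by positivity
  have hk10 : 0 ≤ k1 := by positivity
  have hk20 : 0 ≤ k2 := by positivity
  have hk30 : 0 ≤ k3 := by positivity
  refine ⟨3 * (k0 + k1 + k2 + k3 + 2 * K3), by positivity, fun δ γ γ' x y h u => ?_⟩
  have hM : 0 ≤ M := (h.p hs x).nn
  have hN0 : 0 ≤ MN s δ γ γ' (x, y) := MN_nonneg h.hδ _
  set N := MN s δ γ γ' (x, y)
  set U := Cs s * ‖u‖ with hU
  have hU0 : 0 ≤ U := by positivity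
  set B := BB s δ γ γ' u (x, y) with hB
  have hBe : B = ‖nf s u.f (x, y)‖ + (N + 1) * U := rfl
  have hb0 := norm_nonneg (nf s u.f (x, y))
  have hNU : 0 ≤ N * U := by positivity
  have hB1 : N * U ≤ B := by rw [hBe]; nlinarith
  have hB2 : U ≤ B := by rw [hBe]; nlinarith
  have hB3 : ‖nf s u.f (x, y)‖ + N * U ≤ B := by rw [hBe]; nlinarith
  have hB0 : 0 ≤ B := hU0.trans hB2
  -- components
  have g1 : LB δ (K1 * B) (tA s γ.f u.f x y) (tA s γ'.f u.f x y) :=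
    (f1 δ γ γ' x y h u.f u.f _ U (LB.const h.hδ le_rfl) (LB.const h.hδ (u.sup_d hs x))).mono h.hδ
      (by gcongr)
  have g2 : LB δ (Kg * N) ‖tA s γ.f γ.f x y‖ ‖tA s γ'.f γ'.f x y‖ :=
    ((f1 δ γ γ' x y h γ.f γ'.f _ M (MN_LB h.hδ _) (h.p hs x)).mono h.hδ
      (by rw [hKg, abs_of_nonneg hM]; apply le_of_eq; ring)).norm
  have g3 : ∀ t, LB δ (2 * K2 * U) (Dg γ.f u.f t) (Dg γ'.f u.f t) := fun t => by
    have := LB.smul h.hδ (f2 _ _ _ h.hδ (h.p hs t).norm (KK.imm h.h1 t) (KK.imm h.h2 t))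
      (LB.const h.hδ (u.sup_d hs t))
    rw [Real.rpow_neg_one, Real.rpow_neg_one, ← mul_assoc] at this
    exact this
  have g4 : LB δ K3 (√‖deriv γ.f x‖) (√‖deriv γ'.f x‖) := by
    rw [Real.sqrt_eq_rpow, Real.sqrt_eq_rpow]
    exact f3 _ _ _ h.hδ (h.p hs x).norm (KK.imm h.h1 x) (KK.imm h.h2 x)
  have g5 := f2 _ _ _ h.hδ (h.e hs).norm (KK.e_ge h.h1 h.hd) (KK.e_ge h.h2 h.hd)
  have key : ∀ i, LB δ ((k0 + k1 + k2 + k3 + 2 * K3) * B) (Tf s γ.f u.f (x, y) i)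
      (Tf s γ'.f u.f (x, y) i) := by
    have q : ∀ {a b : En n} {k : ℝ} (C : ℝ), LB δ C a b → C ≤ k * B →
        k ≤ k0 + k1 + k2 + k3 + 2 * K3 → LB δ ((k0 + k1 + k2 + k3 + 2 * K3) * B) a b :=
      fun C h1 h2 h3 => h1.mono h.hδ (h2.trans (by gcongr))
    have d3 : ∀ t, LB δ ((k0 + k1 + k2 + k3 + 2 * K3) * B) (‖tA s γ.f γ.f x y‖ • Dg γ.f u.f t)
        (‖tA s γ'.f γ'.f x y‖ • Dg γ'.f u.f t) := fun t => by
      refine q (k := k2) _ (LB.smul h.hδ g2 (g3 t)) ?_ (by linarith)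
      calc 2 * (Kg * N * (2 * K2 * U)) = k2 * (N * U) := by rw [hk2]; ring
        _ ≤ k2 * B := by gcongr
    intro i
    fin_cases i
    · exact q (k := k0) _ (LB.smul h.hδ (LB.const h.hδ (by rw [Real.norm_of_nonneg (by positivity)]))
        g1) (by rw [hk0]; apply le_of_eq; ring) (by linarith)
    · have e : ∀ η : HS s n, (√(2 * s + 1) * ‖tA s η.f η.f x y‖ * ‖η.f y - η.f x‖⁻¹) •
          (u.f y - u.f x) = (√(2 * s + 1) * ‖tA s η.f η.f x y‖ *
          ‖(dT x y)⁻¹ • (η.f y - η.f x)‖ ^ (-1 : ℝ)) • ((dT x y)⁻¹ • (u.f y - u.f x)) := fun η => by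
        rw [smul_smul, Real.rpow_neg_one, norm_smul, norm_inv, Real.norm_eq_abs,
          abs_of_pos h.hd, mul_inv, inv_inv]
        congr 1
        have := h.hd.ne'
        field_simp
      have : LB δ (2 * (2 * (2 * (√(2 * s + 1) * (Kg * N)) * K2) * U))
          ((√(2 * s + 1) * ‖tA s γ.f γ.f x y‖ * ‖γ.f y - γ.f x‖⁻¹) • (u.f y - u.f x))
          ((√(2 * s + 1) * ‖tA s γ'.f γ'.f x y‖ * ‖γ'.f y - γ'.f x‖⁻¹) • (u.f y - u.f x)) := by
        rw [e, e]
        exact LB.smul h.hδ (LB.mul h.hδ (LB.mul h.hδ (LB.const h.hδ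
          (by rw [Real.norm_of_nonneg (by positivity)])) g2) g5)
          (LB.const h.hδ (lip_quot hs u h.hd))
      refine q (k := k1) _ this ?_ (by linarith)
      calc _ = k1 * (N * U) := by rw [hk1]; ring
        _ ≤ k1 * B := by gcongr
    · exact d3 x
    · exact d3 y
    · refine q (k := k3) _ (LB.smul h.hδ g4 (g3 x)) ?_ (by linarith)
      calc 2 * (K3 * (2 * K2 * U)) = k3 * U := by rw [hk3]; ring
        _ ≤ k3 * B := by gcongr
    · refine q (k := 2 * K3) _ (LB.smul h.hδ g4 (LB.const h.hδ (u.sup_f hs x))) ?_ (by linarith)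
      calc 2 * (K3 * U) = 2 * K3 * U := by ring
        _ ≤ _ := by gcongr
  have := LB.W6 h.hδ key
  rwa [← mul_assoc] at this

theorem tA_meas (s : ℝ) {γ u : ℝ → En n} (hγ : ContDiff ℝ 1 γ) (hu : ContDiff ℝ 1 u) :
    Measurable fun z : ℝ × ℝ => tA s γ u z.1 z.2 := by
  have a1 := hγ.continuous.measurable
  have a2 := (hγ.continuous_deriv le_rfl).measurable
  have a3 := hu.continuous.measurable
  have a4 := (hu.continuous_deriv le_rfl).measurable
  unfold tA muW Rop DDg
  fun_prop

theorem Tf_meas (s : ℝ) {γ u : ℝ → En n} (hγ : ContDiff ℝ 1 γ) (hu : ContDiff ℝ 1 u) :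
    AEStronglyMeasurable (Tf s γ u) mu2 := by
  have a1 := hγ.continuous.measurable
  have a2 := (hγ.continuous_deriv le_rfl).measurable
  have a3 := hu.continuous.measurable
  have a4 := (hu.continuous_deriv le_rfl).measurable
  have a5 := tA_meas s hγ hu
  have a6 := tA_meas s hγ hγ
  refine Measurable.aestronglyMeasurable ?_
  refine (WithLp.measurable_toLp 2 _).comp (measurable_pi_lambda _ fun i => ?_)
  unfold Dg
  fin_cases i <;> simp <;> fun_prop

end

section
variable {s : ℝ} {n : ℕ} {A c δ : ℝ} {γ γ' : HS s n} {x y : ℝ}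

def L2B (f : ℝ × ℝ → ℝ) (M : ℝ) : Prop :=
  AEStronglyMeasurable f mu2 ∧ 0 ≤ M ∧ eLpNorm f 2 mu2 ≤ ENNReal.ofReal M

theorem L2B.add {f g : ℝ × ℝ → ℝ} {M M' : ℝ} (h : L2B f M) (h' : L2B g M') :
    L2B (fun z => f z + g z) (M + M') := by
  refine ⟨h.1.add h'.1, add_nonneg h.2.1 h'.2.1, ?_⟩
  rw [ENNReal.ofReal_add h.2.1 h'.2.1]
  exact (eLpNorm_add_le h.1 h'.1 (by norm_num)).trans (add_le_add h.2.2 h'.2.2)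

theorem L2B.mulc {f : ℝ × ℝ → ℝ} {M : ℝ} (a : ℝ) (ha : 0 ≤ a) (h : L2B f M) :
    L2B (fun z => a * f z) (a * M) := by
  refine ⟨h.1.const_mul a, mul_nonneg ha h.2.1, ?_⟩
  rw [ENNReal.ofReal_mul ha]
  have := eLpNorm_const_smul (μ := mu2) (p := 2) a f
  calc _ = ‖a‖ₑ * eLpNorm f 2 mu2 := this
    _ ≤ _ := by
      rw [← ofReal_norm, Real.norm_of_nonneg ha]; gcongr; exact h.2.2

theorem L2B.one : L2B (fun _ => 1) 1 := by
  refine ⟨aestronglyMeasurable_const, zero_le_one, ?_⟩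
  rw [eLpNorm_const _ (by norm_num) (NeZero.ne _)]
  simp

theorem nf_L2B (hs : s ∈ Ioo (3 / 2 : ℝ) 2) (u : HS s n) : L2B (fun z => ‖nf s u.f z‖) ‖u‖ := by
  refine ⟨(nf_meas s u.mem.cd).norm.aestronglyMeasurable, norm_nonneg _, ?_⟩
  by_contra hlt
  have h1 := ENNReal.pow_lt_pow_left two_ne_zero (not_le.1 hlt)
  rw [eLpNorm_norm, eLpNorm_two_sq, ← ENNReal.ofReal_pow (norm_nonneg _)] at h1
  exact absurd (hardy hs u) (not_le.2 h1)

theorem BB_L2B (hs : s ∈ Ioo (3 / 2 : ℝ) 2) (hδ : 0 < δ) (h1 : ‖γ‖ ≤ A) (h2 : ‖γ'‖ ≤ A)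
    (h3 : ‖γ - γ'‖ ≤ δ) (u : HS s n) : eLpNorm (BB s δ γ γ' u) 2 mu2 ≤
      ENNReal.ofReal ((1 + (2 * A + 2) * Cs s) * ‖u‖) := by
  have hC := Cs_ge hs
  have h := (nf_L2B hs u).add (L2B.mulc (Cs s * ‖u‖) (by positivity)
    ((((nf_L2B hs γ).add (nf_L2B hs γ')).add
      (L2B.mulc δ⁻¹ (by positivity) (nf_L2B hs (γ - γ')))).add L2B.one))
  have e : BB s δ γ γ' u = fun z => ‖nf s u.f z‖ + (Cs s * ‖u‖) *
      (‖nf s γ.f z‖ + ‖nf s γ'.f z‖ + δ⁻¹ * ‖nf s (γ - γ').f z‖ + 1) := by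
    funext z; unfold BB MN; ring
  rw [e]
  refine h.2.2.trans (ENNReal.ofReal_le_ofReal ?_)
  have h4 : δ⁻¹ * ‖γ - γ'‖ ≤ 1 := by rw [inv_mul_le_iff₀ hδ]; linarith
  calc _ ≤ ‖u‖ + Cs s * ‖u‖ * (A + A + 1 + 1) := by gcongr
    _ = _ := by ring

theorem Tf_est (hs : s ∈ Ioo (3 / 2 : ℝ) 2) (hc : 0 < c) (A : ℝ) : ∃ C, 0 < C ∧
    ∀ (γ γ' : HS s n), γ ∈ KK s n A c → γ' ∈ KK s n A c → ∀ u : HS s n,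
      eLpNorm (Tf s γ.f u.f) 2 mu2 ≤ ENNReal.ofReal (C * ‖u‖) ∧
      eLpNorm (Tf s γ.f u.f - Tf s γ'.f u.f) 2 mu2 ≤ ENNReal.ofReal (C * ‖γ - γ'‖ * ‖u‖) := by
  obtain ⟨K, hK, hf⟩ := Tf_LB (n := n) hs hc A
  have hC := Cs_ge hs
  set L := 1 + (2 * |A| + 2) * Cs s
  have hL : 0 < L := by positivity
  refine ⟨K * L * Cs s, by positivity, fun γ γ' h1 h2 u => ⟨?_, ?_⟩⟩
  · have hb := BB_L2B hs (δ := 1) one_pos (h1.1.trans (le_abs_self A)) (h1.1.trans (le_abs_self A))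
      (by rw [sub_self, norm_zero]; exact zero_le_one) u
    have := eLpNorm_le_mul_eLpNorm_of_ae_le_mul (f := Tf s γ.f u.f) (g := BB s 1 γ γ u) (c := K)
      (μ := mu2) (by
        filter_upwards [mu2_ae] with z hz
        have := (hf 1 γ γ z.1 z.2 ⟨h1, h1, one_pos, dT_pos hz.1 hz.2.1 hz.2.2, by simp⟩ u).1
        refine this.trans ?_
        gcongr; exact Real.le_norm_self _) 2
    refine this.trans ((mul_le_mul_right hb _).trans ?_)
    rw [← ENNReal.ofReal_mul hK.le]
    refine ENNReal.ofReal_le_ofReal ?_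
    have : 0 ≤ K * L * ‖u‖ := by positivity
    nlinarith
  · rcases eq_or_ne γ γ' with rfl | hne
    · rw [sub_self, sub_self, eLpNorm_zero]; exact bot_le
    have hd : 0 < ‖γ - γ'‖ := norm_pos_iff.2 (sub_ne_zero.2 hne)
    set δ := Cs s * ‖γ - γ'‖ with hδ
    have hδ0 : 0 < δ := by positivity
    have hb := BB_L2B hs hδ0 (h1.1.trans (le_abs_self A)) (h2.1.trans (le_abs_self A))
      (by rw [hδ]; nlinarith) u
    have := eLpNorm_le_mul_eLpNorm_of_ae_le_mul (f := Tf s γ.f u.f - Tf s γ'.f u.f)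
      (g := BB s δ γ γ' u) (c := K * δ) (μ := mu2) (by
        filter_upwards [mu2_ae] with z hz
        have := (hf δ γ γ' z.1 z.2 ⟨h1, h2, hδ0, dT_pos hz.1 hz.2.1 hz.2.2, le_rfl⟩ u).2.2
        refine this.trans ?_
        rw [mul_right_comm]
        gcongr; exact Real.le_norm_self _) 2
    refine this.trans ((mul_le_mul_right hb _).trans ?_)
    rw [← ENNReal.ofReal_mul (by positivity)]
    refine ENNReal.ofReal_le_ofReal (le_of_eq ?_)
    rw [hδ]; ring

theorem Tf_mem (hs : s ∈ Ioo (3 / 2 : ℝ) 2) {γ : HS s n} (h : InM s γ.f) (u : HS s n) :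
    MemLp (Tf s γ.f u.f) 2 mu2 := by
  obtain ⟨c, hc, hk⟩ := KK.exists hs γ h
  obtain ⟨C, hC, h1⟩ := Tf_est (n := n) hs hc ‖γ‖
  exact ⟨Tf_meas s γ.mem.cd u.mem.cd, (h1 γ γ hk hk u).1.trans_lt ENNReal.ofReal_lt_top⟩

open Classical in
def TT (γ u : HS s n) : Lp (W6 n) 2 mu2 :=
  if h : MemLp (Tf s γ.f u.f) 2 mu2 then h.toLp else 0

theorem TT_eq (hs : s ∈ Ioo (3 / 2 : ℝ) 2) {γ : HS s n} (h : InM s γ.f) (u : HS s n) :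
    TT γ u = (Tf_mem hs h u).toLp := by rw [TT, dif_pos]

theorem dadd' (u v : HS s n) (x : ℝ) : deriv (u.f + v.f) x = deriv u.f x + deriv v.f x :=
  HS.dadd u v x
theorem dsmul' (a : ℝ) (u : HS s n) (x : ℝ) : deriv (a • u.f) x = a • deriv u.f x :=
  HS.dsmul a u x

theorem tA_add (s : ℝ) (γ : ℝ → En n) (u v : HS s n) (x y : ℝ) :
    tA s γ (u.f + v.f) x y = tA s γ u.f x y + tA s γ v.f x y := by
  simp only [tA, Rop, DDg, dadd', Pi.add_apply, smul_add, smul_sub]; abel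

theorem tA_smul (s : ℝ) (γ : ℝ → En n) (a : ℝ) (u : HS s n) (x y : ℝ) :
    tA s γ (a • u.f) x y = a • tA s γ u.f x y := by
  simp only [tA, Rop, DDg, dsmul', Pi.smul_apply]
  rw [smul_comm _ a (deriv u.f x), ← smul_sub, ← smul_sub, smul_comm _ a, smul_comm _ a]

theorem Tf_add (s : ℝ) (γ : ℝ → En n) (u v : HS s n) (z : ℝ × ℝ) :
    Tf s γ (u + v).f z = Tf s γ u.f z + Tf s γ v.f z := by
  have e : u.f z.2 + v.f z.2 - (u.f z.1 + v.f z.1) = (u.f z.2 - u.f z.1) + (v.f z.2 - v.f z.1) := by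
    abel
  ext1 i
  fin_cases i <;> simp [Tf, tA_add, Dg, dadd', smul_add, e]

theorem Tf_smul (s : ℝ) (γ : ℝ → En n) (a : ℝ) (u : HS s n) (z : ℝ × ℝ) :
    Tf s γ (a • u).f z = a • Tf s γ u.f z := by
  ext1 i
  fin_cases i <;> simp only [Tf, tA_smul, Dg, dsmul', HS.smul_f, ← smul_sub, Pi.smul_apply,
    PiLp.smul_apply] <;> simp <;> simp only [smul_comm _ a]

theorem TT_add (hs : s ∈ Ioo (3 / 2 : ℝ) 2) {γ : HS s n} (h : InM s γ.f) (u v : HS s n) :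
    TT γ (u + v) = TT γ u + TT γ v := by
  rw [TT_eq hs h, TT_eq hs h, TT_eq hs h, ← MemLp.toLp_add]
  congr 1; funext z; exact Tf_add s γ.f u v z

theorem TT_smul (hs : s ∈ Ioo (3 / 2 : ℝ) 2) {γ : HS s n} (h : InM s γ.f) (a : ℝ) (u : HS s n) :
    TT γ (a • u) = a • TT γ u := by
  rw [TT_eq hs h, TT_eq hs h, ← MemLp.toLp_const_smul]
  congr 1; funext z; exact Tf_smul s γ.f a u z

theorem TT_sub (hs : s ∈ Ioo (3 / 2 : ℝ) 2) {γ : HS s n} (h : InM s γ.f) (u v : HS s n) :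
    TT γ (u - v) = TT γ u - TT γ v := by
  rw [sub_eq_add_neg, ← neg_one_smul ℝ v, TT_add hs h, TT_smul hs h, neg_one_smul, sub_eq_add_neg]

theorem TT_est (hs : s ∈ Ioo (3 / 2 : ℝ) 2) (n : ℕ) (hc : 0 < c) (A : ℝ) : ∃ C, 0 < C ∧
    ∀ (γ γ' : HS s n), γ ∈ KK s n A c → γ' ∈ KK s n A c → ∀ u : HS s n,
      ‖TT γ u‖ ≤ C * ‖u‖ ∧ ‖TT γ u - TT γ' u‖ ≤ C * ‖γ - γ'‖ * ‖u‖ := by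
  obtain ⟨C, hC, h⟩ := Tf_est (n := n) hs hc A
  refine ⟨C, hC, fun γ γ' h1 h2 u => ?_⟩
  rw [TT_eq hs (KK.inM hc h1), TT_eq hs (KK.inM hc h2), ← MemLp.toLp_sub, Lp.norm_toLp,
    Lp.norm_toLp]
  exact ⟨ENNReal.toReal_le_of_le_ofReal (by positivity) (h γ γ' h1 h2 u).1,
    ENNReal.toReal_le_of_le_ofReal (by positivity) (h γ γ' h1 h2 u).2⟩

end

section
variable {s : ℝ} {n : ℕ} {A c δ : ℝ} {γ γ' : HS s n} {x y : ℝ}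

theorem iter_int {F : ℝ → ℝ → ℝ} (hF : Integrable (fun z : ℝ × ℝ => F z.1 z.2) mu2) :
    ∫ x in I01, ∫ y in I01, F x y = ∫ z, F z.1 z.2 ∂mu2 :=
  (integral_prod (μ := mu1) (ν := mu1) (fun z : ℝ × ℝ => F z.1 z.2) hF).symm

theorem single_int {F : ℝ → ℝ} (hF : Integrable (fun z : ℝ × ℝ => F z.1) mu2) :
    ∫ x in I01, F x = ∫ z, F z.1 ∂mu2 := by
  have := iter_int (F := fun x _ => F x) hF
  rw [← this]
  congr 1; funext x
  rw [setIntegral_const]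
  simp [I01, Measure.real]

theorem tA_sq (s : ℝ) (γ u : ℝ → En n) (x y : ℝ) :
    ‖tA s γ u x y‖ ^ 2 = ‖Rop s γ u x y‖ ^ 2 * muW γ x y := by
  have : 0 ≤ muW γ x y := by unfold muW; positivity
  rw [tA, norm_smul, mul_pow, Real.norm_of_nonneg (by positivity), Real.sq_sqrt this, mul_comm]

theorem Tf_comp (hs : s ∈ Ioo (3 / 2 : ℝ) 2) (γ u : ℝ → En n) (z : ℝ × ℝ) :
    ‖Tf s γ u z 0‖ ^ 2 = 2 * (‖Rop s γ u z.1 z.2‖ ^ 2 * muW γ z.1 z.2) ∧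
    ‖Tf s γ u z 1‖ ^ 2 = (2 * s + 1) * (‖Rop s γ γ z.1 z.2‖ ^ 2 *
      (‖u z.2 - u z.1‖ ^ 2 / ‖γ z.2 - γ z.1‖ ^ 2) * muW γ z.1 z.2) ∧
    ‖Tf s γ u z 2‖ ^ 2 = ‖Rop s γ γ z.1 z.2‖ ^ 2 * muW γ z.1 z.2 * ‖Dg γ u z.1‖ ^ 2 ∧
    ‖Tf s γ u z 3‖ ^ 2 = ‖Rop s γ γ z.1 z.2‖ ^ 2 * muW γ z.1 z.2 * ‖Dg γ u z.2‖ ^ 2 ∧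
    ‖Tf s γ u z 4‖ ^ 2 = ‖Dg γ u z.1‖ ^ 2 * ‖deriv γ z.1‖ ∧
    ‖Tf s γ u z 5‖ ^ 2 = ‖u z.1‖ ^ 2 * ‖deriv γ z.1‖ := by
  have h2 : (0:ℝ) ≤ 2 * s + 1 := by linarith [hs.1]
  have q : ∀ (a : ℝ) (v : En n), ‖a • v‖ ^ 2 = a ^ 2 * ‖v‖ ^ 2 := fun a v => by
    rw [norm_smul, mul_pow, Real.norm_eq_abs, sq_abs]
  have hn := norm_nonneg (deriv γ z.1)
  refine ⟨?_, ?_, ?_, ?_, ?_, ?_⟩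
  · change ‖√2 • tA s γ u z.1 z.2‖ ^ 2 = _
    rw [q, tA_sq, Real.sq_sqrt (by norm_num)]
  · change ‖(√(2 * s + 1) * ‖tA s γ γ z.1 z.2‖ * ‖γ z.2 - γ z.1‖⁻¹) • (u z.2 - u z.1)‖ ^ 2 = _
    rw [q, mul_pow, mul_pow, tA_sq, Real.sq_sqrt h2, inv_pow, div_eq_mul_inv]; ring
  · change ‖‖tA s γ γ z.1 z.2‖ • Dg γ u z.1‖ ^ 2 = _
    rw [q, tA_sq]
  · change ‖‖tA s γ γ z.1 z.2‖ • Dg γ u z.2‖ ^ 2 = _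
    rw [q, tA_sq]
  · change ‖√‖deriv γ z.1‖ • Dg γ u z.1‖ ^ 2 = _
    rw [q, Real.sq_sqrt hn, mul_comm]
  · change ‖√‖deriv γ z.1‖ • u z.1‖ ^ 2 = _
    rw [q, Real.sq_sqrt hn, mul_comm]

theorem Tf_sum (γ u : ℝ → En n) (z : ℝ × ℝ) : ‖Tf s γ u z‖ ^ 2 = ‖Tf s γ u z 0‖ ^ 2 +
    ‖Tf s γ u z 1‖ ^ 2 + ‖Tf s γ u z 2‖ ^ 2 + ‖Tf s γ u z 3‖ ^ 2 + ‖Tf s γ u z 4‖ ^ 2 +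
    ‖Tf s γ u z 5‖ ^ 2 := by
  rw [W6_norm, Fin.sum_univ_six]

theorem Gmet_eq (hs : s ∈ Ioo (3 / 2 : ℝ) 2) {γ : HS s n} (h : InM s γ.f) (u : HS s n) :
    Gmet s γ.f u.f u.f = ‖TT γ u‖ ^ 2 := by
  have hm := Tf_mem hs h u
  have hs0 : (2 * s + 1) ≠ 0 := by linarith [hs.1]
  have hi : ∀ i, Integrable (fun z => ‖Tf s γ.f u.f z i‖ ^ 2) mu2 := fun i => by
    have h1 : MemLp (fun z => Tf s γ.f u.f z i) 2 mu2 := hm.of_le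
      ((PiLp.continuous_apply 2 _ i).comp_aestronglyMeasurable hm.1)
      (Eventually.of_forall fun z => PiLp.norm_apply_le _ i)
    exact h1.integrable_norm_pow two_ne_zero
  rw [TT_eq hs h, toLp_normsq, ← integral_eq_lintegral_of_nonneg_ae
    (f := fun z => ‖Tf s γ.f u.f z‖ ^ 2) (Eventually.of_forall fun z => by positivity)
    (hm.1.norm.pow 2)]
  simp only [Tf_sum]
  have i0 := hi 0; have i1 := hi 1; have i2 := hi 2
  have i3 := hi 3; have i4 := hi 4; have i5 := hi 5
  rw [integral_add _ i5, integral_add _ i4, integral_add _ i3, integral_add _ i2,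
    integral_add i0 i1]
  rotate_left
  · exact i0.add i1
  · exact (i0.add i1).add i2
  · exact ((i0.add i1).add i2).add i3
  · exact (((i0.add i1).add i2).add i3).add i4
  have e0 : 2 * B1 s γ.f u.f u.f = ∫ z, ‖Tf s γ.f u.f z 0‖ ^ 2 ∂mu2 := by
    simp only [(Tf_comp hs _ _ _).1] at i0 ⊢
    rw [integral_const_mul]; congr 1
    unfold B1; simp only [real_inner_self_eq_norm_sq]
    exact iter_int (F := fun x y => ‖Rop s γ.f u.f x y‖ ^ 2 * muW γ.f x y)
      ((integrable_const_mul_iff (IsUnit.mk0 _ two_ne_zero) _).1 i0)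
  have e1 : (2 * s + 1) * B2 s γ.f u.f u.f = ∫ z, ‖Tf s γ.f u.f z 1‖ ^ 2 ∂mu2 := by
    simp only [(Tf_comp hs _ _ _).2.1] at i1 ⊢
    rw [integral_const_mul]; congr 1
    unfold B2; simp only [real_inner_self_eq_norm_sq]
    exact iter_int (F := fun x y => ‖Rop s γ.f γ.f x y‖ ^ 2 *
      (‖u.f y - u.f x‖ ^ 2 / ‖γ.f y - γ.f x‖ ^ 2) * muW γ.f x y)
      ((integrable_const_mul_iff (IsUnit.mk0 _ hs0) _).1 i1)
  have e2 : B3 s γ.f u.f u.f = (∫ z, ‖Tf s γ.f u.f z 2‖ ^ 2 ∂mu2) +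
      ∫ z, ‖Tf s γ.f u.f z 3‖ ^ 2 ∂mu2 := by
    rw [← integral_add i2 i3]
    have i23 := i2.add i3
    simp only [Pi.add_def, (Tf_comp hs _ _ _).2.2.1, (Tf_comp hs _ _ _).2.2.2.1] at i23 ⊢
    unfold B3; simp only [real_inner_self_eq_norm_sq]
    have e : ∀ x y, ‖Rop s γ.f γ.f x y‖ ^ 2 * (‖Dg γ.f u.f x‖ ^ 2 + ‖Dg γ.f u.f y‖ ^ 2) *
      muW γ.f x y = ‖Rop s γ.f γ.f x y‖ ^ 2 * muW γ.f x y * ‖Dg γ.f u.f x‖ ^ 2 +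
      ‖Rop s γ.f γ.f x y‖ ^ 2 * muW γ.f x y * ‖Dg γ.f u.f y‖ ^ 2 := fun x y => by ring
    simp only [e]
    exact iter_int (F := fun x y => ‖Rop s γ.f γ.f x y‖ ^ 2 * muW γ.f x y * ‖Dg γ.f u.f x‖ ^ 2 +
      ‖Rop s γ.f γ.f x y‖ ^ 2 * muW γ.f x y * ‖Dg γ.f u.f y‖ ^ 2) i23
  have e4 : innerH1g γ.f u.f u.f = ∫ z, ‖Tf s γ.f u.f z 4‖ ^ 2 ∂mu2 := by
    simp only [(Tf_comp hs _ _ _).2.2.2.2.1] at i4 ⊢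
    unfold innerH1g; simp only [real_inner_self_eq_norm_sq]
    exact single_int (F := fun x => ‖Dg γ.f u.f x‖ ^ 2 * ‖deriv γ.f x‖) i4
  have e5 : innerL2g γ.f u.f u.f = ∫ z, ‖Tf s γ.f u.f z 5‖ ^ 2 ∂mu2 := by
    simp only [(Tf_comp hs _ _ _).2.2.2.2.2] at i5 ⊢
    unfold innerL2g; simp only [real_inner_self_eq_norm_sq]
    exact single_int (F := fun x => ‖u.f x‖ ^ 2 * ‖deriv γ.f x‖) i5
  rw [Gmet, e0, e1, e2, e4, e5]; ring

theorem TT_lint (hs : s ∈ Ioo (3 / 2 : ℝ) 2) {γ : HS s n} (h : InM s γ.f) (u : HS s n) :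
    ENNReal.ofReal (‖TT γ u‖ ^ 2) = ∫⁻ z, ENNReal.ofReal (‖Tf s γ.f u.f z‖ ^ 2) ∂mu2 := by
  rw [TT_eq hs h, toLp_normsq']

theorem tA_lim {ι : Type*} {l : Filter ι} {g u : ι → ℝ → En n} {γ v : ℝ → En n} {x y : ℝ}
    (h1 : ∀ x, Tendsto (fun k => g k x) l (𝓝 (γ x)))
    (h2 : ∀ x, Tendsto (fun k => deriv (g k) x) l (𝓝 (deriv γ x)))
    (h3 : ∀ x, Tendsto (fun k => u k x) l (𝓝 (v x)))
    (h4 : ∀ x, Tendsto (fun k => deriv (u k) x) l (𝓝 (deriv v x)))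
    (hp : deriv γ x ≠ 0) (hg : γ y ≠ γ x) :
    Tendsto (fun k => tA s (g k) (u k) x y) l (𝓝 (tA s γ v x y)) := by
  have hp' : ‖deriv γ x‖ ≠ 0 := norm_ne_zero_iff.2 hp
  have hg' : ‖γ y - γ x‖ ≠ 0 := norm_ne_zero_iff.2 (sub_ne_zero.2 hg)
  unfold tA muW Rop DDg
  refine Tendsto.smul (Real.continuous_sqrt.continuousAt.tendsto.comp
    ((((h2 x).norm.mul (h2 y).norm)).div ((h1 y).sub (h1 x)).norm hg')) ?_
  refine Tendsto.smul (Tendsto.inv₀ ((((h1 y).sub (h1 x)).norm).rpow_const (Or.inl hg')) ?_) ?_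
  · exact (Real.rpow_pos_of_pos (lt_of_le_of_ne (norm_nonneg _) hg'.symm) s).ne'
  · exact ((h3 y).sub (h3 x)).sub (Tendsto.smul ((((h2 x).norm.pow 2).inv₀ (pow_ne_zero 2 hp')).mul
      ((h2 x).inner ((h1 y).sub (h1 x)))) (h4 x))

theorem Tf_lim {ι : Type*} {l : Filter ι} {g u : ι → ℝ → En n} {γ v : ℝ → En n} {x y : ℝ}
    (h1 : ∀ x, Tendsto (fun k => g k x) l (𝓝 (γ x)))
    (h2 : ∀ x, Tendsto (fun k => deriv (g k) x) l (𝓝 (deriv γ x)))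
    (h3 : ∀ x, Tendsto (fun k => u k x) l (𝓝 (v x)))
    (h4 : ∀ x, Tendsto (fun k => deriv (u k) x) l (𝓝 (deriv v x)))
    (hp : ∀ x, deriv γ x ≠ 0) (hg : γ y ≠ γ x) :
    Tendsto (fun k => Tf s (g k) (u k) (x, y)) l (𝓝 (Tf s γ v (x, y))) := by
  have hg' : ‖γ y - γ x‖ ≠ 0 := norm_ne_zero_iff.2 (sub_ne_zero.2 hg)
  have a1 := tA_lim (s := s) h1 h2 h3 h4 (hp x) hg
  have a2 := (tA_lim (s := s) h1 h2 h1 h2 (hp x) hg).norm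
  have a3 : ∀ x, Tendsto (fun k => Dg (g k) (u k) x) l (𝓝 (Dg γ v x)) := fun x =>
    ((h2 x).norm.inv₀ (norm_ne_zero_iff.2 (hp x))).smul (h4 x)
  have a4 := Real.continuous_sqrt.continuousAt.tendsto.comp (h2 x).norm
  refine ((PiLp.continuous_toLp 2 _).tendsto _).comp (tendsto_pi_nhds.2 fun i => ?_)
  fin_cases i
  · exact a1.const_smul (√2)
  · exact ((a2.const_mul (√(2 * s + 1))).mul (((h1 y).sub (h1 x)).norm.inv₀ hg')).smul
      ((h3 y).sub (h3 x))
  · exact a2.smul (a3 x)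
  · exact a2.smul (a3 y)
  · exact a4.smul (a3 x)
  · exact a4.smul (h3 x)

theorem InM.ne {γ : ℝ → En n} (h : InM s γ) {x y : ℝ} (hx : x ∈ I01) (hy : y ∈ I01) (hxy : x ≠ y) :
    γ y ≠ γ x := fun e => hxy (h.2.1 hx hy e.symm)

theorem TT_lsc (hs : s ∈ Ioo (3 / 2 : ℝ) 2) {g u : ℕ → HS s n} {γ v : HS s n} {b : ℕ → ℝ} {B : ℝ}
    (hg : ∀ k, InM s (g k).f) (hγ : InM s γ.f)
    (h1 : ∀ x, Tendsto (fun k => (g k).f x) atTop (𝓝 (γ.f x)))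
    (h2 : ∀ x, Tendsto (fun k => deriv (g k).f x) atTop (𝓝 (deriv γ.f x)))
    (h3 : ∀ x, Tendsto (fun k => (u k).f x) atTop (𝓝 (v.f x)))
    (h4 : ∀ x, Tendsto (fun k => deriv (u k).f x) atTop (𝓝 (deriv v.f x)))
    (hb : ∀ k, ‖TT (g k) (u k)‖ ≤ b k) (hB : Tendsto b atTop (𝓝 B)) : ‖TT γ v‖ ≤ B := by
  have hB0 : 0 ≤ B := ge_of_tendsto' hB fun k => (norm_nonneg _).trans (hb k)
  have h5 : ENNReal.ofReal (‖TT γ v‖ ^ 2) ≤ ENNReal.ofReal (B ^ 2) := by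
    rw [TT_lint hs hγ]
    have hl : Tendsto (fun k => ENNReal.ofReal (b k ^ 2)) atTop (𝓝 (ENNReal.ofReal (B ^ 2))) :=
      ENNReal.tendsto_ofReal (hB.pow 2)
    calc ∫⁻ z, ENNReal.ofReal (‖Tf s γ.f v.f z‖ ^ 2) ∂mu2
        = ∫⁻ z, liminf (fun k => ENNReal.ofReal (‖Tf s (g k).f (u k).f z‖ ^ 2)) atTop ∂mu2 := by
          refine lintegral_congr_ae ?_
          filter_upwards [mu2_ae] with z hz
          have := Tf_lim (s := s) (x := z.1) (y := z.2) h1 h2 h3 h4 hγ.2.2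
            (hγ.ne hz.1 hz.2.1 hz.2.2)
          exact (ENNReal.tendsto_ofReal (this.norm.pow 2)).liminf_eq.symm
      _ ≤ liminf (fun k => ∫⁻ z, ENNReal.ofReal (‖Tf s (g k).f (u k).f z‖ ^ 2) ∂mu2) atTop :=
          lintegral_liminf_le' fun k =>
            ((Tf_meas s (g k).mem.cd (u k).mem.cd).norm.aemeasurable.pow_const 2).ennreal_ofReal
      _ ≤ liminf (fun k => ENNReal.ofReal (b k ^ 2)) atTop := by
          refine liminf_le_liminf (Eventually.of_forall fun k => ?_)
          rw [← TT_lint hs (hg k)]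
          exact ENNReal.ofReal_le_ofReal (by have := hb k; gcongr)
      _ = _ := hl.liminf_eq
  rw [ENNReal.ofReal_le_ofReal_iff (by positivity)] at h5
  exact (abs_le_of_sq_le_sq' h5 hB0).2

end

/-! ### Part 11: the near inequality -/
section
variable {s : ℝ} {n : ℕ} {γ u : ℝ → En n} {x y ℓ : ℝ}

def Av (γ u : ℝ → En n) (x y : ℝ) : En n := u y - u x - DDg γ u x (γ y - γ x)

theorem DDg_eq (γ u : ℝ → En n) (x : ℝ) (w : En n) :
    DDg γ u x w = ⟪Dg γ γ x, w⟫ • Dg γ u x := by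
  rw [DDg, Dg, Dg, inner_smul_left, smul_smul]
  congr 1
  simp only [conj_trivial]
  rw [sq, mul_inv]; ring

theorem tau_norm (h : deriv γ x ≠ 0) : ‖Dg γ γ x‖ = 1 := by
  rw [Dg, norm_smul, norm_inv, norm_norm, inv_mul_cancel₀ (norm_ne_zero_iff.2 h)]

theorem tA_sq' (s : ℝ) (u : ℝ → En n) (hg : γ y ≠ γ x) : ‖tA s γ u x y‖ ^ 2 =
    ‖Av γ u x y‖ ^ 2 * (‖deriv γ x‖ * ‖deriv γ y‖) / ‖γ y - γ x‖ ^ (2 * s + 1) := by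
  have hg' : 0 < ‖γ y - γ x‖ := norm_pos_iff.2 (sub_ne_zero.2 hg)
  rw [tA_sq, Rop, norm_smul, norm_inv, Real.norm_of_nonneg (by positivity), mul_pow, muW,
    Real.rpow_add hg', Real.rpow_one, inv_pow, sq_rpow_half _ _ hg'.le, Av]
  field_simp

theorem near_alg0 (hx : deriv γ x ≠ 0) (hy : deriv γ y ≠ 0) (hℓ : 0 < ℓ)
    (h1 : ℓ / 2 ≤ ⟪Dg γ γ x, γ y - γ x⟫) (h2 : ℓ / 2 ≤ ⟪Dg γ γ y, γ y - γ x⟫) :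
    ‖Dg γ u y - Dg γ u x‖ * (ℓ / 2) ≤ ‖Av γ u x y‖ + ‖Av γ u y x‖ +
      ‖Dg γ u y‖ * (‖Av γ γ x y‖ + ‖Av γ γ y x‖) := by
  set ρ := ⟪Dg γ γ x, γ y - γ x⟫ with hρ
  set ρ' := ⟪Dg γ γ y, γ y - γ x⟫ with hρ'
  have key : ∀ v : ℝ → En n, Av γ v x y + Av γ v y x = ρ' • Dg γ v y - ρ • Dg γ v x := fun v => by
    rw [Av, Av, DDg_eq, DDg_eq, ← neg_sub (γ y) (γ x), inner_neg_right, neg_smul, ← hρ, ← hρ']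
    abel
  have e1 : |ρ' - ρ| ≤ ‖Av γ γ x y‖ + ‖Av γ γ y x‖ := by
    have h3 : ‖ρ' • Dg γ γ y‖ = ρ' := by
      rw [norm_smul, tau_norm hy, mul_one, Real.norm_of_nonneg (by linarith)]
    have h4 : ‖ρ • Dg γ γ x‖ = ρ := by
      rw [norm_smul, tau_norm hx, mul_one, Real.norm_of_nonneg (by linarith)]
    calc |ρ' - ρ| = |‖ρ' • Dg γ γ y‖ - ‖ρ • Dg γ γ x‖| := by rw [h3, h4]
      _ ≤ ‖ρ' • Dg γ γ y - ρ • Dg γ γ x‖ := abs_norm_sub_norm_le _ _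
      _ = ‖Av γ γ x y + Av γ γ y x‖ := by rw [key]
      _ ≤ _ := norm_add_le _ _
  have e2 : ρ • (Dg γ u y - Dg γ u x) = (Av γ u x y + Av γ u y x) - (ρ' - ρ) • Dg γ u y := by
    rw [key, smul_sub, sub_smul]; abel
  calc ‖Dg γ u y - Dg γ u x‖ * (ℓ / 2) ≤ ‖Dg γ u y - Dg γ u x‖ * ρ := by gcongr
    _ = ‖ρ • (Dg γ u y - Dg γ u x)‖ := by
      rw [norm_smul, Real.norm_of_nonneg (by linarith), mul_comm]
    _ ≤ ‖Av γ u x y + Av γ u y x‖ + |ρ' - ρ| * ‖Dg γ u y‖ := by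
      rw [e2]; refine (norm_sub_le _ _).trans ?_; rw [norm_smul]; rfl
    _ ≤ (‖Av γ u x y‖ + ‖Av γ u y x‖) + (‖Av γ γ x y‖ + ‖Av γ γ y x‖) * ‖Dg γ u y‖ := by
      gcongr; exact norm_add_le _ _
    _ = _ := by ring

theorem near_alg (hs : s ∈ Ioo (3 / 2 : ℝ) 2) (hx : deriv γ x ≠ 0) (hy : deriv γ y ≠ 0) (hℓ : 0 < ℓ)
    (h1 : ℓ / 2 ≤ ⟪Dg γ γ x, γ y - γ x⟫) (h2 : ℓ / 2 ≤ ⟪Dg γ γ y, γ y - γ x⟫)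
    (h3 : ‖γ y - γ x‖ ≤ ℓ) :
    ‖Dg γ u y - Dg γ u x‖ ^ 2 / ℓ ^ (2 * s - 1) * (‖deriv γ x‖ * ‖deriv γ y‖) ≤
      16 * (‖tA s γ u x y‖ ^ 2 + ‖tA s γ u y x‖ ^ 2 +
        ‖Dg γ u y‖ ^ 2 * (‖tA s γ γ x y‖ ^ 2 + ‖tA s γ γ y x‖ ^ 2)) := by
  have hg : γ y ≠ γ x := fun e => by
    rw [e, sub_self, inner_zero_right] at h1; linarith
  have hg' : 0 < ‖γ y - γ x‖ := norm_pos_iff.2 (sub_ne_zero.2 hg)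
  rw [tA_sq' s u hg, tA_sq' s u hg.symm, tA_sq' s γ hg, tA_sq' s γ hg.symm,
    norm_sub_rev (γ x) (γ y)]
  have h4 := near_alg0 (u := u) hx hy hℓ h1 h2
  set a1 := ‖Av γ u x y‖
  set a2 := ‖Av γ u y x‖
  set a3 := ‖Av γ γ x y‖
  set a4 := ‖Av γ γ y x‖
  set k := ‖Dg γ u y‖
  set d := ‖Dg γ u y - Dg γ u x‖
  set P := ‖deriv γ x‖
  set Q := ‖deriv γ y‖
  set r := ‖γ y - γ x‖ ^ (2 * s + 1)
  have hr : 0 < r := by positivity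
  have h5 : (d * (ℓ / 2)) ^ 2 ≤ 4 * (a1 ^ 2 + a2 ^ 2 + k ^ 2 * (a3 ^ 2 + a4 ^ 2)) := by
    have : (d * (ℓ / 2)) ^ 2 ≤ (a1 + a2 + k * (a3 + a4)) ^ 2 := by gcongr
    refine this.trans ?_
    nlinarith [sq_nonneg (a1 - a2), sq_nonneg (a1 - k * a3), sq_nonneg (a1 - k * a4),
      sq_nonneg (a2 - k * a3), sq_nonneg (a2 - k * a4), sq_nonneg (k * a3 - k * a4)]
  have h6 : r ≤ ℓ ^ (2 * s + 1) := by
    apply Real.rpow_le_rpow hg'.le h3; linarith [hs.1]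
  have h7 : ℓ ^ (2 * s + 1) = ℓ ^ (2 * s - 1) * ℓ ^ 2 := by
    rw [← Real.rpow_natCast, ← Real.rpow_add hℓ]; congr 1; push_cast; ring
  have h8 : d ^ 2 / ℓ ^ (2 * s - 1) ≤ 16 * (a1 ^ 2 + a2 ^ 2 + k ^ 2 * (a3 ^ 2 + a4 ^ 2)) / r := by
    have hp : 0 < ℓ ^ (2 * s - 1) := by positivity
    calc d ^ 2 / ℓ ^ (2 * s - 1) = (d ^ 2 * ℓ ^ 2) / ℓ ^ (2 * s + 1) := by
          rw [h7]; field_simp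
      _ ≤ (d ^ 2 * ℓ ^ 2) / r := by gcongr
      _ ≤ _ := div_le_div_of_nonneg_right (by
          linarith [h5, (by ring : (d * (ℓ / 2)) ^ 2 = d ^ 2 * ℓ ^ 2 / 4)]) hr.le
  calc _ ≤ 16 * (a1 ^ 2 + a2 ^ 2 + k ^ 2 * (a3 ^ 2 + a4 ^ 2)) / r * (P * Q) := by gcongr
    _ = _ := by ring

/-- arclength function -/
def phi (γ : ℝ → En n) (x : ℝ) : ℝ := ∫ t in (0:ℝ)..x, ‖deriv γ t‖

theorem phi_deriv (hc : Continuous (deriv γ)) (x : ℝ) : HasDerivAt (phi γ) ‖deriv γ x‖ x :=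
  intervalIntegral.integral_hasDerivAt_right (hc.norm.intervalIntegrable _ _)
    (hc.norm.stronglyMeasurableAtFilter _ _) hc.norm.continuousAt

theorem phi_sub (hc : Continuous (deriv γ)) (x y : ℝ) :
    phi γ y - phi γ x = ∫ t in x..y, ‖deriv γ t‖ :=
  intervalIntegral.integral_interval_sub_left (hc.norm.intervalIntegrable _ _)
    (hc.norm.intervalIntegrable _ _)

theorem phi_cont (hc : Continuous (deriv γ)) : Continuous (phi γ) :=
  continuous_iff_continuousAt.2 fun x => (phi_deriv hc x).continuousAt

theorem phi_mono (hc : Continuous (deriv γ)) (h0 : ∀ x, deriv γ x ≠ 0) : StrictMono (phi γ) :=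
  strictMono_of_hasDerivAt_pos (fun x => phi_deriv hc x) fun x => norm_pos_iff.2 (h0 x)

theorem chord_le (hγ : ContDiff ℝ 1 γ) (hxy : x ≤ y) : ‖γ y - γ x‖ ≤ phi γ y - phi γ x := by
  have hc := hγ.continuous_deriv le_rfl
  rw [phi_sub hc, ← intervalIntegral.integral_deriv_eq_sub
    (fun t _ => hγ.differentiable one_ne_zero t) (hc.intervalIntegrable _ _)]
  exact intervalIntegral.norm_integral_le_integral_norm hxy

theorem tau_inner {a b : ℝ} (ha : deriv γ a ≠ 0) (hb : deriv γ b ≠ 0)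
    (h : ‖Dg γ γ b - Dg γ γ a‖ ≤ 1 / 4) : 1 / 2 ≤ ⟪Dg γ γ a, Dg γ γ b⟫ := by
  have := norm_sub_sq_real (Dg γ γ b) (Dg γ γ a)
  rw [tau_norm ha, tau_norm hb, real_inner_comm] at this
  nlinarith [norm_nonneg (Dg γ γ b - Dg γ γ a)]

theorem rho_ge (hγ : ContDiff ℝ 1 γ) (h0 : ∀ x, deriv γ x ≠ 0) (hxy : x ≤ y) (z : ℝ)
    (h : ∀ t ∈ Icc x y, ‖Dg γ γ t - Dg γ γ z‖ ≤ 1 / 4) :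
    (phi γ y - phi γ x) / 2 ≤ ⟪Dg γ γ z, γ y - γ x⟫ := by
  have hc := hγ.continuous_deriv le_rfl
  have hd : ∀ t, HasDerivAt (fun t => ⟪Dg γ γ z, γ t⟫ - phi γ t / 2)
      (⟪Dg γ γ z, deriv γ t⟫ - ‖deriv γ t‖ / 2) t := fun t => by
    have h1 : HasDerivAt (fun t => ⟪Dg γ γ z, γ t⟫) ⟪Dg γ γ z, deriv γ t⟫ t := by
      have := (hasDerivAt_const t (Dg γ γ z)).inner ℝ
        (hγ.differentiable one_ne_zero t).hasDerivAt
      simpa using this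
    exact h1.sub ((phi_deriv hc t).div_const 2)
  have hm : MonotoneOn (fun t => ⟪Dg γ γ z, γ t⟫ - phi γ t / 2) (Icc x y) := by
    refine monotoneOn_of_deriv_nonneg (convex_Icc _ _)
      (fun t _ => (hd t).continuousAt.continuousWithinAt)
      (fun t _ => (hd t).differentiableAt.differentiableWithinAt) fun t ht => ?_
    rw [(hd t).deriv]
    have h2 := tau_inner (h0 z) (h0 t) (h t (interior_subset ht))
    have h3 : deriv γ t = ‖deriv γ t‖ • Dg γ γ t := by
      rw [Dg, smul_inv_smul₀ (norm_ne_zero_iff.2 (h0 t))]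
    rw [h3, inner_smul_right, ← h3]
    nlinarith [norm_nonneg (deriv γ t)]
  have := hm (left_mem_Icc.2 hxy) (right_mem_Icc.2 hxy) hxy
  simp only at this
  rw [inner_sub_right]; linarith

def Qd (s : ℝ) (γ u : ℝ → En n) (x y : ℝ) : ℝ :=
  16 * (‖tA s γ u x y‖ ^ 2 + ‖tA s γ u y x‖ ^ 2 +
        (‖Dg γ u x‖ ^ 2 + ‖Dg γ u y‖ ^ 2) * (‖tA s γ γ x y‖ ^ 2 + ‖tA s γ γ y x‖ ^ 2))

theorem Qd_comm (s : ℝ) (γ u : ℝ → En n) (x y : ℝ) : Qd s γ u x y = Qd s γ u y x := by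
  unfold Qd; ring

theorem near {a b : ℝ} (hs : s ∈ Ioo (3 / 2 : ℝ) 2) (hγ : ContDiff ℝ 1 γ) (h0 : ∀ x, deriv γ x ≠ 0)
    (h : ∀ t ∈ Icc a b, ∀ t' ∈ Icc a b, ‖Dg γ γ t - Dg γ γ t'‖ ≤ 1 / 4) :
    ∀ x ∈ Icc a b, ∀ y ∈ Icc a b, 
      ‖Dg γ u y - Dg γ u x‖ ^ 2 / |phi γ y - phi γ x| ^ (2 * s - 1) *
        (‖deriv γ x‖ * ‖deriv γ y‖) ≤ Qd s γ u x y := by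
  have main : ∀ x ∈ Icc a b, ∀ y ∈ Icc a b, x < y →
      ‖Dg γ u y - Dg γ u x‖ ^ 2 / |phi γ y - phi γ x| ^ (2 * s - 1) *
        (‖deriv γ x‖ * ‖deriv γ y‖) ≤ Qd s γ u x y := fun x hx y hy hxy => by
    have hp := phi_mono (hγ.continuous_deriv le_rfl) h0 hxy
    have hI : Icc x y ⊆ Icc a b := Icc_subset_Icc hx.1 hy.2
    rw [abs_of_pos (by linarith)]
    refine (near_alg hs (h0 x) (h0 y) (by linarith)
      (rho_ge hγ h0 hxy.le x fun t ht => h t (hI ht) x hx)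
      (rho_ge hγ h0 hxy.le y fun t ht => h t (hI ht) y hy) (chord_le hγ hxy.le)).trans ?_
    unfold Qd
    have : 0 ≤ ‖Dg γ u x‖ ^ 2 * (‖tA s γ γ x y‖ ^ 2 + ‖tA s γ γ y x‖ ^ 2) := by positivity
    nlinarith
  intro x hx y hy
  rcases lt_trichotomy x y with hlt | rfl | hlt
  · exact main x hx y hy hlt
  · rw [sub_self, norm_zero]; unfold Qd; simp; positivity
  · rw [Qd_comm, norm_sub_rev, abs_sub_comm, mul_comm ‖deriv γ x‖]
    exact main y hy x hx hlt

theorem Qd_le (hs : s ∈ Ioo (3 / 2 : ℝ) 2) (γ u : ℝ → En n) (x y : ℝ) :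
    Qd s γ u x y ≤ 16 * (‖Tf s γ u (x, y)‖ ^ 2 + ‖Tf s γ u (y, x)‖ ^ 2) := by
  have q : ∀ x y, ‖tA s γ u x y‖ ^ 2 + (‖Dg γ u x‖ ^ 2 + ‖Dg γ u y‖ ^ 2) * ‖tA s γ γ x y‖ ^ 2 ≤
      ‖Tf s γ u (x, y)‖ ^ 2 := fun x y => by
    obtain ⟨c0, c1, c2, c3, c4, c5⟩ := Tf_comp hs γ u (x, y)
    rw [Tf_sum, c0, c2, c3]
    simp only [← tA_sq]
    have : 0 ≤ ‖tA s γ u x y‖ ^ 2 := by positivity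
    nlinarith [sq_nonneg ‖Tf s γ u (x, y) 1‖, sq_nonneg ‖Tf s γ u (x, y) 4‖,
      sq_nonneg ‖Tf s γ u (x, y) 5‖]
  have h1 := q x y
  have h2 := q y x
  unfold Qd
  nlinarith

end

section
variable {s : ℝ} {n : ℕ}

def EN (s : ℝ) (γ : ℝ → En n) : ℝ≥0∞ := ∫⁻ z, ENNReal.ofReal (‖tA s γ γ z.1 z.2‖ ^ 2) ∂mu2

theorem nu_Ioc {γ : ℝ → En n} (hc : Continuous (deriv γ)) (a b : ℝ) (hab : a ≤ b) :
    (volume.withDensity fun x => ENNReal.ofReal ‖deriv γ x‖) (Ioc a b) =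
      ENNReal.ofReal (phi γ b - phi γ a) := by
  rw [withDensity_apply _ measurableSet_Ioc, phi_sub hc, intervalIntegral.integral_of_le hab,
    ofReal_integral_eq_lintegral_ofReal]
  · exact (hc.norm.intervalIntegrable a b).1
  · exact ae_of_all _ fun _ => norm_nonneg _

theorem tA_per {γ u : ℝ → En n} (hγ : Function.Periodic γ 1) (hu : Function.Periodic u 1)
    (x y : ℝ) : tA s γ u (x + 1) y = tA s γ u x y ∧ tA s γ u x (y + 1) = tA s γ u x y ∧
      Dg γ u (x + 1) = Dg γ u x := by
  simp [tA, muW, Rop, DDg, Dg, hγ _, hu _, per_deriv hγ _, per_deriv hu _]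

theorem Qd_per {γ u : ℝ → En n} (hγ : Function.Periodic γ 1) (hu : Function.Periodic u 1)
    (x y : ℝ) : Qd s γ u (x + 1) y = Qd s γ u x y ∧ Qd s γ u x (y + 1) = Qd s γ u x y := by
  simp [Qd, (tA_per hγ hu _ _).1, (tA_per hγ hu _ _).2, (tA_per hγ hγ _ _).1,
    (tA_per hγ hγ _ _).2, (tA_per (s := s) hγ hu _ 0).2.2]

theorem Dg_meas {γ u : ℝ → En n} (hγ : ContDiff ℝ 1 γ) (hu : ContDiff ℝ 1 u) :
    Measurable (Dg γ u) := by
  have a2 := (hγ.continuous_deriv le_rfl).measurable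
  have a4 := (hu.continuous_deriv le_rfl).measurable
  unfold Dg
  fun_prop

theorem Dg_cont {γ u : ℝ → En n} (hγ : ContDiff ℝ 1 γ) (hu : ContDiff ℝ 1 u)
    (h0 : ∀ x, deriv γ x ≠ 0) : Continuous (Dg γ u) := by
  have a2 := (hγ.continuous_deriv le_rfl)
  have a4 := (hu.continuous_deriv le_rfl)
  unfold Dg
  exact (a2.norm.inv₀ fun x => norm_ne_zero_iff.2 (h0 x)).smul a4

theorem Qd_meas {γ u : ℝ → En n} (hγ : ContDiff ℝ 1 γ) (hu : ContDiff ℝ 1 u) :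
    Measurable fun z : ℝ × ℝ => Qd s γ u z.1 z.2 := by
  have a5 := tA_meas s hγ hu
  have a6 := tA_meas s hγ hγ
  have a5' := a5.comp measurable_swap
  have a6' := a6.comp measurable_swap
  simp only [Function.comp_def, Prod.fst_swap, Prod.snd_swap] at a5' a6'
  have a7 := Dg_meas hγ hu
  unfold Qd
  fun_prop

theorem arcM (hs : s ∈ Ioo (3 / 2 : ℝ) 2) {γ u : HS s n} (hγ : InM s γ.f) {M a b : ℝ}
    (hM : 0 ≤ M) (hQ : ∫⁻ z, ENNReal.ofReal (Qd s γ.f u.f z.1 z.2) ∂mu2 ≤ ENNReal.ofReal M)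
    (hab : a ≤ b) (hb : b ≤ a + 1)
    (h : ∀ t ∈ Icc a b, ∀ t' ∈ Icc a b, ‖Dg γ.f γ.f t - Dg γ.f γ.f t'‖ ≤ 1 / 4) :
    ‖Dg γ.f u.f b - Dg γ.f u.f a‖ ≤ CM (s - 3/2) * √M *
      (phi γ.f b - phi γ.f a) ^ (s - 3/2) := by
  have hc := γ.mem.cont_deriv
  have h0 := hγ.2.2
  have hcγ := γ.mem.cd
  have hcu := u.mem.cd
  have hw : Measurable fun x => ENNReal.ofReal ‖deriv γ.f x‖ := hc.norm.measurable.ennreal_ofReal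
  have hD := Dg_meas hcγ hcu
  have hp := (phi_cont hc).measurable
  refine morrey (phi_mono hc h0) (phi_cont hc) (nu_Ioc hc) (Dg_cont hcγ hcu h0)
    (by linarith [hs.1]) hM hab (le_trans ?_ hQ)
  have e1 : (2 * (s - 3/2) + 2) = 2 * s - 1 := by ring
  rw [e1, ← mu2_iter (F := fun x y => ENNReal.ofReal (Qd s γ.f u.f x y))
    (Qd_meas hcγ hcu).ennreal_ofReal]
  refine le_trans ?_ (per_lint2_le (A := Ioc a b) (B := Ioc a b) (a := a) (b := a)
    (fun y x => ?_) (fun x y => ?_) (Ioc_subset_Ioc_right hb) (Ioc_subset_Ioc_right hb))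
  · have mF : Measurable fun z : ℝ × ℝ => ENNReal.ofReal (‖Dg γ.f u.f z.2 - Dg γ.f u.f z.1‖ ^ 2 /
        |phi γ.f z.2 - phi γ.f z.1| ^ (2 * s - 1)) := by fun_prop
    rw [restrict_withDensity measurableSet_Ioc,
      lintegral_withDensity_eq_lintegral_mul _ hw]
    · refine setLIntegral_mono' measurableSet_Ioc fun x hx => ?_
      have mx : Measurable fun y => ENNReal.ofReal (‖Dg γ.f u.f y - Dg γ.f u.f x‖ ^ 2 /
        |phi γ.f y - phi γ.f x| ^ (2 * s - 1)) := by fun_prop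
      simp only [Pi.mul_apply]
      rw [lintegral_withDensity_eq_lintegral_mul _ hw mx, ← lintegral_const_mul]
      · refine setLIntegral_mono' measurableSet_Ioc fun y hy => ?_
        simp only [Pi.mul_apply, Function.comp]
        rw [← ENNReal.ofReal_mul (norm_nonneg _), ← ENNReal.ofReal_mul (norm_nonneg _)]
        apply ENNReal.ofReal_le_ofReal
        have := near (u := u.f) hs hcγ h0 h x (Ioc_subset_Icc_self hx) y (Ioc_subset_Icc_self hy)
        linarith
      · exact hw.mul mx
    · exact Measurable.lintegral_prod_right' (f := fun z : ℝ × ℝ => 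
        ENNReal.ofReal (‖Dg γ.f u.f z.2 - Dg γ.f u.f z.1‖ ^ 2 /
        |phi γ.f z.2 - phi γ.f z.1| ^ (2 * s - 1))) mF
  · simp [(Qd_per γ.mem.1 u.mem.1 _ _).1]
  · simp [(Qd_per γ.mem.1 u.mem.1 _ _).2]

theorem Qd_self {γ : HS s n} (hγ : InM s γ.f) {E : ℝ} (hE0 : 0 ≤ E)
    (hE : EN s γ.f ≤ ENNReal.ofReal E) :
    ∫⁻ z, ENNReal.ofReal (Qd s γ.f γ.f z.1 z.2) ∂mu2 ≤ ENNReal.ofReal (96 * E) := by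
  have a6 := tA_meas s γ.mem.cd γ.mem.cd
  calc _ ≤ ∫⁻ z, ENNReal.ofReal 48 * (ENNReal.ofReal (‖tA s γ.f γ.f z.1 z.2‖ ^ 2) +
        ENNReal.ofReal (‖tA s γ.f γ.f z.2 z.1‖ ^ 2)) ∂mu2 := by
        refine lintegral_mono fun z => ?_
        rw [← ENNReal.ofReal_add (by positivity) (by positivity),
          ← ENNReal.ofReal_mul (by norm_num)]
        apply ENNReal.ofReal_le_ofReal
        unfold Qd
        rw [tau_norm (hγ.2.2 _), tau_norm (hγ.2.2 _)]
        linarith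
    _ = ENNReal.ofReal 48 * (EN s γ.f + EN s γ.f) := by
        rw [lintegral_const_mul' _ _ ENNReal.ofReal_ne_top, lintegral_add_left (by fun_prop),
          mu2_swap (F := fun x y => ENNReal.ofReal (‖tA s γ.f γ.f x y‖ ^ 2))]; rfl
    _ ≤ ENNReal.ofReal 48 * (ENNReal.ofReal E + ENNReal.ofReal E) := by gcongr
    _ = _ := by
        rw [← ENNReal.ofReal_add hE0 hE0, ← ENNReal.ofReal_mul (by norm_num)]; congr 1; ring

theorem Qd_gen (hs : s ∈ Ioo (3 / 2 : ℝ) 2) {γ : HS s n} (hγ : InM s γ.f) (u : HS s n) :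
    ∫⁻ z, ENNReal.ofReal (Qd s γ.f u.f z.1 z.2) ∂mu2 ≤ ENNReal.ofReal (32 * ‖TT γ u‖ ^ 2) := by
  calc _ ≤ ∫⁻ z, ENNReal.ofReal 16 * (ENNReal.ofReal (‖Tf s γ.f u.f (z.1, z.2)‖ ^ 2) +
        ENNReal.ofReal (‖Tf s γ.f u.f (z.2, z.1)‖ ^ 2)) ∂mu2 := by
        refine lintegral_mono fun z => ?_
        rw [← ENNReal.ofReal_add (by positivity) (by positivity),
          ← ENNReal.ofReal_mul (by norm_num)]
        exact ENNReal.ofReal_le_ofReal (Qd_le hs _ _ _ _)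
    _ = ENNReal.ofReal 16 * (ENNReal.ofReal (‖TT γ u‖ ^ 2) + ENNReal.ofReal (‖TT γ u‖ ^ 2)) := by
        have m : AEMeasurable (fun z : ℝ × ℝ => ENNReal.ofReal (‖Tf s γ.f u.f (z.1, z.2)‖ ^ 2))
          mu2 := ((Tf_meas s γ.mem.cd u.mem.cd).norm.pow 2).aemeasurable.ennreal_ofReal
        rw [lintegral_const_mul' _ _ ENNReal.ofReal_ne_top,
          lintegral_add_left' m,
          mu2_swap (F := fun x y => ENNReal.ofReal (‖Tf s γ.f u.f (x, y)‖ ^ 2)), TT_lint hs hγ]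
    _ = _ := by
        rw [← ENNReal.ofReal_add (by positivity) (by positivity), ← ENNReal.ofReal_mul (by norm_num)]; congr 1; ring

/-- small-arc radius -/
theorem exists_r0 (hs : s ∈ Ioo (3 / 2 : ℝ) 2) (n : ℕ) {E : ℝ} (hE0 : 0 ≤ E) : ∃ r, 0 < r ∧
    ∀ γ : HS s n, InM s γ.f → EN s γ.f ≤ ENNReal.ofReal E →
      (∀ a b, a ≤ b → b ≤ a + 1 → phi γ.f b - phi γ.f a ≤ r →
        ∀ t ∈ Icc a b, ∀ t' ∈ Icc a b, ‖Dg γ.f γ.f t - Dg γ.f γ.f t'‖ ≤ 1 / 4) ∧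
      ∀ x, r < phi γ.f (x + 1) - phi γ.f x := by
  have hα : 0 < s - 3/2 := by linarith [hs.1]
  set K := CM (s - 3/2) * √(96 * E) + 1
  have hK : 0 < K := by have := CM_pos hα; positivity
  refine ⟨(1 / (8 * K)) ^ (s - 3/2)⁻¹, by positivity, fun γ hγ hE => ?_⟩
  set r := (1 / (8 * K)) ^ (s - 3/2)⁻¹ with hr
  have hr0 : 0 < r := by positivity
  have hrK : K * r ^ (s - 3/2) = 1 / 8 := by
    rw [hr, ← Real.rpow_mul (by positivity), inv_mul_cancel₀ hα.ne', Real.rpow_one]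
    field_simp
  have hc := γ.mem.cont_deriv
  have hτ := Dg_cont γ.mem.cd γ.mem.cd hγ.2.2
  have hφ := phi_cont hc
  have hφm := phi_mono hc hγ.2.2
  have main : ∀ a b, a ≤ b → b ≤ a + 1 → phi γ.f b - phi γ.f a ≤ r →
      ∀ t ∈ Icc a b, ∀ t' ∈ Icc a b, t ≤ t' → ‖Dg γ.f γ.f t' - Dg γ.f γ.f t‖ < 1 / 4 := by
    intro a b hab hb hl t ht t' ht' htt'
    by_contra hbad
    push Not at hbad
    set S := {z : ℝ × ℝ | z ∈ Icc a b ×ˢ Icc a b ∧ z.1 ≤ z.2 ∧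
      1 / 4 ≤ ‖Dg γ.f γ.f z.2 - Dg γ.f γ.f z.1‖}
    have hS : IsCompact S := by
      refine (isCompact_Icc.prod isCompact_Icc).inter_right ?_
      exact (isClosed_le continuous_fst continuous_snd).inter
        (isClosed_le (f := fun _ : ℝ × ℝ => (1 / 4 : ℝ))
          (g := fun z : ℝ × ℝ => ‖Dg γ.f γ.f z.2 - Dg γ.f γ.f z.1‖) continuous_const (by fun_prop))
    obtain ⟨⟨p, q⟩, hpq, hmin⟩ := hS.exists_isMinOn ⟨(t, t'), ⟨ht, ht'⟩, htt', hbad⟩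
      (f := fun z => phi γ.f z.2 - phi γ.f z.1) (by fun_prop)
    obtain ⟨⟨hp, hq⟩, hpq1, hpq2⟩ := hpq
    simp only at hp hq hpq1 hpq2
    have hlt : p < q := by
      rcases hpq1.lt_or_eq with h | h
      · exact h
      · rw [h, sub_self, norm_zero] at hpq2; norm_num at hpq2
    have hin : ∀ w ∈ Ioo p q, ‖Dg γ.f γ.f w - Dg γ.f γ.f p‖ ≤ 1 / 8 := by
      intro w hw
      have hosc1 : ∀ y ∈ Icc p w, ∀ y' ∈ Icc p w, y ≤ y' →
          ‖Dg γ.f γ.f y' - Dg γ.f γ.f y‖ ≤ 1 / 4 := by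
        intro y hy y' hy' hyy
        by_contra hcon
        push Not at hcon
        have h1 := hmin (show (y, y') ∈ S from ⟨⟨⟨hp.1.trans hy.1, by linarith [hy.2, hw.2, hq.2]⟩,
          ⟨hp.1.trans hy'.1, by linarith [hy'.2, hw.2, hq.2]⟩⟩, hyy, hcon.le⟩)
        simp only [mem_ofPred_eq] at h1
        have h2 := hφm.monotone hy.1
        have h3 := hφm (hy'.2.trans_lt hw.2)
        linarith
      have hosc : ∀ y ∈ Icc p w, ∀ y' ∈ Icc p w, ‖Dg γ.f γ.f y - Dg γ.f γ.f y'‖ ≤ 1 / 4 := by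
        intro y hy y' hy'
        rcases le_total y y' with h | h
        · rw [norm_sub_rev]; exact hosc1 y hy y' hy' h
        · exact hosc1 y' hy' y hy h
      have h1 := arcM hs hγ (by positivity) (Qd_self hγ hE0 hE) hw.1.le
        (by linarith [hw.2, hq.2, hp.1]) hosc
      have h2 : phi γ.f w - phi γ.f p ≤ r := by
        have := hφm.monotone hp.1
        have := hφm.monotone (hw.2.le.trans hq.2)
        linarith
      have h3 : 0 ≤ phi γ.f w - phi γ.f p := by linarith [hφm hw.1]
      calc _ ≤ _ := h1
        _ ≤ K * r ^ (s - 3/2) := by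
            refine mul_le_mul (by simp [K]) (Real.rpow_le_rpow h3 h2 hα.le) (by positivity) hK.le
        _ = _ := hrK
    have hlim : Tendsto (fun w => ‖Dg γ.f γ.f w - Dg γ.f γ.f p‖) (𝓝[<] q)
        (𝓝 ‖Dg γ.f γ.f q - Dg γ.f γ.f p‖) :=
      ((hτ.sub continuous_const).norm.tendsto q).mono_left nhdsWithin_le_nhds
    have := le_of_tendsto hlim (by
      filter_upwards [Ioo_mem_nhdsLT hlt] with w hw using hin w hw)
    linarith
  have main' : ∀ a b, a ≤ b → b ≤ a + 1 → phi γ.f b - phi γ.f a ≤ r →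
        ∀ t ∈ Icc a b, ∀ t' ∈ Icc a b, ‖Dg γ.f γ.f t - Dg γ.f γ.f t'‖ ≤ 1 / 4 := by
    intro a b hab hb hl t ht t' ht'
    rcases le_total t t' with h | h
    · rw [norm_sub_rev]; exact (main a b hab hb hl t ht t' ht' h).le
    · exact (main a b hab hb hl t' ht' t ht h).le
  refine ⟨main', fun x => ?_⟩
  by_contra hcon
  push Not at hcon
  have h1 := rho_ge γ.mem.cd hγ.2.2 (by linarith : x ≤ x + 1) x fun t ht =>
    main' x (x + 1) (by linarith) le_rfl hcon t ht x ⟨le_rfl, by linarith⟩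
  rw [γ.mem.1 x, sub_self, inner_zero_right] at h1
  have := hφm (by linarith : x < x + 1)
  linarith

theorem sup_Dg (hs : s ∈ Ioo (3 / 2 : ℝ) 2) (n : ℕ) {E : ℝ} (hE0 : 0 ≤ E) : ∃ C, 0 < C ∧
    ∀ γ : HS s n, InM s γ.f → EN s γ.f ≤ ENNReal.ofReal E → ∀ (u : HS s n) (x : ℝ),
      ‖Dg γ.f u.f x‖ ≤ C * ‖TT γ u‖ := by
  have hα : 0 < s - 3/2 := by linarith [hs.1]
  obtain ⟨r, hr, H⟩ := exists_r0 hs n hE0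
  have hCM := CM_pos hα
  refine ⟨√(1 / r) + CM (s - 3/2) * √32 * r ^ (s - 3/2), by positivity, fun γ hγ hE u x => ?_⟩
  obtain ⟨H1, H2⟩ := H γ hγ hE
  have hc := γ.mem.cont_deriv
  have hD := Dg_cont γ.mem.cd u.mem.cd hγ.2.2
  have hφ := phi_cont hc
  have hφm := phi_mono hc hγ.2.2
  obtain ⟨b, ⟨hb1, hb2⟩, hb⟩ : phi γ.f x + r ∈ phi γ.f '' Icc x (x + 1) :=
    intermediate_value_Icc (by linarith) hφ.continuousOn ⟨by linarith, by linarith [H2 x]⟩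
  obtain ⟨t, ht, hmin⟩ := isCompact_Icc.exists_isMinOn (nonempty_Icc.2 hb1)
    (f := fun t => ‖Dg γ.f u.f t‖ ^ 2) (by fun_prop)
  have hG : ‖Dg γ.f u.f t‖ ^ 2 * r ≤ ‖TT γ u‖ ^ 2 := by
    rw [← ENNReal.ofReal_le_ofReal_iff (by positivity), ENNReal.ofReal_mul (by positivity)]
    have h1 : ENNReal.ofReal r = ∫⁻ y in Ioc x b, ENNReal.ofReal ‖deriv γ.f y‖ := by
      rw [← withDensity_apply _ measurableSet_Ioc, nu_Ioc hc _ _ hb1, hb]; congr 1; ring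
    rw [h1, ← lintegral_const_mul' _ _ ENNReal.ofReal_ne_top]
    have hper : Function.Periodic
        (fun y => ENNReal.ofReal (‖Dg γ.f u.f y‖ ^ 2 * ‖deriv γ.f y‖)) 1 := fun y => by
      simp [(tA_per (s := s) γ.mem.1 u.mem.1 y y).2.2, per_deriv γ.mem.1 y]
    calc _ ≤ ∫⁻ y in Ioc x b, ENNReal.ofReal (‖Dg γ.f u.f y‖ ^ 2 * ‖deriv γ.f y‖) := by
          refine setLIntegral_mono' measurableSet_Ioc fun y hy => ?_
          rw [← ENNReal.ofReal_mul (by positivity)]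
          have := hmin (Ioc_subset_Icc_self hy)
          simp only [mem_ofPred_eq] at this
          gcongr
      _ ≤ ∫⁻ y in Ioc x (x + 1), ENNReal.ofReal (‖Dg γ.f u.f y‖ ^ 2 * ‖deriv γ.f y‖) :=
          lintegral_mono_set (Ioc_subset_Ioc_right hb2)
      _ = ∫⁻ y in I01, ENNReal.ofReal (‖Dg γ.f u.f y‖ ^ 2 * ‖deriv γ.f y‖) :=
          (per_lint hper x).symm
      _ = ∫⁻ z, ENNReal.ofReal (‖Dg γ.f u.f z.1‖ ^ 2 * ‖deriv γ.f z.1‖) ∂mu2 := by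
          have m1 : Measurable fun z : ℝ × ℝ =>
              ENNReal.ofReal (‖Dg γ.f u.f z.1‖ ^ 2 * ‖deriv γ.f z.1‖) := by fun_prop
          rw [← mu2_iter (F := fun x y => ENNReal.ofReal (‖Dg γ.f u.f x‖ ^ 2 * ‖deriv γ.f x‖)) m1]
          simp [I01]
      _ ≤ _ := by
          rw [TT_lint hs hγ]
          refine lintegral_mono fun z => ENNReal.ofReal_le_ofReal ?_
          rw [← (Tf_comp hs γ.f u.f z).2.2.2.2.1, Tf_sum]
          nlinarith [sq_nonneg ‖Tf s γ.f u.f z 0‖, sq_nonneg ‖Tf s γ.f u.f z 1‖,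
            sq_nonneg ‖Tf s γ.f u.f z 2‖, sq_nonneg ‖Tf s γ.f u.f z 3‖,
            sq_nonneg ‖Tf s γ.f u.f z 5‖]
  have h1 : ‖Dg γ.f u.f t‖ ≤ √(1 / r) * ‖TT γ u‖ := by
    apply le_of_sq_le_sq _ (by positivity)
    rw [mul_pow, Real.sq_sqrt (by positivity)]
    rw [one_div, inv_mul_eq_div, le_div_iff₀ hr]; exact hG
  have h2 := arcM (u := u) hs hγ (by positivity) (Qd_gen hs hγ u) ht.1 (ht.2.trans hb2)
    fun p hp q hq => H1 x b hb1 hb2 (by linarith) p (Icc_subset_Icc_right ht.2 hp) q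
      (Icc_subset_Icc_right ht.2 hq)
  rw [Real.sqrt_mul (by norm_num), Real.sqrt_sq (norm_nonneg _)] at h2
  have h3 : (phi γ.f t - phi γ.f x) ^ (s - 3/2) ≤ r ^ (s - 3/2) := by
    have a1 := hφm.monotone ht.1
    have a2 := hφm.monotone ht.2
    exact Real.rpow_le_rpow (by linarith) (by linarith) hα.le
  have h4 : ‖Dg γ.f u.f x‖ ≤ ‖Dg γ.f u.f t‖ + ‖Dg γ.f u.f t - Dg γ.f u.f x‖ := by
    have := norm_sub_le (Dg γ.f u.f t) (Dg γ.f u.f t - Dg γ.f u.f x)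
    rwa [sub_sub_cancel] at this
  calc _ ≤ _ := h4
    _ ≤ √(1 / r) * ‖TT γ u‖ + CM (s - 3/2) * (√32 * ‖TT γ u‖) * r ^ (s - 3/2) := by
        refine add_le_add h1 (h2.trans ?_)
        exact mul_le_mul_of_nonneg_left h3 (by positivity)
    _ = _ := by ring

end

section
variable {s : ℝ} {n : ℕ}

theorem phi_le {γ : ℝ → En n} (hc : Continuous (deriv γ)) {C : ℝ} (h : ∀ x, ‖deriv γ x‖ ≤ C)
    {a b : ℝ} (hab : a ≤ b) : phi γ b - phi γ a ≤ C * (b - a) :=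
  image_sub_le_mul_sub_of_deriv_le (fun x => (phi_deriv hc x).differentiableAt)
    (fun x => by rw [(phi_deriv hc x).deriv]; exact h x) hab

theorem phi_ge {γ : ℝ → En n} (hc : Continuous (deriv γ)) {C : ℝ} (h : ∀ x, C ≤ ‖deriv γ x‖)
    {a b : ℝ} (hab : a ≤ b) : C * (b - a) ≤ phi γ b - phi γ a :=
  mul_sub_le_image_sub_of_le_deriv (fun x => (phi_deriv hc x).differentiableAt)
    (fun x => by rw [(phi_deriv hc x).deriv]; exact h x) hab

theorem gag_near (hs : s ∈ Ioo (3 / 2 : ℝ) 2) {γ u : HS s n} (hγ : InM s γ.f) {r c0 C0 N : ℝ}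
    (hr : 0 < r) (hc0 : 0 < c0) (hC0 : 0 < C0)
    (H1 : ∀ a b, a ≤ b → b ≤ a + 1 → phi γ.f b - phi γ.f a ≤ r →
        ∀ t ∈ Icc a b, ∀ t' ∈ Icc a b, ‖Dg γ.f γ.f t - Dg γ.f γ.f t'‖ ≤ 1 / 4)
    (h1 : ∀ x, c0 ≤ ‖deriv γ.f x‖) (h2 : ∀ x, ‖deriv γ.f x‖ ≤ C0)
    (hN : ∀ x, ‖Dg γ.f u.f x‖ ≤ N) (x y : ℝ) :
    ‖Dg γ.f u.f y - Dg γ.f u.f x‖ ^ 2 / dT x y ^ (2 * s - 1) ≤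
      C0 ^ (2 * s - 1) * (c0 ^ 2)⁻¹ * Qd s γ.f u.f x y + 4 * N ^ 2 / (r / C0) ^ (2 * s - 1) := by
  have hp : 0 < 2 * s - 1 := by linarith [hs.1]
  have hN0 : 0 ≤ N := (norm_nonneg _).trans (hN 0)
  have hQ : 0 ≤ Qd s γ.f u.f x y := by unfold Qd; positivity
  have hc := γ.mem.cont_deriv
  rcases le_total (dT x y) (r / C0) with hd | hd
  · refine le_add_of_le_of_nonneg ?_ (by positivity)
    obtain ⟨k, hk1, hk2⟩ := dT_shift x y
    have e1 : Dg γ.f u.f (y + k) = Dg γ.f u.f y :=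
      per_int (u := Dg γ.f u.f) (fun y => (tA_per (s := s) γ.mem.1 u.mem.1 y y).2.2) y k
    have e2 : Qd s γ.f u.f x (y + k) = Qd s γ.f u.f x y := by
      have : Function.Periodic (fun y => Qd s γ.f u.f x y) 1 :=
        fun y => (Qd_per γ.mem.1 u.mem.1 x y).2
      simpa using this.int_mul k y
    rw [← e1, ← e2, ← hk1]
    rw [← hk1] at hd
    generalize y + k = y at *
    have hl : |phi γ.f y - phi γ.f x| ≤ C0 * |y - x| := by
      rcases le_total x y with h | h
      · rw [abs_of_nonneg (sub_nonneg.2 h),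
          abs_of_nonneg (sub_nonneg.2 ((phi_mono hc hγ.2.2).monotone h))]
        exact phi_le hc h2 h
      · rw [abs_sub_comm, abs_sub_comm y, abs_of_nonneg (sub_nonneg.2 h),
          abs_of_nonneg (sub_nonneg.2 ((phi_mono hc hγ.2.2).monotone h))]
        exact phi_le hc h2 h
    have hl2 : |phi γ.f y - phi γ.f x| ≤ r := hl.trans (by
      calc C0 * |y - x| ≤ C0 * (r / C0) := by gcongr
        _ = r := by field_simp)
    have hN2 := near (u := u.f) (a := min x y) (b := max x y) hs γ.mem.cd hγ.2.2
      (H1 _ _ min_le_max (by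
        rcases le_total x y with h | h
        · rw [min_eq_left h, max_eq_right h]; linarith [le_abs_self (y - x)]
        · rw [min_eq_right h, max_eq_left h]; linarith [neg_le_abs (y - x)]) (by
        rcases le_total x y with h | h
        · rw [min_eq_left h, max_eq_right h]; linarith [le_abs_self (phi γ.f y - phi γ.f x)]
        · rw [min_eq_right h, max_eq_left h]; linarith [neg_le_abs (phi γ.f y - phi γ.f x)]))
      x ⟨min_le_left _ _, le_max_left _ _⟩ y ⟨min_le_right _ _, le_max_right _ _⟩
    by_cases hxy : y = x
    · subst hxy
      have : 0 ≤ Qd s γ.f u.f y y := by unfold Qd; positivity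
      simp; positivity
    have hxy' : 0 < |y - x| := abs_pos.2 (sub_ne_zero.2 hxy)
    have hph : 0 < |phi γ.f y - phi γ.f x| :=
      abs_pos.2 (sub_ne_zero.2 ((phi_mono hc hγ.2.2).injective.ne hxy))
    set d := ‖Dg γ.f u.f y - Dg γ.f u.f x‖
    have h3 : d ^ 2 / |y - x| ^ (2 * s - 1) ≤
        C0 ^ (2 * s - 1) * (d ^ 2 / |phi γ.f y - phi γ.f x| ^ (2 * s - 1)) := by
      rw [mul_div_assoc', div_le_div_iff₀ (by positivity) (by positivity)]
      have := Real.rpow_le_rpow hph.le hl hp.le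
      rw [Real.mul_rpow hC0.le hxy'.le] at this
      nlinarith [sq_nonneg d]
    have h4 : d ^ 2 / |phi γ.f y - phi γ.f x| ^ (2 * s - 1) ≤
        (c0 ^ 2)⁻¹ * Qd s γ.f u.f x y := by
      rw [inv_mul_eq_div, le_div_iff₀ (by positivity)]
      refine le_trans (mul_le_mul_of_nonneg_left ?_ (by positivity)) hN2
      rw [sq]; exact mul_le_mul (h1 x) (h1 y) hc0.le (norm_nonneg _)
    calc _ ≤ _ := h3
      _ ≤ C0 ^ (2 * s - 1) * ((c0 ^ 2)⁻¹ * Qd s γ.f u.f x y) := by gcongr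
      _ = _ := by ring
  · refine le_add_of_nonneg_of_le (by positivity) ?_
    have h3 : ‖Dg γ.f u.f y - Dg γ.f u.f x‖ ≤ 2 * N :=
      (norm_sub_le _ _).trans (by linarith [hN x, hN y])
    have h4 : ‖Dg γ.f u.f y - Dg γ.f u.f x‖ ^ 2 ≤ 4 * N ^ 2 := by
      calc _ ≤ (2 * N) ^ 2 := by gcongr
        _ = _ := by ring
    have : 0 < r / C0 := by positivity
    gcongr

theorem Jf_ptw (hs : s ∈ Ioo (3 / 2 : ℝ) 2) {γ u : HS s n} (hγ : InM s γ.f) {r c0 C0 N : ℝ}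
    (hr : 0 < r) (hc0 : 0 < c0) (hC0 : 0 < C0)
    (H1 : ∀ a b, a ≤ b → b ≤ a + 1 → phi γ.f b - phi γ.f a ≤ r →
        ∀ t ∈ Icc a b, ∀ t' ∈ Icc a b, ‖Dg γ.f γ.f t - Dg γ.f γ.f t'‖ ≤ 1 / 4)
    (h1 : ∀ x, c0 ≤ ‖deriv γ.f x‖) (h2 : ∀ x, ‖deriv γ.f x‖ ≤ C0)
    (hN : ∀ x, ‖Dg γ.f u.f x‖ ≤ N) (z : ℝ × ℝ) :
    ‖Jf s u.f z‖ ^ 2 ≤ c0⁻¹ * ‖Tf s γ.f u.f z‖ ^ 2 +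
      2 * C0 ^ 2 * C0 ^ (2 * s - 1) * (c0 ^ 2)⁻¹ * Qd s γ.f u.f z.1 z.2 +
      2 * N ^ 2 * ‖Jf s γ.f z‖ ^ 2 +
      (C0 ^ 2 + 8 * C0 ^ 2 / (r / C0) ^ (2 * s - 1)) * N ^ 2 := by
  have e0 : 2 * (s - 1) + 1 = 2 * s - 1 := by ring
  rw [Jf_normsq, Jf_normsq, e0]
  obtain ⟨x, y⟩ := z
  have g1 := gag_near hs hγ hr hc0 hC0 H1 h1 h2 hN x y
  simp only
  have hp := Real.rpow_nonneg (dT_nonneg x y) (2 * s - 1)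
  set p := dT x y ^ (2 * s - 1)
  have e1 : ∀ x, deriv u.f x = ‖deriv γ.f x‖ • Dg γ.f u.f x := fun x => by
    rw [Dg, smul_inv_smul₀ (norm_ne_zero_iff.2 (hγ.2.2 x))]
  have k1 : ‖u.f x‖ ^ 2 ≤ c0⁻¹ * ‖Tf s γ.f u.f (x, y)‖ ^ 2 := by
    rw [inv_mul_eq_div, le_div_iff₀ hc0]
    calc ‖u.f x‖ ^ 2 * c0 ≤ ‖u.f x‖ ^ 2 * ‖deriv γ.f x‖ := by gcongr; exact h1 x
      _ ≤ _ := by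
        rw [← (Tf_comp hs γ.f u.f (x, y)).2.2.2.2.2, Tf_sum]
        nlinarith [sq_nonneg ‖Tf s γ.f u.f (x, y) 0‖, sq_nonneg ‖Tf s γ.f u.f (x, y) 1‖,
          sq_nonneg ‖Tf s γ.f u.f (x, y) 2‖, sq_nonneg ‖Tf s γ.f u.f (x, y) 3‖,
          sq_nonneg ‖Tf s γ.f u.f (x, y) 4‖]
  have k2 : ‖deriv u.f x‖ ^ 2 ≤ C0 ^ 2 * N ^ 2 := by
    rw [e1, norm_smul, norm_norm, mul_pow]
    gcongr
    exacts [h2 x, hN x]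
  have k3 : ‖deriv u.f y - deriv u.f x‖ ^ 2 ≤
      2 * C0 ^ 2 * ‖Dg γ.f u.f y - Dg γ.f u.f x‖ ^ 2 +
      2 * N ^ 2 * ‖deriv γ.f y - deriv γ.f x‖ ^ 2 := by
    have : deriv u.f y - deriv u.f x = ‖deriv γ.f y‖ • (Dg γ.f u.f y - Dg γ.f u.f x) +
        (‖deriv γ.f y‖ - ‖deriv γ.f x‖) • Dg γ.f u.f x := by
      rw [e1 x, e1 y, smul_sub, sub_smul]; abel
    have h5 : ‖deriv u.f y - deriv u.f x‖ ≤ C0 * ‖Dg γ.f u.f y - Dg γ.f u.f x‖ +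
        ‖deriv γ.f y - deriv γ.f x‖ * N := by
      rw [this]
      refine (norm_add_le _ _).trans ?_
      rw [norm_smul, norm_smul, norm_norm]
      refine add_le_add (by gcongr; exact h2 y)
        (mul_le_mul (abs_norm_sub_norm_le _ _) (hN x) (norm_nonneg _) (norm_nonneg _))
    calc _ ≤ (C0 * ‖Dg γ.f u.f y - Dg γ.f u.f x‖ + ‖deriv γ.f y - deriv γ.f x‖ * N) ^ 2 := by
          gcongr
      _ ≤ _ := by
          nlinarith [sq_nonneg (C0 * ‖Dg γ.f u.f y - Dg γ.f u.f x‖ -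
            ‖deriv γ.f y - deriv γ.f x‖ * N)]
  have k4 : ‖deriv u.f y - deriv u.f x‖ ^ 2 / p ≤
      2 * C0 ^ 2 * (‖Dg γ.f u.f y - Dg γ.f u.f x‖ ^ 2 / p) +
      2 * N ^ 2 * (‖deriv γ.f y - deriv γ.f x‖ ^ 2 / p) := by
    refine (div_le_div_of_nonneg_right k3 hp).trans (le_of_eq ?_)
    rw [add_div, mul_div_assoc, mul_div_assoc]
  have k5 := mul_le_mul_of_nonneg_left g1 (by positivity : 0 ≤ 2 * C0 ^ 2)
  have k6 : 0 ≤ 2 * N ^ 2 * (‖γ.f x‖ ^ 2 + ‖deriv γ.f x‖ ^ 2) := by positivity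
  have k7 : 8 * C0 ^ 2 / (r / C0) ^ (2 * s - 1) * N ^ 2 =
    2 * C0 ^ 2 * (4 * N ^ 2 / (r / C0) ^ (2 * s - 1)) := by ring
  nlinarith

theorem coer (hs : s ∈ Ioo (3 / 2 : ℝ) 2) (n : ℕ) {E c0 C0 : ℝ} (hE0 : 0 ≤ E) (hc0 : 0 < c0)
    (hC0 : 0 < C0) : ∃ C, 0 < C ∧
    ∀ γ : HS s n, InM s γ.f → EN s γ.f ≤ ENNReal.ofReal E → (∀ x, c0 ≤ ‖deriv γ.f x‖) →
      (∀ x, ‖deriv γ.f x‖ ≤ C0) → ∀ u : HS s n, ‖u‖ ≤ C * (1 + ‖γ‖) * ‖TT γ u‖ := by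
  obtain ⟨r, hr, H⟩ := exists_r0 hs n hE0
  obtain ⟨C1, hC1, H'⟩ := sup_Dg hs n hE0
  set K2 := 2 * C0 ^ 2 * C0 ^ (2 * s - 1) * (c0 ^ 2)⁻¹ with hK2
  set K4 := C0 ^ 2 + 8 * C0 ^ 2 / (r / C0) ^ (2 * s - 1) with hK4
  have hK20 : 0 < K2 := by positivity
  have hK40 : 0 < K4 := by positivity
  set K := c0⁻¹ + 32 * K2 + K4 * C1 ^ 2 + 2 * C1 ^ 2
  have hK : 0 < K := by positivity
  refine ⟨√K, by positivity, fun γ hγ hE h1 h2 u => ?_⟩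
  obtain ⟨H1, -⟩ := H γ hγ hE
  have hN := H' γ hγ hE u
  set G := ‖TT γ u‖
  have m1 : AEMeasurable (fun z => ENNReal.ofReal (‖Tf s γ.f u.f z‖ ^ 2)) mu2 :=
    ((Tf_meas s γ.mem.cd u.mem.cd).norm.pow 2).aemeasurable.ennreal_ofReal
  have m2 : Measurable fun z : ℝ × ℝ => ENNReal.ofReal (Qd s γ.f u.f z.1 z.2) :=
    (Qd_meas γ.mem.cd u.mem.cd).ennreal_ofReal
  have hQ : ∀ z : ℝ × ℝ, 0 ≤ Qd s γ.f u.f z.1 z.2 := fun z => by unfold Qd; positivity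
  have key : ‖u‖ ^ 2 ≤ c0⁻¹ * G ^ 2 + K2 * (32 * G ^ 2) + 2 * (C1 * G) ^ 2 * ‖γ‖ ^ 2 +
      K4 * (C1 * G) ^ 2 := by
    rw [← ENNReal.ofReal_le_ofReal_iff (by positivity), HS.normsq_lint]
    calc _ ≤ ∫⁻ z, (ENNReal.ofReal c0⁻¹ * ENNReal.ofReal (‖Tf s γ.f u.f z‖ ^ 2) +
          (ENNReal.ofReal K2 * ENNReal.ofReal (Qd s γ.f u.f z.1 z.2) + 
          (ENNReal.ofReal (2 * (C1 * G) ^ 2) * ENNReal.ofReal (‖Jf s γ.f z‖ ^ 2) +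
          ENNReal.ofReal (K4 * (C1 * G) ^ 2)))) ∂mu2 := by
          refine lintegral_mono fun z => ?_
          have := hQ z
          rw [← ENNReal.ofReal_mul (by positivity), ← ENNReal.ofReal_mul (by positivity),
            ← ENNReal.ofReal_mul (by positivity), ← ENNReal.ofReal_add (by positivity)
            (by positivity), ← ENNReal.ofReal_add (by positivity) (by positivity),
            ← ENNReal.ofReal_add (by positivity) (by positivity)]
          apply ENNReal.ofReal_le_ofReal
          have := Jf_ptw hs hγ hr hc0 hC0 H1 h1 h2 hN z
          linarith
      _ ≤ ENNReal.ofReal c0⁻¹ * ENNReal.ofReal (G ^ 2) +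
          (ENNReal.ofReal K2 * ENNReal.ofReal (32 * G ^ 2) + 
          (ENNReal.ofReal (2 * (C1 * G) ^ 2) * ENNReal.ofReal (‖γ‖ ^ 2) +
          ENNReal.ofReal (K4 * (C1 * G) ^ 2))) := by
          rw [lintegral_add_left' (m1.const_mul _), lintegral_add_left (m2.const_mul _),
            lintegral_add_right _ measurable_const,
            lintegral_const_mul' _ _ ENNReal.ofReal_ne_top,
            lintegral_const_mul' _ _ ENNReal.ofReal_ne_top,
            lintegral_const_mul' _ _ ENNReal.ofReal_ne_top, ← TT_lint hs hγ, ← HS.normsq_lint,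
            lintegral_const, measure_univ, mul_one]
          have := Qd_gen hs hγ u
          gcongr
      _ = _ := by
          rw [← ENNReal.ofReal_mul (by positivity), ← ENNReal.ofReal_mul (by positivity),
            ← ENNReal.ofReal_mul (by positivity), ← ENNReal.ofReal_add (by positivity)
            (by positivity), ← ENNReal.ofReal_add (by positivity) (by positivity),
            ← ENNReal.ofReal_add (by positivity) (by positivity)]
          congr 1; ring
  refine le_of_sq_le_sq ?_ (by positivity)
  rw [mul_pow, mul_pow, Real.sq_sqrt hK.le]
  refine key.trans ?_
  have hb : 0 ≤ ‖γ‖ := norm_nonneg γ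
  have q1 : 0 ≤ (2 * ‖γ‖ + ‖γ‖ ^ 2) * (c0⁻¹ + 32 * K2 + K4 * C1 ^ 2) * G ^ 2 := by positivity
  have q2 : 0 ≤ (1 + 2 * ‖γ‖) * (2 * C1 ^ 2) * G ^ 2 := by positivity
  have : K * (1 + ‖γ‖) ^ 2 * G ^ 2 - (c0⁻¹ * G ^ 2 + K2 * (32 * G ^ 2) + 2 * (C1 * G) ^ 2 * ‖γ‖ ^ 2
    + K4 * (C1 * G) ^ 2) = (2 * ‖γ‖ + ‖γ‖ ^ 2) * (c0⁻¹ + 32 * K2 + K4 * C1 ^ 2) * G ^ 2 +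
    (1 + 2 * ‖γ‖) * (2 * C1 ^ 2) * G ^ 2 := by simp only [K]; ring
  linarith

end

section
variable {s : ℝ} {n : ℕ}

theorem phi_arc {γ : ℝ → En n} (hc : Continuous (deriv γ)) {x r η : ℝ}
    (h : r < phi γ (x + 1) - phi γ x) (h0 : 0 ≤ η) (h1 : η ≤ r) :
    ∃ b, x ≤ b ∧ b ≤ x + 1 ∧ phi γ b = phi γ x + η := by
  obtain ⟨b, ⟨hb1, hb2⟩, hb⟩ : phi γ x + η ∈ phi γ '' Icc x (x + 1) :=
    intermediate_value_Icc (by linarith) (phi_cont hc).continuousOn ⟨by linarith, by linarith⟩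
  exact ⟨b, hb1, hb2, hb⟩

/-- energy lower bound near an orthogonal chord -/
theorem orth_chord (hs : s ∈ Ioo (3 / 2 : ℝ) 2) {γ : HS s n} (hγ : InM s γ.f) {E r x y : ℝ}
    (hE0 : 0 ≤ E) (hE : EN s γ.f ≤ ENNReal.ofReal E)
    (H1 : ∀ a b, a ≤ b → b ≤ a + 1 → phi γ.f b - phi γ.f a ≤ r →
        ∀ t ∈ Icc a b, ∀ t' ∈ Icc a b, ‖Dg γ.f γ.f t - Dg γ.f γ.f t'‖ ≤ 1 / 4)
    (H2 : ∀ x, r < phi γ.f (x + 1) - phi γ.f x)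
    (h0 : ⟪Dg γ.f γ.f y, γ.f x - γ.f y⟫ = 0) (hε : 0 < ‖γ.f y - γ.f x‖)
    (hr : ‖γ.f y - γ.f x‖ ≤ r) :
    1 ≤ 1024 * E * 2 ^ (2 * s + 1) * ‖γ.f y - γ.f x‖ ^ (2 * s - 3) := by
  set ε := ‖γ.f y - γ.f x‖
  have hc := γ.mem.cont_deriv
  have hφm := phi_mono hc hγ.2.2
  obtain ⟨x1, hx1, hx1', hx⟩ := phi_arc hc (H2 x) (η := ε / 8) (by positivity) (by linarith)
  obtain ⟨y1, hy1, hy1', hy⟩ := phi_arc hc (H2 y) (η := ε / 8) (by positivity) (by linarith)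
  have ptw : ∀ y' ∈ Ioc y y1, ∀ x' ∈ Ioc x x1,
      (ε ^ 2 / 16) / (2 * ε) ^ (2 * s + 1) * (‖deriv γ.f y'‖ * ‖deriv γ.f x'‖) ≤
        ‖tA s γ.f γ.f y' x'‖ ^ 2 := by
    intro y' hy' x' hx'
    have a1 : ‖γ.f y' - γ.f y‖ ≤ ε / 8 := (chord_le γ.mem.cd hy'.1.le).trans (by
      linarith [hφm.monotone hy'.2])
    have a2 : ‖γ.f x' - γ.f x‖ ≤ ε / 8 := (chord_le γ.mem.cd hx'.1.le).trans (by
      linarith [hφm.monotone hx'.2])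
    have a3 : ‖Dg γ.f γ.f y' - Dg γ.f γ.f y‖ ≤ 1 / 4 := H1 y y1 hy1 hy1' (by linarith) y'
      (Ioc_subset_Icc_self hy') y ⟨le_rfl, hy1⟩
    set δ := (γ.f x' - γ.f x) - (γ.f y' - γ.f y) with hδ
    have a4 : ‖δ‖ ≤ ε / 4 := (norm_sub_le _ _).trans (by linarith)
    have a5 : γ.f x' - γ.f y' = (γ.f x - γ.f y) + δ := by rw [hδ]; abel
    have a6 : ‖γ.f x - γ.f y‖ = ε := norm_sub_rev _ _
    have b1 : ‖γ.f x' - γ.f y'‖ ≤ 2 * ε := by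
      rw [a5]; exact (norm_add_le _ _).trans (by linarith)
    have b2 : 3 / 4 * ε ≤ ‖γ.f x' - γ.f y'‖ := by
      have := norm_sub_le ((γ.f x - γ.f y) + δ) δ
      rw [add_sub_cancel_right, ← a5] at this; linarith
    have b3 : |⟪Dg γ.f γ.f y', γ.f x' - γ.f y'⟫| ≤ ε / 2 := by
      have e : ⟪Dg γ.f γ.f y', γ.f x' - γ.f y'⟫ =
          ⟪Dg γ.f γ.f y' - Dg γ.f γ.f y, γ.f x - γ.f y⟫ + ⟪Dg γ.f γ.f y', δ⟫ := by
        rw [a5, inner_add_right, inner_sub_left, h0]; ring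
      rw [e]
      refine (abs_add_le _ _).trans ?_
      have c1 := abs_real_inner_le_norm (Dg γ.f γ.f y' - Dg γ.f γ.f y) (γ.f x - γ.f y)
      have c2 := abs_real_inner_le_norm (Dg γ.f γ.f y') δ
      rw [tau_norm (hγ.2.2 _), one_mul] at c2
      rw [a6] at c1
      nlinarith
    have b4 : ε / 4 ≤ ‖Av γ.f γ.f y' x'‖ := by
      rw [Av, DDg_eq]
      have := norm_sub_norm_le (γ.f x' - γ.f y')
        (⟪Dg γ.f γ.f y', γ.f x' - γ.f y'⟫ • Dg γ.f γ.f y')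
      rw [norm_smul, tau_norm (hγ.2.2 _), mul_one, Real.norm_eq_abs] at this
      linarith
    have b5 : 0 < ‖γ.f x' - γ.f y'‖ := by linarith
    rw [tA_sq' s γ.f (sub_ne_zero.1 (norm_pos_iff.1 b5)), mul_div_right_comm]
    refine mul_le_mul_of_nonneg_right ?_ (by positivity)
    have b6 : ε ^ 2 / 16 ≤ ‖Av γ.f γ.f y' x'‖ ^ 2 := by nlinarith
    have b7 : ‖γ.f x' - γ.f y'‖ ^ (2 * s + 1) ≤ (2 * ε) ^ (2 * s + 1) :=
      Real.rpow_le_rpow b5.le b1 (by linarith [hs.1])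
    exact div_le_div₀ (by positivity) b6 (by positivity) b7
  set κ := (ε ^ 2 / 16) / (2 * ε) ^ (2 * s + 1) with hκ
  have hκ0 : 0 ≤ κ := by positivity
  have hν : ∀ a b, a ≤ b → ∫⁻ t in Ioc a b, ENNReal.ofReal ‖deriv γ.f t‖ =
      ENNReal.ofReal (phi γ.f b - phi γ.f a) := fun a b hab => by
    rw [← nu_Ioc hc a b hab, withDensity_apply _ measurableSet_Ioc]
  have hint : κ * ((ε / 8) * (ε / 8)) ≤ E := by
    rw [← ENNReal.ofReal_le_ofReal_iff hE0]
    refine le_trans ?_ hE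
    have m := (tA_meas s γ.mem.cd γ.mem.cd)
    have m' : Measurable (Function.uncurry fun x y => ENNReal.ofReal (‖tA s γ.f γ.f x y‖ ^ 2)) :=
      (m.norm.pow_const 2).ennreal_ofReal
    rw [EN, ← mu2_iter (F := fun x y => ENNReal.ofReal (‖tA s γ.f γ.f x y‖ ^ 2)) m']
    refine le_trans ?_ (per_lint2_le (A := Ioc y y1) (B := Ioc x x1) (a := y) (b := x)
      (fun y x => ?_) (fun x y => ?_) (Ioc_subset_Ioc_right hy1') (Ioc_subset_Ioc_right hx1'))
    · calc _ = ∫⁻ y' in Ioc y y1, ∫⁻ x' in Ioc x x1,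
            ENNReal.ofReal κ * ENNReal.ofReal ‖deriv γ.f y'‖ * ENNReal.ofReal ‖deriv γ.f x'‖ := by
            simp_rw [lintegral_const_mul' _ _ (ENNReal.mul_ne_top ENNReal.ofReal_ne_top
              ENNReal.ofReal_ne_top), hν x x1 hx1]
            rw [lintegral_mul_const' _ _ ENNReal.ofReal_ne_top,
              lintegral_const_mul' _ _ ENNReal.ofReal_ne_top, hν y y1 hy1, hx, hy,
              ← ENNReal.ofReal_mul hκ0, ← ENNReal.ofReal_mul (mul_nonneg hκ0 (by linarith))]
            congr 1; ring
        _ ≤ _ := by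
            refine setLIntegral_mono' measurableSet_Ioc fun y' hy' =>
              setLIntegral_mono' measurableSet_Ioc fun x' hx' => ?_
            rw [← ENNReal.ofReal_mul hκ0, ← ENNReal.ofReal_mul (by positivity)]
            apply ENNReal.ofReal_le_ofReal
            rw [mul_assoc]; exact ptw y' hy' x' hx'
    · simp [(tA_per (s := s) γ.mem.1 γ.mem.1 _ _).1]
    · simp [(tA_per (s := s) γ.mem.1 γ.mem.1 _ _).2.1]
  have e1 : ε ^ (2 * s + 1) = ε ^ (2 * s - 3) * ε ^ 4 := by
    rw [← Real.rpow_natCast, ← Real.rpow_add hε]; congr 1; push_cast; ring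
  rw [hκ, Real.mul_rpow (by norm_num) hε.le, e1, div_mul_eq_mul_div,
    div_le_iff₀ (by positivity)] at hint
  have e2 : ε ^ 2 / 16 * (ε / 8 * (ε / 8)) = 1 / 1024 * ε ^ 4 := by ring
  have e3 : E * (2 ^ (2 * s + 1) * (ε ^ (2 * s - 3) * ε ^ 4)) =
    (E * 2 ^ (2 * s + 1) * ε ^ (2 * s - 3)) * ε ^ 4 := by ring
  rw [e2, e3] at hint
  have := le_of_mul_le_mul_right hint (by positivity)
  linarith

theorem far_chord (hs : s ∈ Ioo (3 / 2 : ℝ) 2) {γ : HS s n} (hγ : InM s γ.f) {E r x : ℝ}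
    (hE0 : 0 ≤ E) (hE : EN s γ.f ≤ ENNReal.ofReal E) (hr : 0 < r)
    (H1 : ∀ a b, a ≤ b → b ≤ a + 1 → phi γ.f b - phi γ.f a ≤ r →
        ∀ t ∈ Icc a b, ∀ t' ∈ Icc a b, ‖Dg γ.f γ.f t - Dg γ.f γ.f t'‖ ≤ 1 / 4)
    (H2 : ∀ x, r < phi γ.f (x + 1) - phi γ.f x) {y0 : ℝ} (hy0 : y0 ∈ Icc x (x + 1))
    (h1 : r ≤ phi γ.f y0 - phi γ.f x) (h2 : r ≤ phi γ.f (x + 1) - phi γ.f y0) :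
    min (r / 2) ((1 / (1024 * E * 2 ^ (2 * s + 1) + 1)) ^ (2 * s - 3)⁻¹) ≤
      ‖γ.f y0 - γ.f x‖ := by
  have hc := γ.mem.cont_deriv
  have hφ := phi_cont hc
  have hφm := phi_mono hc hγ.2.2
  have hgc := γ.mem.cd.continuous
  set S := {y | y ∈ Icc x (x + 1) ∧ r ≤ phi γ.f y - phi γ.f x ∧
    r ≤ phi γ.f (x + 1) - phi γ.f y}
  have hS : IsCompact S := isCompact_Icc.inter_right
    ((isClosed_le (f := fun _ : ℝ => r) (g := fun y => phi γ.f y - phi γ.f x)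
      continuous_const (by fun_prop)).inter
    (isClosed_le (f := fun _ : ℝ => r) (g := fun y => phi γ.f (x + 1) - phi γ.f y)
      continuous_const (by fun_prop)))
  obtain ⟨y, hyS, hmin⟩ := hS.exists_isMinOn ⟨y0, hy0, h1, h2⟩
    (f := fun y => ‖γ.f y - γ.f x‖) (by fun_prop)
  refine le_trans ?_ (hmin (show y0 ∈ S from ⟨hy0, h1, h2⟩))
  obtain ⟨hy, g1, g2⟩ := hyS
  show _ ≤ ‖γ.f y - γ.f x‖
  have near1 : ∀ a b, a ≤ b → b ≤ a + 1 → phi γ.f b - phi γ.f a ≤ r →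
      (phi γ.f b - phi γ.f a) / 2 ≤ ‖γ.f b - γ.f a‖ := fun a b hab hb hl => by
    have := rho_ge γ.mem.cd hγ.2.2 hab a fun t ht => H1 a b hab hb hl t ht a ⟨le_rfl, hab⟩
    have h3 := real_inner_le_norm (Dg γ.f γ.f a) (γ.f b - γ.f a)
    rw [tau_norm (hγ.2.2 a), one_mul] at h3
    exact this.trans h3
  rcases g1.eq_or_lt with g1 | g1
  · refine (min_le_left _ _).trans ?_
    have := near1 x y hy.1 hy.2 g1.symm.le
    linarith
  rcases g2.eq_or_lt with g2 | g2
  · refine (min_le_left _ _).trans ?_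
    have := near1 y (x + 1) hy.2 (by linarith [hy.1]) g2.symm.le
    rw [γ.mem.1 x, norm_sub_rev] at this
    linarith
  have hxy : x < y := hφm.lt_iff_lt.1 (by linarith)
  have hyx : y < x + 1 := hφm.lt_iff_lt.1 (by linarith)
  have hloc : IsLocalMin (fun t => ‖γ.f t - γ.f x‖ ^ 2) y := by
    have o1 : ∀ᶠ t in 𝓝 y, r < phi γ.f t - phi γ.f x :=
      (hφ.sub continuous_const).continuousAt.eventually (lt_mem_nhds g1)
    have o2 : ∀ᶠ t in 𝓝 y, r < phi γ.f (x + 1) - phi γ.f t :=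
      (continuous_const.sub hφ).continuousAt.eventually (lt_mem_nhds g2)
    filter_upwards [o1, o2, Ioo_mem_nhds hxy hyx] with t t1 t2 t3
    have : ‖γ.f y - γ.f x‖ ≤ ‖γ.f t - γ.f x‖ := hmin (show t ∈ S from
      ⟨Ioo_subset_Icc_self t3, t1.le, t2.le⟩)
    gcongr
  have hder : HasDerivAt (fun t => ‖γ.f t - γ.f x‖ ^ 2)
      (2 * ⟪γ.f y - γ.f x, deriv γ.f y⟫) y :=
    ((γ.mem.dif y).hasDerivAt.sub_const _).norm_sq
  have h0 := hloc.hasDerivAt_eq_zero hder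
  have horth : ⟪Dg γ.f γ.f y, γ.f x - γ.f y⟫ = 0 := by
    rw [Dg, inner_smul_left, ← neg_sub, inner_neg_right, real_inner_comm]
    have : ⟪γ.f y - γ.f x, deriv γ.f y⟫ = 0 := by linarith
    rw [this]; simp
  have hε : 0 < ‖γ.f y - γ.f x‖ := by
    obtain ⟨c, hc0, hk⟩ := KK.exists hs γ hγ
    refine lt_of_lt_of_le ?_ (hk.2 x y)
    have : 0 < dT x y := by
      have e1 : dT x y = dT 0 (y - x) := by unfold dT; congr 1; ext k; congr 1; ring
      rw [e1]; exact dT_pos ⟨le_rfl, by norm_num⟩ ⟨by linarith, by linarith⟩ (by linarith)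
    positivity
  rcases le_total ‖γ.f y - γ.f x‖ r with hle | hle
  · have h3 := orth_chord hs hγ hE0 hE H1 H2 horth hε hle
    refine (min_le_right _ _).trans ?_
    have hp : 0 < 2 * s - 3 := by linarith [hs.1]
    set ε := ‖γ.f y - γ.f x‖
    have hεp : 0 < ε ^ (2 * s - 3) := by positivity
    have hK : 0 < 1024 * E * 2 ^ (2 * s + 1) + 1 := by positivity
    calc _ ≤ (ε ^ (2 * s - 3)) ^ (2 * s - 3)⁻¹ := by
          refine Real.rpow_le_rpow (by positivity) ?_ (by positivity)
          rw [div_le_iff₀ hK]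
          nlinarith
      _ = ε := by rw [← Real.rpow_mul hε.le, mul_inv_cancel₀ hp.ne', Real.rpow_one]
  · exact (min_le_left _ _).trans (by linarith)

theorem chord_arc (hs : s ∈ Ioo (3 / 2 : ℝ) 2) (n : ℕ) {E c0 : ℝ} (hE0 : 0 ≤ E) (hc0 : 0 < c0) :
    ∃ c, 0 < c ∧ ∀ γ : HS s n, InM s γ.f → EN s γ.f ≤ ENNReal.ofReal E →
      (∀ x, c0 ≤ ‖deriv γ.f x‖) → ∀ x y, c * dT x y ≤ ‖γ.f y - γ.f x‖ := by
  obtain ⟨r, hr, H⟩ := exists_r0 hs n hE0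
  set ε0 := min (r / 2) ((1 / (1024 * E * 2 ^ (2 * s + 1) + 1)) ^ (2 * s - 3)⁻¹) with hε0
  have hε : 0 < ε0 := lt_min (by positivity) (by positivity)
  refine ⟨min (c0 / 2) ε0, lt_min (by positivity) hε, fun γ hγ hE h1 x y => ?_⟩
  obtain ⟨H1, H2⟩ := H γ hγ hE
  have hc := γ.mem.cont_deriv
  have near1 : ∀ a b, a ≤ b → b ≤ a + 1 → phi γ.f b - phi γ.f a ≤ r →
      c0 / 2 * (b - a) ≤ ‖γ.f b - γ.f a‖ := fun a b hab hb hl => by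
    have := rho_ge γ.mem.cd hγ.2.2 hab a fun t ht => H1 a b hab hb hl t ht a ⟨le_rfl, hab⟩
    have h3 := real_inner_le_norm (Dg γ.f γ.f a) (γ.f b - γ.f a)
    rw [tau_norm (hγ.2.2 a), one_mul] at h3
    have := phi_ge hc h1 hab
    linarith
  have e1 : γ.f (y + (-⌊y - x⌋ : ℤ)) = γ.f y := per_int γ.mem.1 y _
  have e2 : dT x (y + (-⌊y - x⌋ : ℤ)) = dT x y := dT_add_int_right x y _
  rw [← e1, ← e2]
  have hy : y + (-⌊y - x⌋ : ℤ) ∈ Icc x (x + 1) := by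
    have := Int.floor_le (y - x)
    have := Int.lt_floor_add_one (y - x)
    push_cast; constructor <;> linarith
  generalize y + (-⌊y - x⌋ : ℤ) = y at *
  have hd := dT_nonneg x y
  have hd1 : dT x y ≤ y - x := (dT_le_abs x y).trans_eq (abs_of_nonneg (by linarith [hy.1]))
  have hd2 : dT x y ≤ x + 1 - y := by
    have := dT_le_abs (x + 1) y
    have e := dT_add_int_left x y 1
    push_cast at e
    rw [e, abs_sub_comm, abs_of_nonneg (by linarith [hy.2])] at this
    exact this
  rcases le_total (phi γ.f y - phi γ.f x) r with g1 | g1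
  · calc _ ≤ c0 / 2 * (y - x) := mul_le_mul (min_le_left _ _) hd1 hd (by positivity)
      _ ≤ _ := near1 x y hy.1 hy.2 g1
  rcases le_total (phi γ.f (x + 1) - phi γ.f y) r with g2 | g2
  · have := near1 y (x + 1) hy.2 (by linarith [hy.1]) g2
    rw [γ.mem.1 x, norm_sub_rev] at this
    calc _ ≤ c0 / 2 * (x + 1 - y) := mul_le_mul (min_le_left _ _) hd2 hd (by positivity)
      _ ≤ _ := this
  · calc _ ≤ ε0 * 1 := mul_le_mul (min_le_right _ _) ((dT_le_half x y).trans (by norm_num)) hd hε.le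
      _ ≤ _ := by rw [mul_one]; exact far_chord hs hγ hE0 hE hr H1 H2 hy g1 g2

end

/-! ### Part 15: paths -/
section
variable {s : ℝ} {n : ℕ}

def HPath (g v : ℝ → HS s n) : Prop :=
  (∀ t ∈ Icc (0:ℝ) 1, HasDerivWithinAt g (v t) (Icc 0 1) t) ∧ ContinuousOn v (Icc 0 1) ∧
    ∀ t ∈ Icc (0:ℝ) 1, InM s (g t).f

theorem HPath.cont {g v : ℝ → HS s n} (h : HPath g v) : ContinuousOn g (Icc 0 1) :=
  fun t ht => (h.1 t ht).continuousWithinAt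

theorem nw_shift (t : ℝ) : Tendsto (fun h : ℝ => t + h)
    (𝓝[{h : ℝ | t + h ∈ Icc (0:ℝ) 1 ∧ h ≠ 0}] 0) (𝓝[Icc (0:ℝ) 1 \ {t}] t) := by
  refine tendsto_nhdsWithin_iff.2 ⟨?_, ?_⟩
  · have : Tendsto (fun h : ℝ => t + h) (𝓝 0) (𝓝 (t + 0)) := Continuous.tendsto (by fun_prop) 0
    rw [add_zero] at this; exact this.mono_left nhdsWithin_le_nhds
  · filter_upwards [self_mem_nhdsWithin] with h hh
    exact ⟨hh.1, fun e => hh.2 (by simpa using e)⟩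

theorem nw_shift' (t : ℝ) : Tendsto (fun τ : ℝ => τ - t)
    (𝓝[Icc (0:ℝ) 1 \ {t}] t) (𝓝[{h : ℝ | t + h ∈ Icc (0:ℝ) 1 ∧ h ≠ 0}] 0) := by
  refine tendsto_nhdsWithin_iff.2 ⟨?_, ?_⟩
  · have : Tendsto (fun h : ℝ => h - t) (𝓝 t) (𝓝 (t - t)) := Continuous.tendsto (by fun_prop) t
    rw [sub_self] at this; exact this.mono_left nhdsWithin_le_nhds
  · filter_upwards [self_mem_nhdsWithin] with h hh
    exact ⟨by simpa using hh.1, fun e => hh.2 (by simpa using sub_eq_zero.1 e)⟩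

def HPath.toC {g v : ℝ → HS s n} (h : HPath g v) : C1Path s n where
  Γ t := (g t).f
  V t := (v t).f
  mem := h.2.2
  memV t _ := (v t).mem
  isDeriv t ht := by
    have h1 := (hasDerivWithinAt_iff_tendsto_slope.1 (h.1 t ht)).comp (nw_shift t)
    have h2 := (tendsto_iff_norm_sub_tendsto_zero.1 h1)
    refine h2.congr fun τ => ?_
    rw [HS.norm_eq]; simp only [Function.comp, slope_def_module, add_sub_cancel_left]; rfl
  contV t ht := by
    refine (tendsto_iff_norm_sub_tendsto_zero.1 (h.2.1 t ht)).congr fun τ => ?_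
    rw [HS.norm_eq]; rfl

theorem C1Path.toH (P : C1Path s n) : ∃ g v : ℝ → HS s n, HPath g v ∧
    ∀ t ∈ Icc (0:ℝ) 1, (g t).f = P.Γ t ∧ (v t).f = P.V t := by
  classical
  set g : ℝ → HS s n := fun t => if h : t ∈ Icc (0:ℝ) 1 then HS.mk (P.Γ t) (P.mem t h).1 else 0 with hg
  set v : ℝ → HS s n := fun t => if h : t ∈ Icc (0:ℝ) 1 then HS.mk (P.V t) (P.memV t h) else 0 with hv
  have eg : ∀ t ∈ Icc (0:ℝ) 1, (g t).f = P.Γ t := fun t ht => by simp only [hg, dif_pos ht, HS.mk_f]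
  have ev : ∀ t ∈ Icc (0:ℝ) 1, (v t).f = P.V t := fun t ht => by simp only [hv, dif_pos ht, HS.mk_f]
  refine ⟨g, v, ⟨fun t ht => ?_, fun t ht => ?_, fun t ht => by rw [eg t ht]; exact P.mem t ht⟩,
    fun t ht => ⟨eg t ht, ev t ht⟩⟩
  · refine hasDerivWithinAt_iff_tendsto_slope.2 (tendsto_iff_norm_sub_tendsto_zero.2 ?_)
    refine ((P.isDeriv t ht).comp (nw_shift' t)).congr' ?_
    filter_upwards [self_mem_nhdsWithin] with τ hτ
    rw [HS.norm_eq]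
    simp only [Function.comp, slope_def_module, HS.sub_f, HS.smul_f, eg t ht, eg τ hτ.1, ev t ht,
      add_sub_cancel]
    rfl
  · refine tendsto_iff_norm_sub_tendsto_zero.2 ((P.contV t ht).congr' ?_)
    filter_upwards [self_mem_nhdsWithin] with τ hτ
    rw [HS.norm_eq, HS.sub_f, ev t ht, ev τ hτ]; rfl

theorem TT_sub' {A c : ℝ} {C : ℝ} (hC : ∀ γ γ' : HS s n,
    γ ∈ KK s n A c → γ' ∈ KK s n A c → ∀ u, ‖TT γ u‖ ≤ C * ‖u‖ ∧
      ‖TT γ u - TT γ' u‖ ≤ C * ‖γ - γ'‖ * ‖u‖) {γ γ' : HS s n} (h : γ ∈ KK s n A c)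
    (h' : γ' ∈ KK s n A c) (u : HS s n) : ‖TT γ u‖ ≤ ‖TT γ' u‖ + C * ‖γ - γ'‖ * ‖u‖ := by
  have := (hC γ γ' h h' u).2
  have h2 := norm_sub_norm_le (TT γ u) (TT γ' u)
  linarith

theorem KK.nbhd (hs : s ∈ Ioo (3 / 2 : ℝ) 2) {γ : HS s n} {A c : ℝ} (hc : 0 < c)
    (h : γ ∈ KK s n A c) : ∃ ρ, 0 < ρ ∧ ρ ≤ 1 ∧ ρ * (2 * Cs s) ≤ c ∧ ∀ γ' : HS s n, ‖γ' - γ‖ ≤ ρ → γ' ∈ KK s n (A + 1) (c / 2) := by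
  have h2 := Cs_ge hs
  refine ⟨min 1 (c / (2 * Cs s)), by positivity, min_le_left _ _, ?_, fun γ' h' => ?_⟩
  · exact (mul_le_mul_of_nonneg_right (min_le_right _ _) (by positivity)).trans_eq (by field_simp)
  · refine KK.mono (KK.pert hs h h') (by linarith [min_le_left 1 (c / (2 * Cs s))]) ?_
    have := mul_le_mul_of_nonneg_left (min_le_right 1 (c / (2 * Cs s))) (by positivity : 0 ≤ Cs s)
    have e : Cs s * (c / (2 * Cs s)) = c / 2 := by field_simp
    linarith

theorem TT_cont (hs : s ∈ Ioo (3 / 2 : ℝ) 2) {ι : Type*} {l : Filter ι} {g v : ι → HS s n}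
    {γ u : HS s n} (h : InM s γ.f) (hg : Tendsto g l (𝓝 γ)) (hv : Tendsto v l (𝓝 u)) :
    Tendsto (fun i => ‖TT (g i) (v i)‖) l (𝓝 ‖TT γ u‖) := by
  obtain ⟨c, hc, hk⟩ := KK.exists hs γ h
  obtain ⟨ρ, hρ, -, -, hn⟩ := KK.nbhd hs hc hk
  obtain ⟨C, hC, hT⟩ := TT_est hs n (half_pos hc) (‖γ‖ + 1)
  have hkγ := hn γ (by simpa using hρ.le)
  have h1 : Tendsto (fun i => ‖g i - γ‖) l (𝓝 0) := tendsto_iff_norm_sub_tendsto_zero.1 hg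
  have h2 : Tendsto (fun i => ‖v i - u‖) l (𝓝 0) := tendsto_iff_norm_sub_tendsto_zero.1 hv
  have h3 : Tendsto (fun i => C * ‖g i - γ‖ * ‖v i‖ + C * ‖v i - u‖) l (𝓝 0) := by
    have := ((h1.const_mul C).mul hv.norm).add (h2.const_mul C)
    simpa using this
  refine tendsto_iff_norm_sub_tendsto_zero.2 (squeeze_zero' (Eventually.of_forall fun i => norm_nonneg _) ?_ h3)
  filter_upwards [h1.eventually (ge_mem_nhds hρ)] with i hi
  have hki := hn (g i) hi
  have e1 := (hT (g i) γ hki hkγ (v i)).2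
  have e2 := (hT γ γ hkγ hkγ (v i - u)).1
  rw [TT_sub hs h] at e2
  calc ‖‖TT (g i) (v i)‖ - ‖TT γ u‖‖ ≤ ‖TT (g i) (v i) - TT γ u‖ := by
        rw [Real.norm_eq_abs]; exact abs_norm_sub_norm_le _ _
    _ ≤ _ := by
        rw [← sub_add_sub_cancel _ (TT γ (v i))]
        exact (norm_add_le _ _).trans (add_le_add e1 e2)

theorem HPath.spd (hs : s ∈ Ioo (3 / 2 : ℝ) 2) {g v : ℝ → HS s n} (h : HPath g v) :
    ContinuousOn (fun t => ‖TT (g t) (v t)‖) (Icc 0 1) := fun t ht =>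
  TT_cont hs (h.2.2 t ht) (h.cont t ht) (h.2.1 t ht)

theorem len_of (hs : s ∈ Ioo (3 / 2 : ℝ) 2) {P : C1Path s n} {g v : ℝ → HS s n} (h : HPath g v)
    (e : ∀ t ∈ Icc (0:ℝ) 1, (g t).f = P.Γ t ∧ (v t).f = P.V t) :
    pathLen P = ∫ t in (0:ℝ)..1, ‖TT (g t) (v t)‖ := by
  refine intervalIntegral.integral_congr fun t ht => ?_
  rw [uIcc_of_le zero_le_one] at ht
  simp only [← (e t ht).1, ← (e t ht).2, Gmet_eq hs (h.2.2 t ht), Real.sqrt_sq (norm_nonneg _)]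

theorem HPath.dist_le (hs : s ∈ Ioo (3 / 2 : ℝ) 2) {g v : ℝ → HS s n} (h : HPath g v) {F F' : ℝ → ℝ}
    (hF : ∀ t, HasDerivAt F (F' t) t) (hF' : Continuous F')
    (hb : ∀ t ∈ Icc (0:ℝ) 1, ‖TT (g t) (v t)‖ ≤ F' t) :
    geodDist s (g 0).f (g 1).f ≤ ENNReal.ofReal (F 1 - F 0) := by
  refine (iInf₂_le h.toC ⟨rfl, rfl⟩).trans (ENNReal.ofReal_le_ofReal ?_)
  rw [len_of hs h fun t _ => ⟨rfl, rfl⟩,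
    ← intervalIntegral.integral_eq_sub_of_hasDerivAt (fun t _ => hF t) (hF'.intervalIntegrable _ _)]
  refine intervalIntegral.integral_mono_on zero_le_one ?_ (hF'.intervalIntegrable _ _) hb
  exact ContinuousOn.intervalIntegrable (by rw [uIcc_of_le zero_le_one]; exact h.spd hs)
end

/-! ### Part 16: surgery and reparametrization -/
section
variable {s : ℝ} {n : ℕ}

theorem TT_nsmul (hs : s ∈ Ioo (3 / 2 : ℝ) 2) {γ : HS s n} (h : InM s γ.f) {a : ℝ} (ha : 0 ≤ a)
    (u : HS s n) : ‖TT γ (a • u)‖ = a * ‖TT γ u‖ := by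
  rw [TT_smul hs h, norm_smul, Real.norm_of_nonneg ha]

theorem HPath.comp {g v : ℝ → HS s n} (h : HPath g v) {σ σ' : ℝ → ℝ}
    (hσ : ∀ t, HasDerivAt σ (σ' t) t) (hm : MapsTo σ (Icc 0 1) (Icc 0 1))
    (t : ℝ) (ht : t ∈ Icc (0:ℝ) 1) :
    HasDerivWithinAt (fun t => g (σ t)) (σ' t • v (σ t)) (Icc 0 1) t :=
  (h.1 (σ t) (hm ht)).scomp t (hσ t).hasDerivWithinAt hm

theorem HPath.compc {g v : ℝ → HS s n} (h : HPath g v) {σ σ' : ℝ → ℝ}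
    (hσ : ∀ t, HasDerivAt σ (σ' t) t) (hσ' : Continuous σ') (hm : MapsTo σ (Icc 0 1) (Icc 0 1)) :
    ContinuousOn (fun t => σ' t • v (σ t)) (Icc 0 1) :=
  hσ'.continuousOn.smul (h.2.1.comp (fun t _ => (hσ t).continuousAt.continuousWithinAt) hm)

theorem HPath.reparam (hs : s ∈ Ioo (3 / 2 : ℝ) 2) {g v : ℝ → HS s n} (h : HPath g v) {δ : ℝ}
    (hδ : 0 < δ) : ∃ g' v' : ℝ → HS s n, HPath g' v' ∧ g' 0 = g 0 ∧ g' 1 = g 1 ∧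
      ∀ t ∈ Icc (0:ℝ) 1, ‖TT (g' t) (v' t)‖ ≤ (∫ t in (0:ℝ)..1, ‖TT (g t) (v t)‖) + δ := by
  set f : ℝ → ℝ := fun t => IccExtend (zero_le_one' ℝ) ((Icc (0:ℝ) 1).domRestrict fun t => ‖TT (g t) (v t)‖) t + δ with hf
  have hfc : Continuous f := (Continuous.Icc_extend' (h.spd hs).domRestrict).add continuous_const
  have hfi : ∀ t ∈ Icc (0:ℝ) 1, f t = ‖TT (g t) (v t)‖ + δ := fun t ht => by
    simp only [hf]; rw [IccExtend_of_mem _ _ ht]; rfl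
  have hfδ : ∀ t, δ ≤ f t := fun t => le_add_of_nonneg_left (norm_nonneg _)
  set L := (∫ t in (0:ℝ)..1, ‖TT (g t) (v t)‖) + δ with hL
  have hL0 : 0 < L := add_pos_of_nonneg_of_pos
    (intervalIntegral.integral_nonneg zero_le_one fun t _ => norm_nonneg _) hδ
  have hLf : ∫ t in (0:ℝ)..1, f t = L := by
    rw [intervalIntegral.integral_congr (g := fun t => ‖TT (g t) (v t)‖ + δ)
      (fun t ht => hfi t (by rwa [uIcc_of_le zero_le_one] at ht)), intervalIntegral.integral_add
      (ContinuousOn.intervalIntegrable (by rw [uIcc_of_le zero_le_one]; exact h.spd hs))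
      intervalIntegrable_const]; simp [hL]
  set ψ : ℝ → ℝ := fun t => (∫ τ in (0:ℝ)..t, f τ) / L with hψ
  have hd : ∀ t, HasDerivAt ψ (f t / L) t := fun t =>
    (intervalIntegral.integral_hasDerivAt_right (hfc.intervalIntegrable _ _)
      (hfc.stronglyMeasurableAtFilter _ _) hfc.continuousAt).div_const L
  have hfp : ∀ t, 0 < f t := fun t => hδ.trans_le (hfδ t)
  have hmono : StrictMono ψ := strictMono_of_deriv_pos fun t => by
    rw [(hd t).deriv]; exact div_pos (hfp t) hL0
  have hψ0 : ψ 0 = 0 := by simp [hψ]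
  have hψ1 : ψ 1 = 1 := by simp only [hψ, hLf]; exact div_self hL0.ne'
  have hψm : Monotone fun t => ψ t - δ / L * t := by
    have hd' : ∀ t, HasDerivAt (fun t => ψ t - δ / L * t) (f t / L - δ / L * 1) t := fun t =>
      (hd t).sub ((hasDerivAt_id t).const_mul (δ / L))
    refine monotone_of_deriv_nonneg (fun t => (hd' t).differentiableAt) fun t => ?_
    rw [(hd' t).deriv, mul_one, sub_nonneg]; exact div_le_div_of_nonneg_right (hfδ t) hL0.le
  have hdp : 0 < δ / L := div_pos hδ hL0
  have hψc : Continuous ψ := continuous_iff_continuousAt.2 fun t => (hd t).continuousAt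
  have hsurj : Function.Surjective ψ := by
    refine hψc.surjective ?_ ?_
    · refine tendsto_atTop_mono' atTop ?_ (tendsto_id.const_mul_atTop hdp)
      filter_upwards [eventually_ge_atTop 0] with t ht
      have := hψm ht; simp [hψ0] at this; exact this
    · refine tendsto_atBot_mono' atBot ?_ (tendsto_id.const_mul_atBot hdp)
      filter_upwards [eventually_le_atBot 0] with t ht
      have := hψm ht; simp [hψ0] at this; exact this
  set e := hmono.orderIsoOfSurjective ψ hsurj with he
  set σ : ℝ → ℝ := fun t => e.symm t with hσ
  have hσψ : ∀ t, ψ (σ t) = t := fun t => e.apply_symm_apply t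
  have hψσ : ∀ t, σ (ψ t) = t := fun t => e.symm_apply_apply t
  have hσc : Continuous σ := e.symm.continuous
  have hσd : ∀ t, HasDerivAt σ ((f (σ t) / L)⁻¹) t := fun t =>
    HasDerivAt.of_local_left_inverse hσc.continuousAt (hd (σ t)) (div_pos (hfp _) hL0).ne'
      (Eventually.of_forall hσψ)
  have hσ0 : σ 0 = 0 := by have := hψσ 0; rwa [hψ0] at this
  have hσ1 : σ 1 = 1 := by have := hψσ 1; rwa [hψ1] at this
  have hm : MapsTo σ (Icc 0 1) (Icc 0 1) := fun t ht => by
    have h1 := e.symm.monotone ht.1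
    have h2 := e.symm.monotone ht.2
    change σ 0 ≤ σ t at h1; change σ t ≤ σ 1 at h2
    exact ⟨hσ0 ▸ h1, hσ1 ▸ h2⟩
  have hσ'c : Continuous fun t => (f (σ t) / L)⁻¹ :=
    ((hfc.comp hσc).div_const L).inv₀ fun t => (div_pos (hfp _) hL0).ne'
  refine ⟨_, _, ⟨h.comp hσd hm, h.compc hσd hσ'c hm, fun t ht => h.2.2 _ (hm ht)⟩,
    by rw [hσ0], by rw [hσ1], fun t ht => ?_⟩
  rw [TT_nsmul hs (h.2.2 _ (hm ht)) (inv_nonneg.2 (div_pos (hfp _) hL0).le), inv_div,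
    div_mul_eq_mul_div, div_le_iff₀ (hfp _), hfi _ (hm ht)]
  exact mul_le_mul_of_nonneg_left (by linarith) hL0.le

theorem HPath.surgery (hs : s ∈ Ioo (3 / 2 : ℝ) 2) {g v : ℝ → HS s n} (h : HPath g v) {a b D M : ℝ}
    (ha : 0 ≤ a) (hab : a ≤ b) (hb : b ≤ 1) (hD : ∀ t ∈ Icc (0:ℝ) 1, ‖TT (g t) (v t)‖ ≤ D)
    (hl : ∀ θ ∈ Icc (0:ℝ) 1, InM s (g a + θ • (g b - g a)).f ∧
      ‖TT (g a + θ • (g b - g a)) (g b - g a)‖ ≤ M) :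
    geodDist s (g 0).f (g 1).f ≤ ENNReal.ofReal (D * a + M + D * (1 - b)) := by
  set θ := Real.smoothTransition with hθ
  have hθd : ∀ t, HasDerivAt θ (deriv θ t) t := fun t =>
    ((Real.smoothTransition.contDiff (n := 1)).differentiable (by norm_num) t).hasDerivAt
  have hθc : Continuous (deriv θ) := (Real.smoothTransition.contDiff (n := 1)).continuous_deriv le_rfl
  have hθp : ∀ t, 0 ≤ deriv θ t := fun t => Real.smoothTransition.monotone.deriv_nonneg
  have hθ0 : ∀ t ≤ 0, deriv θ t = 0 := fun t ht => by
    refine IsLocalMin.deriv_eq_zero (Eventually.of_forall fun y => ?_)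
    rw [hθ, Real.smoothTransition.zero_of_nonpos ht]; exact Real.smoothTransition.nonneg y
  have hθ1 : ∀ t, 1 ≤ t → deriv θ t = 0 := fun t ht => by
    refine IsLocalMax.deriv_eq_zero (Eventually.of_forall fun y => ?_)
    rw [hθ, Real.smoothTransition.one_of_one_le ht]; exact Real.smoothTransition.le_one y
  have z0 : ∀ t ≤ 0, θ t = 0 := fun t ht => Real.smoothTransition.zero_of_nonpos ht
  have z1 : ∀ t, 1 ≤ t → θ t = 1 := fun t ht => Real.smoothTransition.one_of_one_le ht
  have p0 : ∀ t, 0 ≤ θ t := Real.smoothTransition.nonneg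
  have p1 : ∀ t, θ t ≤ 1 := Real.smoothTransition.le_one
  have hj : ∀ j : ℝ, ∀ t, HasDerivAt (fun t => θ (3 * t - j)) (3 * deriv θ (3 * t - j)) t := fun j t => by
    have h1 : HasDerivAt (fun t : ℝ => 3 * t - j) (3 * 1) t := ((hasDerivAt_id t).const_mul 3).sub_const j
    have := (hθd (3 * t - j)).comp t h1
    rw [mul_one, mul_comm] at this; exact this
  have hjc : ∀ j : ℝ, Continuous fun t => 3 * deriv θ (3 * t - j) := fun j =>
    continuous_const.mul (hθc.comp (by fun_prop))
  have hα : ∀ t, HasDerivAt (fun t => a * θ (3 * t - 0)) (a * (3 * deriv θ (3 * t - 0))) t :=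
    fun t => (hj 0 t).const_mul a
  have hκ : ∀ t, HasDerivAt (fun t => b + (1 - b) * θ (3 * t - 2)) ((1 - b) * (3 * deriv θ (3 * t - 2))) t :=
    fun t => ((hj 2 t).const_mul (1 - b)).const_add b
  have mα : MapsTo (fun t => a * θ (3 * t - 0)) (Icc 0 1) (Icc 0 1) := fun t _ =>
    ⟨mul_nonneg ha (p0 _), by nlinarith [p0 (3 * t - 0), p1 (3 * t - 0)]⟩
  have mκ : MapsTo (fun t => b + (1 - b) * θ (3 * t - 2)) (Icc 0 1) (Icc 0 1) := fun t _ =>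
    ⟨by nlinarith [p0 (3 * t - 2)], by nlinarith [p1 (3 * t - 2)]⟩
  set G : ℝ → HS s n := fun t => g (a * θ (3 * t - 0)) + θ (3 * t - 1) • (g b - g a) +
    (g (b + (1 - b) * θ (3 * t - 2)) - g b) with hG
  set W : ℝ → HS s n := fun t => (a * (3 * deriv θ (3 * t - 0))) • v (a * θ (3 * t - 0)) +
    (3 * deriv θ (3 * t - 1)) • (g b - g a) +
    ((1 - b) * (3 * deriv θ (3 * t - 2))) • v (b + (1 - b) * θ (3 * t - 2)) with hW
  have key : ∀ t ∈ Icc (0:ℝ) 1, InM s (G t).f ∧ ‖TT (G t) (W t)‖ ≤ D * (a * (3 * deriv θ (3 * t - 0))) +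
      M * (3 * deriv θ (3 * t - 1)) + D * ((1 - b) * (3 * deriv θ (3 * t - 2))) := by
    intro t ht
    have q := fun j => hθp (3 * t - j)
    rcases le_total (3 * t) 1 with h1 | h1
    · have e1 : G t = g (a * θ (3 * t - 0)) := by
        simp only [hG]; rw [z0 (3 * t - 1) (by linarith), z0 (3 * t - 2) (by linarith)]; simp
      have e2 : W t = (a * (3 * deriv θ (3 * t - 0))) • v (a * θ (3 * t - 0)) := by
        simp only [hW]; rw [hθ0 (3 * t - 1) (by linarith), hθ0 (3 * t - 2) (by linarith)]; simp
      have hi := h.2.2 _ (mα ht)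
      rw [e1, e2, TT_nsmul hs hi (mul_nonneg ha (by linarith [q 0])), hθ0 (3 * t - 1) (by linarith), hθ0 (3 * t - 2) (by linarith)]
      refine ⟨hi, ?_⟩
      have := mul_le_mul_of_nonneg_right (hD _ (mα ht)) (mul_nonneg ha (by linarith [q 0] : 0 ≤ 3 * deriv θ (3 * t - 0)))
      linarith
    rcases le_total (3 * t) 2 with h2 | h2
    · have e1 : G t = g a + θ (3 * t - 1) • (g b - g a) := by
        simp only [hG]; rw [z1 (3 * t - 0) (by linarith), z0 (3 * t - 2) (by linarith)]; simp
      have e2 : W t = (3 * deriv θ (3 * t - 1)) • (g b - g a) := by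
        simp only [hW]; rw [hθ1 (3 * t - 0) (by linarith), hθ0 (3 * t - 2) (by linarith)]; simp
      obtain ⟨hi, hM⟩ := hl _ ⟨p0 (3 * t - 1), p1 (3 * t - 1)⟩
      rw [e1, e2, TT_nsmul hs hi (by linarith [q 1]), hθ1 (3 * t - 0) (by linarith), hθ0 (3 * t - 2) (by linarith)]
      refine ⟨hi, ?_⟩
      have := mul_le_mul_of_nonneg_right hM (by linarith [q 1] : 0 ≤ 3 * deriv θ (3 * t - 1))
      linarith
    · have e1 : G t = g (b + (1 - b) * θ (3 * t - 2)) := by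
        simp only [hG]; rw [z1 (3 * t - 0) (by linarith), z1 (3 * t - 1) (by linarith)]
        rw [mul_one, one_smul]; abel
      have e2 : W t = ((1 - b) * (3 * deriv θ (3 * t - 2))) • v (b + (1 - b) * θ (3 * t - 2)) := by
        simp only [hW]; rw [hθ1 (3 * t - 0) (by linarith), hθ1 (3 * t - 1) (by linarith)]; simp
      have hi := h.2.2 _ (mκ ht)
      have hb' : 0 ≤ (1 - b) * (3 * deriv θ (3 * t - 2)) := mul_nonneg (by linarith) (by linarith [q 2])
      rw [e1, e2, TT_nsmul hs hi hb', hθ1 (3 * t - 0) (by linarith), hθ1 (3 * t - 1) (by linarith)]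
      refine ⟨hi, ?_⟩
      have := mul_le_mul_of_nonneg_right (hD _ (mκ ht)) hb'
      linarith
  have hP : HPath G W := by
    refine ⟨fun t ht => ?_, ?_, fun t ht => (key t ht).1⟩
    · exact ((h.comp hα mα t ht).add ((hj 1 t).hasDerivWithinAt.smul_const (g b - g a))).add
        ((h.comp hκ mκ t ht).sub_const (g b))
    · exact ((h.compc hα (continuous_const.mul (hjc 0)) mα).add
        ((hjc 1).continuousOn.smul continuousOn_const)).add
        (h.compc hκ (continuous_const.mul (hjc 2)) mκ)
  have := hP.dist_le hs (F := fun t => D * (a * θ (3 * t - 0)) + M * θ (3 * t - 1) +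
      D * (b + (1 - b) * θ (3 * t - 2)))
    (fun t => (((hα t).const_mul D).add ((hj 1 t).const_mul M)).add ((hκ t).const_mul D))
    (((continuous_const.mul (continuous_const.mul (hjc 0))).add (continuous_const.mul (hjc 1))).add
      (continuous_const.mul (continuous_const.mul (hjc 2)))) (fun t ht => (key t ht).2)
  have g0 : G 0 = g 0 := by
    simp only [hG]; rw [z0 (3 * 0 - 0) (by norm_num), z0 (3 * 0 - 1) (by norm_num), z0 (3 * 0 - 2) (by norm_num)]; simp
  have g1 : G 1 = g 1 := by
    simp only [hG]; rw [z1 (3 * 1 - 0) (by norm_num), z1 (3 * 1 - 1) (by norm_num), z1 (3 * 1 - 2) (by norm_num)]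
    simp
  rw [g0, g1] at this
  refine this.trans_eq ?_
  beta_reduce
  rw [z0 (3 * 0 - 0) (by norm_num), z0 (3 * 0 - 1) (by norm_num), z0 (3 * 0 - 2) (by norm_num),
    z1 (3 * 1 - 0) (by norm_num), z1 (3 * 1 - 1) (by norm_num), z1 (3 * 1 - 2) (by norm_num)]
  congr 1; ring
end

/-! ### Part 17: pointwise ODE for the energy density -/
section
variable {s : ℝ} {n : ℕ}

theorem hd_norm {p : ℝ → En n} {p1 : En n} {S : Set ℝ} {t : ℝ} (hp : HasDerivWithinAt p p1 S t)
    (h0 : p t ≠ 0) : HasDerivWithinAt (fun τ => ‖p τ‖) (⟪p t, p1⟫ / ‖p t‖) S t := by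
  have h0' : 0 < ‖p t‖ := norm_pos_iff.2 h0
  have h1 := (hp.norm_sq).sqrt (by positivity)
  simp only [Real.sqrt_sq (norm_nonneg _)] at h1
  refine h1.congr_deriv ?_
  field_simp

theorem lg_le {p p1 : En n} (h0 : p ≠ 0) : |⟪p, p1⟫ / ‖p‖ / ‖p‖| ≤ ‖p‖⁻¹ * ‖p1‖ := by
  have h0' : 0 < ‖p‖ := norm_pos_iff.2 h0
  rw [div_div, abs_div, abs_of_pos (by positivity : 0 < ‖p‖ * ‖p‖), div_le_iff₀ (by positivity)]
  refine (abs_real_inner_le_norm p p1).trans_eq ?_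
  field_simp

theorem ode_alg {N w X x a b r m α β ρ e1 : ℝ} (hw : 0 ≤ w) (hm : 0 ≤ m) (hm5 : m ≤ 5)
    (hα : |α| ≤ a) (hβ : |β| ≤ b) (hρ : |ρ| ≤ r) (hx : |x| ≤ N * X)
    (he : e1 = 2 * x * w + N ^ 2 * (w * (α + β - m * ρ))) :
    e1 ≤ 5 * (N ^ 2 * w) + (2 * (X ^ 2 * w) + m * (N ^ 2 * w * r ^ 2) + N ^ 2 * w * a ^ 2 +
      N ^ 2 * w * b ^ 2) := by
  have hE : 0 ≤ N ^ 2 * w := by positivity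
  have h1 : 2 * x ≤ N ^ 2 + X ^ 2 := by
    have := le_abs_self x; nlinarith [sq_nonneg (N - X)]
  have h2 : 2 * x * w ≤ (N ^ 2 + X ^ 2) * w := mul_le_mul_of_nonneg_right h1 hw
  have hXw : 0 ≤ X ^ 2 * w := by positivity
  have q : ∀ α a : ℝ, |α| ≤ a → α ≤ 1 / 2 + a ^ 2 / 2 := fun α a h => by
    nlinarith [le_abs_self α, sq_nonneg (a - 1)]
  have h3 : α + β - m * ρ ≤ (1 / 2 + a ^ 2 / 2) + (1 / 2 + b ^ 2 / 2) + m * (1 / 2 + r ^ 2 / 2) := by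
    have := mul_le_mul_of_nonneg_left (q (-ρ) r (by rwa [abs_neg])) hm
    linarith [q α a hα, q β b hβ]
  have h4 := mul_le_mul_of_nonneg_left h3 hE
  have h5 := mul_le_mul_of_nonneg_right hm5 hE
  have : ∀ z : ℝ, 0 ≤ N ^ 2 * w * z ^ 2 := fun z => by positivity
  have h6 := this a
  have h7 := this b
  have h8 := mul_nonneg hm (this r)
  rw [he]; linarith

theorem ode (hs : s ∈ Ioo (3 / 2 : ℝ) 2) {p q h : ℝ → En n} {p1 q1 h1 : En n} {S : Set ℝ} {t : ℝ}
    (hp : HasDerivWithinAt p p1 S t) (hq : HasDerivWithinAt q q1 S t)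
    (hh : HasDerivWithinAt h h1 S t) (p0 : p t ≠ 0) (q0 : q t ≠ 0) (h0 : h t ≠ 0) :
    ∃ e1, HasDerivWithinAt (fun τ => ‖h τ - ((‖p τ‖ ^ 2)⁻¹ * ⟪p τ, h τ⟫) • p τ‖ ^ 2 *
      (‖p τ‖ * ‖q τ‖ * ‖h τ‖ ^ (-(2 * s + 1)))) e1 S t ∧
      ∀ N w X : ℝ, N = ‖h t - ((‖p t‖ ^ 2)⁻¹ * ⟪p t, h t⟫) • p t‖ →
        X = ‖h1 - ((‖p t‖ ^ 2)⁻¹ * ⟪p t, h t⟫) • p1‖ →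
        w = ‖p t‖ * ‖q t‖ * ‖h t‖ ^ (-(2 * s + 1)) →
        e1 ≤ 5 * (N ^ 2 * w) + (2 * (X ^ 2 * w) + (2 * s + 1) * (N ^ 2 * w * (‖h t‖⁻¹ * ‖h1‖) ^ 2) +
        N ^ 2 * w * (‖p t‖⁻¹ * ‖p1‖) ^ 2 + N ^ 2 * w * (‖q t‖⁻¹ * ‖q1‖) ^ 2) := by
  have P0 : 0 < ‖p t‖ := norm_pos_iff.2 p0
  have Q0 : 0 < ‖q t‖ := norm_pos_iff.2 q0
  have H0 : 0 < ‖h t‖ := norm_pos_iff.2 h0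
  obtain ⟨k1, hk⟩ : ∃ k1, HasDerivWithinAt (fun τ => (‖p τ‖ ^ 2)⁻¹ * ⟪p τ, h τ⟫) k1 S t :=
    ⟨_, ((hp.norm_sq).fun_inv (by positivity)).mul (hp.inner ℝ hh)⟩
  have hA := (hh.sub (hk.smul hp)).norm_sq
  have hw := ((hd_norm hp p0).mul (hd_norm hq q0)).mul
    ((hd_norm hh h0).rpow_const (p := -(2 * s + 1)) (Or.inl H0.ne'))
  refine ⟨_, hA.mul hw, fun N w X hN hX hw' => ?_⟩
  have orth : ⟪h t - ((‖p t‖ ^ 2)⁻¹ * ⟪p t, h t⟫) • p t, p t⟫ = 0 := by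
    rw [inner_sub_left, inner_smul_left, real_inner_self_eq_norm_sq, real_inner_comm]
    simp only [conj_trivial]; field_simp; ring
  refine ode_alg (α := ⟪p t, p1⟫ / ‖p t‖ / ‖p t‖) (β := ⟪q t, q1⟫ / ‖q t‖ / ‖q t‖)
    (ρ := ⟪h t, h1⟫ / ‖h t‖ / ‖h t‖) (x := ⟪h t - ((‖p t‖ ^ 2)⁻¹ * ⟪p t, h t⟫) • p t,
      h1 - ((‖p t‖ ^ 2)⁻¹ * ⟪p t, h t⟫) • p1⟫) (by rw [hw']; positivity) (by linarith [hs.1]) (by linarith [hs.2])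
    (lg_le p0) (lg_le q0) (lg_le h0) (by rw [hN, hX]; exact abs_real_inner_le_norm _ _) ?_
  have e3 : ‖h t‖ ^ (-(2 * s + 1) - 1) = ‖h t‖ ^ (-(2 * s + 1)) / ‖h t‖ := by
    rw [Real.rpow_sub H0, Real.rpow_one]
  simp only [Pi.sub_apply, Pi.smul_apply', Pi.mul_apply]
  rw [← sub_sub_eq_add_sub, ← sub_sub, inner_sub_right, inner_smul_right, orth, e3, hN, hw']
  field_simp
  ring
end

/-! ### Part 18: energy control along paths -/
section
variable {s : ℝ} {n : ℕ}

def evf (hs : s ∈ Ioo (3 / 2 : ℝ) 2) (x : ℝ) : HS s n →L[ℝ] En n :=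
  LinearMap.mkContinuous ⟨⟨fun u => u.f x, fun _ _ => rfl⟩, fun _ _ => rfl⟩ (Cs s) fun u => u.sup_f hs x
def evd (hs : s ∈ Ioo (3 / 2 : ℝ) 2) (x : ℝ) : HS s n →L[ℝ] En n :=
  LinearMap.mkContinuous ⟨⟨fun u => deriv u.f x, fun u v => HS.dadd u v x⟩, fun c u => HS.dsmul c u x⟩
    (Cs s) fun u => u.sup_d hs x

theorem HPath.df (hs : s ∈ Ioo (3 / 2 : ℝ) 2) {g v : ℝ → HS s n} (h : HPath g v) (x : ℝ) {t : ℝ}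
    (ht : t ∈ Icc (0:ℝ) 1) : HasDerivWithinAt (fun τ => (g τ).f x) ((v t).f x) (Icc 0 1) t :=
  (evf hs x).hasFDerivAt.comp_hasDerivWithinAt t (h.1 t ht)
theorem HPath.dd (hs : s ∈ Ioo (3 / 2 : ℝ) 2) {g v : ℝ → HS s n} (h : HPath g v) (x : ℝ) {t : ℝ}
    (ht : t ∈ Icc (0:ℝ) 1) :
    HasDerivWithinAt (fun τ => deriv (g τ).f x) (deriv (v t).f x) (Icc 0 1) t :=
  (evd hs x).hasFDerivAt.comp_hasDerivWithinAt t (h.1 t ht)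

theorem jcont {ev : ℝ → HS s n →L[ℝ] En n} {C : ℝ} (hb : ∀ x u, ‖ev x u‖ ≤ C * ‖u‖)
    (hc : ∀ u, Continuous fun x => ev x u) {G : ℝ → HS s n} (hG : Continuous G) :
    Continuous fun p : ℝ × ℝ => ev p.2 (G p.1) := by
  refine continuous_iff_continuousAt.2 fun p => tendsto_iff_norm_sub_tendsto_zero.2 ?_
  have h1 : Tendsto (fun q : ℝ × ℝ => C * ‖G q.1 - G p.1‖ + ‖ev q.2 (G p.1) - ev p.2 (G p.1)‖) (𝓝 p)
      (𝓝 (C * ‖G p.1 - G p.1‖ + ‖ev p.2 (G p.1) - ev p.2 (G p.1)‖)) := by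
    refine Continuous.tendsto ?_ p
    have := (hc (G p.1)).comp (continuous_snd (X := ℝ) (Y := ℝ))
    have h2 := hG.comp (continuous_fst (X := ℝ) (Y := ℝ))
    exact (continuous_const.mul (h2.sub continuous_const).norm).add (this.sub continuous_const).norm
  simp only [sub_self, norm_zero, mul_zero, add_zero] at h1
  refine squeeze_zero (fun _ => norm_nonneg _) (fun q => ?_) h1
  have := hb q.2 (G q.1 - G p.1)
  rw [map_sub] at this
  exact (norm_sub_le_norm_sub_add_norm_sub _ (ev q.2 (G p.1)) _).trans (by gcongr)

theorem Tf_joint (hs : s ∈ Ioo (3 / 2 : ℝ) 2) {g v : ℝ → HS s n} (hg : Continuous g) (hv : Continuous v) :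
    Measurable fun q : (ℝ × ℝ) × ℝ => ENNReal.ofReal (‖Tf s (g q.2).f (v q.2).f q.1‖ ^ 2) := by
  have cf : ∀ {G : ℝ → HS s n}, Continuous G → Measurable fun p : ℝ × ℝ => (G p.1).f p.2 := fun hG =>
    (jcont (ev := evf hs) (fun x u => u.sup_f hs x) (fun u => u.mem.cd.continuous) hG).measurable
  have cd : ∀ {G : ℝ → HS s n}, Continuous G → Measurable fun p : ℝ × ℝ => deriv (G p.1).f p.2 := fun hG =>
    (jcont (ev := evd hs) (fun x u => u.sup_d hs x) (fun u => u.mem.cont_deriv) hG).measurable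
  have m1 : Measurable fun q : (ℝ × ℝ) × ℝ => (q.2, q.1.1) := by fun_prop
  have m2 : Measurable fun q : (ℝ × ℝ) × ℝ => (q.2, q.1.2) := by fun_prop
  have a1 : Measurable fun q : (ℝ × ℝ) × ℝ => (g q.2).f q.1.1 := (cf hg).comp m1
  have a2 : Measurable fun q : (ℝ × ℝ) × ℝ => (g q.2).f q.1.2 := (cf hg).comp m2
  have a3 : Measurable fun q : (ℝ × ℝ) × ℝ => (v q.2).f q.1.1 := (cf hv).comp m1
  have a4 : Measurable fun q : (ℝ × ℝ) × ℝ => (v q.2).f q.1.2 := (cf hv).comp m2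
  have b1 : Measurable fun q : (ℝ × ℝ) × ℝ => deriv (g q.2).f q.1.1 := (cd hg).comp m1
  have b2 : Measurable fun q : (ℝ × ℝ) × ℝ => deriv (g q.2).f q.1.2 := (cd hg).comp m2
  have b3 : Measurable fun q : (ℝ × ℝ) × ℝ => deriv (v q.2).f q.1.1 := (cd hv).comp m1
  have b4 : Measurable fun q : (ℝ × ℝ) × ℝ => deriv (v q.2).f q.1.2 := (cd hv).comp m2
  have c1 : Measurable fun q : (ℝ × ℝ) × ℝ => tA s (g q.2).f (v q.2).f q.1.1 q.1.2 := by
    unfold tA muW Rop DDg; fun_prop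
  have c2 : Measurable fun q : (ℝ × ℝ) × ℝ => tA s (g q.2).f (g q.2).f q.1.1 q.1.2 := by
    unfold tA muW Rop DDg; fun_prop
  have c3 : Measurable fun q : (ℝ × ℝ) × ℝ => Tf s (g q.2).f (v q.2).f q.1 := by
    refine (WithLp.measurable_toLp 2 _).comp (measurable_pi_lambda _ fun i => ?_)
    unfold Dg
    fin_cases i <;> simp <;> fun_prop
  exact ENNReal.measurable_ofReal.comp (c3.norm.pow_const 2)

theorem HPath.ptw (hs : s ∈ Ioo (3 / 2 : ℝ) 2) {g v : ℝ → HS s n} (h : HPath g v) {x y : ℝ}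
    (hx : x ∈ I01) (hy : y ∈ I01) (hxy : x ≠ y) {t : ℝ} (ht : t ∈ Icc (0:ℝ) 1) :
    ∃ e1, HasDerivWithinAt (fun τ => ‖tA s (g τ).f (g τ).f x y‖ ^ 2) e1 (Icc 0 1) t ∧
      e1 ≤ 5 * ‖tA s (g t).f (g t).f x y‖ ^ 2 + ‖Tf s (g t).f (v t).f (x, y)‖ ^ 2 := by
  have hne : ∀ τ ∈ Icc (0:ℝ) 1, (g τ).f y ≠ (g τ).f x := fun τ hτ => (h.2.2 τ hτ).ne hx hy hxy
  have hi := (h.2.2 t ht).2.2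
  have hg' : 0 < ‖(g t).f y - (g t).f x‖ := norm_pos_iff.2 (sub_ne_zero.2 (hne t ht))
  obtain ⟨e1, he, hb⟩ := ode hs (h.dd hs x ht) (h.dd hs y ht) ((h.df hs y ht).sub (h.df hs x ht)) (hi x) (hi y)
    (sub_ne_zero.2 (hne t ht))
  have key : ∀ τ ∈ Icc (0:ℝ) 1, ∀ u : ℝ → En n, ‖tA s (g τ).f u x y‖ ^ 2 = ‖Av (g τ).f u x y‖ ^ 2 *
      (‖deriv (g τ).f x‖ * ‖deriv (g τ).f y‖ * ‖(g τ).f y - (g τ).f x‖ ^ (-(2 * s + 1))) := fun τ hτ u => by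
    rw [tA_sq' s u (hne τ hτ), Real.rpow_neg (norm_nonneg _)]; ring
  refine ⟨e1, he.congr (fun τ hτ => key τ hτ _) (key t ht _), (hb _ _ _ rfl rfl rfl).trans ?_⟩
  obtain ⟨k0, k1, k2, k3, -, -⟩ := Tf_comp hs (g t).f (v t).f (x, y)
  rw [Tf_sum, k0, k1, k2, k3]
  simp only [← tA_sq]
  have e2 : ∀ a b : ℝ, a * b * muW (g t).f x y = (a * muW (g t).f x y) * b := fun a b => by ring
  simp only [e2, ← tA_sq, key t ht]
  have e3 : ∀ z, ‖Dg (g t).f (v t).f z‖ = ‖deriv (g t).f z‖⁻¹ * ‖deriv (v t).f z‖ := fun z => by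
    rw [Dg, norm_smul, norm_inv, norm_norm]
  rw [e3, e3]
  simp only [Pi.sub_apply, Av, DDg, mul_pow, inv_pow, div_eq_inv_mul]
  linarith [sq_nonneg ‖Tf s (g t).f (v t).f (x, y) 4‖, sq_nonneg ‖Tf s (g t).f (v t).f (x, y) 5‖]

theorem HPath.EN_le (hs : s ∈ Ioo (3 / 2 : ℝ) 2) {g v : ℝ → HS s n} (h : HPath g v) {D : ℝ}
    (hD : ∀ t ∈ Icc (0:ℝ) 1, ‖TT (g t) (v t)‖ ≤ D) {t : ℝ} (ht : t ∈ Icc (0:ℝ) 1) :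
    EN s (g t).f ≤ ENNReal.ofReal (exp 5) * (EN s (g 0).f + ENNReal.ofReal (D ^ 2)) := by
  set gE : ℝ → HS s n := fun t => g (projIcc 0 1 zero_le_one t) with hgE
  set vE : ℝ → HS s n := fun t => v (projIcc 0 1 zero_le_one t) with hvE
  have cg : Continuous gE := Continuous.Icc_extend' h.cont.domRestrict
  have cv : Continuous vE := Continuous.Icc_extend' h.2.1.domRestrict
  have eE : ∀ τ ∈ Icc (0:ℝ) 1, gE τ = g τ ∧ vE τ = v τ := fun τ hτ => by
    simp only [hgE, hvE, projIcc_of_mem _ hτ, and_self]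
  have hj := Tf_joint (s := s) hs cg cv
  have step : ∀ᵐ z ∂mu2, ENNReal.ofReal (‖tA s (g t).f (g t).f z.1 z.2‖ ^ 2) ≤
      ENNReal.ofReal (exp 5) * (ENNReal.ofReal (‖tA s (g 0).f (g 0).f z.1 z.2‖ ^ 2) +
        ∫⁻ τ in Icc (0:ℝ) 1, ENNReal.ofReal (‖Tf s (gE τ).f (vE τ).f z‖ ^ 2)) := by
    filter_upwards [mu2_ae] with z hz
    obtain ⟨hx, hy, hxy⟩ := hz
    choose! e1 he1 hb using fun τ (hτ : τ ∈ Icc (0:ℝ) 1) => h.ptw hs hx hy hxy hτ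
    have hsub : Icc 0 t ⊆ Icc (0:ℝ) 1 := Icc_subset_Icc_right ht.2
    have cT : ContinuousOn (fun τ => ‖Tf s (gE τ).f (vE τ).f z‖ ^ 2) (Icc 0 1) := fun τ hτ => by
      have a : ∀ {G : ℝ → HS s n}, Continuous G → ∀ x, Tendsto (fun k => (G k).f x) (𝓝[Icc 0 1] τ) (𝓝 ((G τ).f x)) :=
        fun hG x => (((evf hs x).continuous.comp hG).tendsto τ).mono_left nhdsWithin_le_nhds
      have b : ∀ {G : ℝ → HS s n}, Continuous G → ∀ x, Tendsto (fun k => deriv (G k).f x) (𝓝[Icc 0 1] τ) (𝓝 (deriv (G τ).f x)) :=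
        fun hG x => (((evd hs x).continuous.comp hG).tendsto τ).mono_left nhdsWithin_le_nhds
      have hi := h.2.2 τ hτ
      rw [← (eE τ hτ).1] at hi
      exact (Tf_lim (s := s) (a cg) (b cg) (a cv) (b cv) hi.2.2 (hi.ne hx hy hxy)).norm.pow 2
    have hE : ∀ τ ∈ Icc (0:ℝ) 1, HasDerivWithinAt (fun τ => ‖tA s (g τ).f (g τ).f z.1 z.2‖ ^ 2 * exp (-5 * τ))
        (e1 τ * exp (-5 * τ) + ‖tA s (g τ).f (g τ).f z.1 z.2‖ ^ 2 * (exp (-5 * τ) * (-5 * 1))) (Icc 0 1) τ :=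
      fun τ hτ => (he1 τ hτ).mul (((hasDerivAt_id τ).const_mul (-5)).exp.hasDerivWithinAt)
    have hI := intervalIntegral.sub_le_integral_of_hasDeriv_right_of_le ht.1
      (fun τ hτ => ((hE τ (hsub hτ)).continuousWithinAt).mono hsub)
      (fun τ hτ => ((hE τ (hsub (Ioo_subset_Icc_self hτ))).hasDerivAt
        (Icc_mem_nhds hτ.1 (hτ.2.trans_le ht.2))).hasDerivWithinAt)
      ((cT.mono hsub).integrableOn_Icc) (fun τ hτ => by
        have hτ' := hsub (Ioo_subset_Icc_self hτ)
        have h2 := hb τ hτ'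
        have h3 : exp (-5 * τ) ≤ 1 := Real.exp_le_one_iff.2 (by linarith [hτ'.1])
        have h4 := mul_le_mul_of_nonneg_right h2 (exp_pos (-5 * τ)).le
        have h5 := mul_le_mul_of_nonneg_left h3 (sq_nonneg ‖Tf s (g τ).f (v τ).f z‖)
        rw [(eE τ hτ').1, (eE τ hτ').2]
        linarith)
    have e0 : exp (5 * t) ≤ exp 5 := exp_le_exp.2 (by linarith [ht.2])
    have hpos : 0 ≤ ∫ τ in (0:ℝ)..t, ‖Tf s (gE τ).f (vE τ).f z‖ ^ 2 :=
      intervalIntegral.integral_nonneg ht.1 fun _ _ => sq_nonneg _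
    have hfin : ‖tA s (g t).f (g t).f z.1 z.2‖ ^ 2 ≤ exp 5 * (‖tA s (g 0).f (g 0).f z.1 z.2‖ ^ 2 +
        ∫ τ in (0:ℝ)..t, ‖Tf s (gE τ).f (vE τ).f z‖ ^ 2) := by
      refine le_trans ?_ (mul_le_mul_of_nonneg_right e0 (by positivity))
      have e1 : exp (-5 * t) * exp (5 * t) = 1 := by rw [← exp_add]; simp
      have := mul_le_mul_of_nonneg_right hI (exp_pos (5 * t)).le
      rw [sub_mul, mul_assoc, e1] at this
      simp only [mul_zero, exp_zero, mul_one] at this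
      linarith
    refine (ENNReal.ofReal_le_ofReal hfin).trans ?_
    rw [ENNReal.ofReal_mul (exp_pos 5).le, ENNReal.ofReal_add (sq_nonneg _) hpos,
      intervalIntegral.integral_of_le ht.1, ofReal_integral_eq_lintegral_ofReal
        ((cT.mono hsub).integrableOn_Icc.mono_set Ioc_subset_Icc_self)
        (Eventually.of_forall fun _ => sq_nonneg _)]
    gcongr
    exact Ioc_subset_Icc_self.trans hsub
  refine (lintegral_mono_ae step).trans ?_
  have mA : Measurable fun z : ℝ × ℝ => ENNReal.ofReal (‖tA s (g 0).f (g 0).f z.1 z.2‖ ^ 2) :=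
    ENNReal.measurable_ofReal.comp ((tA_meas s (g 0).mem.cd (g 0).mem.cd).norm.pow_const 2)
  rw [lintegral_const_mul' _ _ ENNReal.ofReal_ne_top, lintegral_add_left mA, lintegral_lintegral_swap hj.aemeasurable]
  gcongr
  · exact le_rfl
  refine (setLIntegral_mono' (g := fun _ => ENNReal.ofReal (D ^ 2)) measurableSet_Icc fun τ hτ => ?_).trans (by simp)
  rw [(eE τ hτ).1, (eE τ hτ).2, ← TT_lint hs (h.2.2 τ hτ)]
  exact ENNReal.ofReal_le_ofReal (pow_le_pow_left₀ (norm_nonneg _) (hD τ hτ) 2)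
end

/-! ### Part 19: uniform path_control -/
section
variable {s : ℝ} {n : ℕ}

theorem EN_TT (hs : s ∈ Ioo (3 / 2 : ℝ) 2) {γ : HS s n} (h : InM s γ.f) :
    EN s γ.f ≤ ENNReal.ofReal (‖TT γ γ‖ ^ 2) := by
  rw [TT_lint hs h]
  refine lintegral_mono fun z => ENNReal.ofReal_le_ofReal ?_
  rw [Tf_sum, (Tf_comp hs γ.f γ.f z).1, ← tA_sq]
  have := fun i => sq_nonneg ‖Tf s γ.f γ.f z i‖
  nlinarith [this 1, this 2, this 3, this 4, this 5, sq_nonneg ‖tA s γ.f γ.f z.1 z.2‖]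

theorem coerKK (hs : s ∈ Ioo (3 / 2 : ℝ) 2) (n : ℕ) {c : ℝ} (hc : 0 < c) (A : ℝ) : ∃ C, 0 < C ∧
    ∀ γ ∈ KK s n A c, ∀ u, ‖u‖ ≤ C * ‖TT γ u‖ := by
  obtain ⟨C1, hC1, hT⟩ := TT_est hs n hc A
  have hCs := Cs_ge hs
  obtain ⟨C2, hC2, h2⟩ := coer hs n (sq_nonneg (C1 * |A|)) hc (by positivity : 0 < Cs s * |A| + 1)
  refine ⟨C2 * (1 + |A|), by positivity, fun γ hγ u => ?_⟩
  have hA : ‖γ‖ ≤ |A| := hγ.1.trans (le_abs_self A)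
  have hM := KK.inM hc hγ
  refine (h2 γ hM ((EN_TT hs hM).trans (ENNReal.ofReal_le_ofReal ?_)) (KK.imm hγ) (fun x => ?_) u).trans ?_
  · exact pow_le_pow_left₀ (norm_nonneg _) (((hT γ γ hγ hγ γ).1).trans (by gcongr)) 2
  · have := γ.sup_d hs x
    have := mul_le_mul_of_nonneg_left hA (by positivity : 0 ≤ Cs s)
    linarith
  · gcongr

theorem gron0 {E : Type*} [NormedAddCommGroup E] [NormedSpace ℝ E] {f f' : ℝ → E} {K ε : ℝ}
    (hK : 0 < K) (hε : 0 ≤ ε) (hd : ∀ t ∈ Icc (0:ℝ) 1, HasDerivWithinAt f (f' t) (Icc 0 1) t)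
    (hb : ∀ t ∈ Icc (0:ℝ) 1, ‖f' t‖ ≤ K * (‖f t‖ + ε)) {a b : ℝ} (ha : 0 ≤ a) (hab : a ≤ b)
    (hb1 : b ≤ 1) : ‖f b‖ + ε ≤ exp K * (‖f a‖ + ε) := by
  have hsub : Icc a b ⊆ Icc 0 1 := Icc_subset_Icc ha hb1
  have := norm_le_gronwallBound_of_norm_deriv_right_le (f := f) (f' := f') (δ := ‖f a‖) (K := K) (ε := K * ε)
    (fun t ht => ((hd t (hsub ht)).continuousWithinAt).mono hsub)
    (fun t ht => (hd t (hsub (Ico_subset_Icc_self ht))).mono_of_mem_nhdsWithin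
      (mem_of_superset (Icc_mem_nhdsGE (ht.2.trans_le hb1)) (Icc_subset_Icc_left (ha.trans ht.1)))) le_rfl
    (fun t ht => (hb t (hsub (Ico_subset_Icc_self ht))).trans_eq (mul_add _ _ _)) b ⟨hab, le_rfl⟩
  rw [gronwallBound_of_K_ne_0 hK.ne', mul_div_cancel_left₀ _ hK.ne'] at this
  have e : exp (K * (b - a)) ≤ exp K := exp_le_exp.2 (by nlinarith)
  have := mul_le_mul_of_nonneg_right e (by positivity : 0 ≤ ‖f a‖ + ε)
  linarith

theorem gron {E : Type*} [NormedAddCommGroup E] [NormedSpace ℝ E] {f f' : ℝ → E} {K ε : ℝ}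
    (hK : 0 < K) (hε : 0 ≤ ε) (hd : ∀ t ∈ Icc (0:ℝ) 1, HasDerivWithinAt f (f' t) (Icc 0 1) t)
    (hb : ∀ t ∈ Icc (0:ℝ) 1, ‖f' t‖ ≤ K * (‖f t‖ + ε)) {t : ℝ} (ht : t ∈ Icc (0:ℝ) 1) :
    ‖f t‖ + ε ≤ exp K * (‖f 0‖ + ε) ∧ ‖f 0‖ + ε ≤ exp K * (‖f t‖ + ε) := by
  refine ⟨gron0 hK hε hd hb le_rfl ht.1 ht.2, ?_⟩
  have hm : MapsTo (fun t : ℝ => 1 - t) (Icc 0 1) (Icc 0 1) := fun t ht =>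
    ⟨by linarith [ht.2], by linarith [ht.1]⟩
  have := gron0 (f := fun t => f (1 - t)) (f' := fun t => (-1:ℝ) • f' (1 - t)) hK hε (fun t ht =>
    (hd (1 - t) (hm ht)).scomp t ((hasDerivAt_id t).const_sub 1).hasDerivWithinAt hm)
    (fun t ht => by rw [neg_one_smul, norm_neg]; exact hb _ (hm ht)) (a := 1 - t) (b := 1)
    (by linarith [ht.2]) (by linarith [ht.1]) le_rfl
  simpa using this

theorem path_control (hs : s ∈ Ioo (3 / 2 : ℝ) 2) {γ₀ : HS s n} (h0 : InM s γ₀.f) {D : ℝ} (hD0 : 0 ≤ D) :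
    ∃ A c, 0 < c ∧ ∀ g v : ℝ → HS s n, HPath g v → g 0 = γ₀ →
      (∀ t ∈ Icc (0:ℝ) 1, ‖TT (g t) (v t)‖ ≤ D) → ∀ t ∈ Icc (0:ℝ) 1, g t ∈ KK s n A c := by
  obtain ⟨c, hc, hk⟩ := KK.exists hs γ₀ h0
  have hCs := Cs_ge hs
  set E := exp 5 * (‖TT γ₀ γ₀‖ ^ 2 + D ^ 2) with hE
  have hE0 : 0 ≤ E := by positivity
  obtain ⟨C1, hC1, h1⟩ := sup_Dg hs n hE0
  set K1 := C1 * D + 1 with hK1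
  have hK1p : 0 < K1 := by positivity
  have hc0 : 0 < c / exp K1 := by positivity
  obtain ⟨C2, hC2, h2⟩ := coer hs n hE0 hc0 (by positivity : 0 < exp K1 * (Cs s * ‖γ₀‖) + 1)
  obtain ⟨c', hc', h3⟩ := chord_arc hs n hE0 hc0
  refine ⟨exp (C2 * D + 1) * (‖γ₀‖ + 1), c', hc', fun g v h hg hv => ?_⟩
  have hEN : ∀ t ∈ Icc (0:ℝ) 1, EN s (g t).f ≤ ENNReal.ofReal E := fun t ht => by
    refine (h.EN_le hs hv ht).trans ?_
    rw [hE, ENNReal.ofReal_mul (exp_pos _).le, ENNReal.ofReal_add (sq_nonneg _) (sq_nonneg _), hg]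
    gcongr; exact EN_TT hs h0
  have hgr : ∀ t ∈ Icc (0:ℝ) 1, ∀ x, ‖deriv (g t).f x‖ + 0 ≤ exp K1 * (‖deriv (g 0).f x‖ + 0) ∧
      ‖deriv (g 0).f x‖ + 0 ≤ exp K1 * (‖deriv (g t).f x‖ + 0) := fun t ht x => by
    refine gron (f := fun t => deriv (g t).f x) hK1p le_rfl (fun t ht => h.dd hs x ht) (fun t ht => ?_) ht
    have hp := norm_pos_iff.2 ((h.2.2 t ht).2.2 x)
    have := h1 (g t) (h.2.2 t ht) (hEN t ht) (v t) x
    rw [Dg, norm_smul, norm_inv, norm_norm, inv_mul_le_iff₀ hp] at this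
    refine this.trans ?_
    rw [add_zero, mul_comm]
    gcongr
    exact (mul_le_mul_of_nonneg_left (hv t ht) hC1.le).trans (by linarith)
  have lo : ∀ t ∈ Icc (0:ℝ) 1, ∀ x, c / exp K1 ≤ ‖deriv (g t).f x‖ := fun t ht x => by
    rw [div_le_iff₀ (exp_pos _), mul_comm]
    have h4 := (hgr t ht x).2
    rw [hg] at h4
    have := KK.imm hk x
    linarith
  have hi : ∀ t ∈ Icc (0:ℝ) 1, ∀ x, ‖deriv (g t).f x‖ ≤ exp K1 * (Cs s * ‖γ₀‖) + 1 := fun t ht x => by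
    have h4 := (hgr t ht x).1
    rw [hg] at h4
    have := mul_le_mul_of_nonneg_left (γ₀.sup_d hs x) (exp_pos K1).le
    linarith
  refine fun t ht => ⟨?_, h3 (g t) (h.2.2 t ht) (hEN t ht) (lo t ht)⟩
  have := (gron (f := g) (f' := v) (K := C2 * D + 1) (ε := 1) (by positivity) zero_le_one h.1 (fun t ht => ?_) ht).1
  · rw [hg] at this; linarith
  · refine (h2 (g t) (h.2.2 t ht) (hEN t ht) (lo t ht) (hi t ht) (v t)).trans ?_
    have h5 : 0 ≤ C2 * (1 + ‖g t‖) := by positivity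
    have := mul_le_mul_of_nonneg_left (hv t ht) h5
    nlinarith [norm_nonneg (g t)]
end

/-! ### Part 20: abstract C¹ criterion -/
section
variable {E : Type*} [NormedAddCommGroup E] [NormedSpace ℝ E]

theorem slope_mid (g : ℝ → E) {a b θ : ℝ} (hab : a ≠ b) (h0 : θ ≠ 0) (h1 : 1 - θ ≠ 0) :
    slope g a b - slope g a (a + θ * (b - a)) =
      (1 - θ) • (slope g (a + θ * (b - a)) b - slope g a (a + θ * (b - a))) := by
  have hb : b - a ≠ 0 := sub_ne_zero.2 hab.symm
  have e : b - (a + θ * (b - a)) = (1 - θ) * (b - a) := by ring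
  simp only [slope_def_module, add_sub_cancel_left, e, mul_inv]
  match_scalars <;> field_simp <;> ring

/-- Symmetric second-difference hypothesis. -/
def SD (g : ℝ → E) (K : ℝ) : Prop := ∀ a ∈ Icc (0:ℝ) 1, ∀ b ∈ Icc (0:ℝ) 1, a ≠ b →
  ∀ θ ∈ Ioo (0:ℝ) 1, θ * (1 - θ) *
    ‖slope g (a + θ * (b - a)) b - slope g a (a + θ * (b - a))‖ ^ 2 ≤ K ^ 2 * |b - a|

theorem SD.near {g : ℝ → E} {K : ℝ} (hK : 0 ≤ K) (h : SD g K) {a b θ : ℝ} (ha : a ∈ Icc (0:ℝ) 1)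
    (hb : b ∈ Icc (0:ℝ) 1) (hab : a ≠ b) (hθ : θ ∈ Ico (1/2 : ℝ) 1) :
    ‖slope g a b - slope g a (a + θ * (b - a))‖ ≤ K * √|b - a| := by
  have hθ' : θ ∈ Ioo (0:ℝ) 1 := ⟨by linarith [hθ.1], hθ.2⟩
  rw [slope_mid g hab hθ'.1.ne' (by linarith [hθ.2]), norm_smul, Real.norm_eq_abs,
    abs_of_nonneg (by linarith [hθ.2])]
  have := h a ha b hb hab θ hθ'
  refine abs_le_of_sq_le_sq' ?_ (by positivity) |>.2
  rw [mul_pow, mul_pow, Real.sq_sqrt (abs_nonneg _)]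
  refine le_trans ?_ this
  gcongr
  nlinarith [hθ.1, hθ.2]

theorem SD.far {g : ℝ → E} {K : ℝ} (hK : 0 ≤ K) (h : SD g K) {a : ℝ} (ha : a ∈ Icc (0:ℝ) 1) (j : ℕ) :
    ∀ b ∈ Icc (0:ℝ) 1, a ≠ b → ∀ θ ∈ Ioc (0:ℝ) 1, (1/2 : ℝ) ^ (j+1) ≤ θ →
    ‖slope g a b - slope g a (a + θ * (b - a))‖ ≤ 4 * K * √|b - a| := by
  induction j with
  | zero =>
    intro b hb hab θ hθ hj
    rcases hθ.2.eq_or_lt with rfl | h1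
    · simp; positivity
    · refine (h.near hK ha hb hab ⟨by simpa using hj, h1⟩).trans ?_
      have := mul_nonneg hK (Real.sqrt_nonneg |b-a|); nlinarith
  | succ j ih =>
    intro b hb hab θ hθ hj
    have hz := mul_nonneg hK (Real.sqrt_nonneg |b-a|)
    rcases le_total (1/2) θ with h2 | h2
    · rcases hθ.2.eq_or_lt with rfl | h1
      · simp; positivity
      · refine (h.near hK ha hb hab ⟨by simpa using h2, h1⟩).trans ?_
        nlinarith
    · have n1 := h.near hK ha hb hab (θ := 1/2) ⟨le_rfl, by norm_num⟩
      have hb' : a + 1/2 * (b - a) ∈ Icc (0:ℝ) 1 := by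
        constructor <;> linarith [ha.1, ha.2, hb.1, hb.2]
      have n2 := ih _ hb' (by intro h; apply hab; linarith) (2 * θ) ⟨by linarith [hθ.1], by linarith⟩
        (by rw [pow_succ] at hj; linarith)
      rw [show a + 2 * θ * (a + 1/2 * (b - a) - a) = a + θ * (b - a) by ring,
        show |a + 1/2 * (b - a) - a| = 1/2 * |b - a| by
          rw [add_sub_cancel_left, abs_mul]; norm_num, Real.sqrt_mul (by norm_num)] at n2
      have n3 : √(1/2 : ℝ) ≤ 3/4 := Real.sqrt_le_iff.2 ⟨by norm_num, by norm_num⟩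
      have := norm_sub_le_norm_sub_add_norm_sub (slope g a b) (slope g a (a + 1/2 * (b - a)))
        (slope g a (a + θ * (b - a)))
      nlinarith

theorem SD.any {g : ℝ → E} {K : ℝ} (hK : 0 ≤ K) (h : SD g K) {a : ℝ} (ha : a ∈ Icc (0:ℝ) 1) {b : ℝ}
    (hb : b ∈ Icc (0:ℝ) 1) (hab : a ≠ b) {θ : ℝ} (hθ : θ ∈ Ioc (0:ℝ) 1) :
    ‖slope g a b - slope g a (a + θ * (b - a))‖ ≤ 4 * K * √|b - a| := by
  obtain ⟨j, hj⟩ := exists_pow_lt_of_lt_one hθ.1 (show (1/2 : ℝ) < 1 by norm_num)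
  refine h.far hK ha j b hb hab θ hθ (le_trans ?_ hj.le)
  exact pow_le_pow_of_le_one (by norm_num) (by norm_num) (Nat.le_succ j)

theorem SD.any' {g : ℝ → E} {K : ℝ} (hK : 0 ≤ K) (h : SD g K) {a : ℝ} (ha : a ∈ Icc (0:ℝ) 1) {b c : ℝ}
    (hb : b ∈ Icc (0:ℝ) 1) (hb0 : b ≠ a) (hc : c ∈ Icc (0:ℝ) 1) (hc0 : c ≠ a)
    (hle : |c - a| ≤ |b - a|) :
    ‖slope g a b - slope g a c‖ ≤ 16 * K * √|b - a| := by
  have hz := mul_nonneg hK (Real.sqrt_nonneg |b-a|)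
  have h1 : 0 < |b - a| := abs_pos.2 (sub_ne_zero.2 hb0)
  have h2 : 0 < |c - a| := abs_pos.2 (sub_ne_zero.2 hc0)
  set θ := |c - a| / |b - a| with hθ
  have hθm : θ ∈ Ioc (0:ℝ) 1 := ⟨by positivity, (div_le_one h1).2 hle⟩
  have n1 := h.any hK ha hb hb0.symm hθm
  have e : θ * |b - a| = |c - a| := by rw [hθ]; field_simp
  have e2 : a + θ * (b - a) = c ∨ a + θ * (b - a) = 2 * a - c := by
    rcases abs_choice (b - a) with h | h <;> rcases abs_choice (c - a) with h' | h' <;>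
    rw [h, h'] at e
    · left; linarith
    · right; linarith
    · right; linarith
    · left; linarith
  rcases e2 with e2 | e2
  · rw [e2] at n1; nlinarith
  · set d := a + θ * (b - a) with hd
    have hdm : d ∈ Icc (0:ℝ) 1 := by
      have : d = (1 - θ) * a + θ * b := by rw [hd]; ring
      rw [this]
      exact ⟨by nlinarith [hθm.1, hθm.2, ha.1, hb.1], by nlinarith [hθm.1, hθm.2, ha.2, hb.2]⟩
    have hdc : d ≠ c := fun h => hc0 (by rw [e2] at h; linarith)
    have n2 := h d hdm c hc hdc (1/2) ⟨by norm_num, by norm_num⟩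
    rw [show d + 1/2 * (c - d) = a by rw [e2]; ring,
      show |c - d| = 2 * |c - a| by rw [e2, show c - (2 * a - c) = 2 * (c - a) by ring, abs_mul]; norm_num] at n2
    have n3 : ‖slope g a c - slope g a d‖ ≤ 4 * K * √|b - a| := by
      refine abs_le_of_sq_le_sq' ?_ (by positivity) |>.2
      rw [mul_pow, mul_pow, Real.sq_sqrt (abs_nonneg _), slope_comm g a d]
      have := mul_le_mul_of_nonneg_left hle (sq_nonneg K)
      have := mul_nonneg (sq_nonneg K) h1.le
      nlinarith
    have := norm_sub_le_norm_sub_add_norm_sub (slope g a b) (slope g a d) (slope g a c)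
    rw [norm_sub_rev (slope g a d)] at this
    nlinarith

theorem SD.deriv [CompleteSpace E] {g : ℝ → E} {K : ℝ} (hK : 0 ≤ K) (h : SD g K) :
    ∃ v : ℝ → E, (∀ t ∈ Icc (0:ℝ) 1, HasDerivWithinAt g (v t) (Icc 0 1) t) ∧
      ContinuousOn v (Icc 0 1) := by
  have key : ∀ t ∈ Icc (0:ℝ) 1, ∃ v : E, HasDerivWithinAt g v (Icc 0 1) t ∧
      ∀ x ∈ Icc (0:ℝ) 1, x ≠ t → ‖slope g t x - v‖ ≤ 16 * K * √|x - t| := by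
    intro t ht
    have nb : (𝓝[Icc (0:ℝ) 1 \ {t}] t).NeBot :=
      accPt_principal_iff_nhdsWithin.1 ((uniqueDiffOn_Icc (zero_lt_one' ℝ)) t ht).accPt
    have tz : Tendsto (fun x => 16 * K * √|x - t|) (𝓝[Icc (0:ℝ) 1 \ {t}] t) (𝓝 0) := by
      have : Continuous fun x => 16 * K * √|x - t| := by fun_prop
      have := this.tendsto t
      simp only [sub_self, abs_zero, Real.sqrt_zero, mul_zero] at this
      exact this.mono_left nhdsWithin_le_nhds
    have hc : Cauchy (Filter.map (slope g t) (𝓝[Icc (0:ℝ) 1 \ {t}] t)) := by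
      rw [Metric.cauchy_iff]
      refine ⟨inferInstance, fun ε hε => ?_⟩
      have ev := (tz.eventually (gt_mem_nhds hε)).and self_mem_nhdsWithin
      refine ⟨_, image_mem_map ev, ?_⟩
      rintro _ ⟨x, ⟨hx, hxm⟩, rfl⟩ _ ⟨y, ⟨hy, hym⟩, rfl⟩
      rcases le_total |y - t| |x - t| with hl | hl
      · rw [dist_eq_norm]
        exact (h.any' hK ht hxm.1 hxm.2 hym.1 hym.2 hl).trans_lt hx
      · rw [dist_comm, dist_eq_norm]
        exact (h.any' hK ht hym.1 hym.2 hxm.1 hxm.2 hl).trans_lt hy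
    obtain ⟨v, hv⟩ := cauchy_map_iff_exists_tendsto.1 hc
    refine ⟨v, hasDerivWithinAt_iff_tendsto_slope.2 hv, fun x hx hxt => ?_⟩
    refine le_of_tendsto (tendsto_const_nhds.sub hv).norm ?_
    have hp : ∀ᶠ y in 𝓝 t, |y - t| < |x - t| := by
      have : Continuous fun y : ℝ => |y - t| := by fun_prop
      have h2 := this.tendsto t
      simp only [sub_self, abs_zero] at h2
      exact h2.eventually (gt_mem_nhds (abs_pos.2 (sub_ne_zero.2 hxt)))
    filter_upwards [nhdsWithin_le_nhds hp, self_mem_nhdsWithin] with y hy hym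
    exact h.any' hK ht hx hxt hym.1 hym.2 hy.le
  choose! v hv using key
  refine ⟨v, fun t ht => (hv t ht).1, fun t ht => ?_⟩
  rw [ContinuousWithinAt, tendsto_iff_norm_sub_tendsto_zero]
  have tz : Tendsto (fun x => 32 * K * √|x - t|) (𝓝[Icc (0:ℝ) 1] t) (𝓝 0) := by
    have : Continuous fun x => 32 * K * √|x - t| := by fun_prop
    have := this.tendsto t
    simp only [sub_self, abs_zero, Real.sqrt_zero, mul_zero] at this
    exact this.mono_left nhdsWithin_le_nhds
  refine squeeze_zero' (Eventually.of_forall fun _ => norm_nonneg _) ?_ tz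
  filter_upwards [self_mem_nhdsWithin] with x hx
  rcases eq_or_ne x t with rfl | hxt
  · simp
  have a1 := (hv t ht).2 x hx hxt
  have a2 := (hv x hx).2 t ht hxt.symm
  rw [slope_comm, abs_sub_comm] at a2
  have := norm_sub_le_norm_sub_add_norm_sub (v x) (slope g t x) (v t)
  rw [norm_sub_rev (v x) (slope g t x)] at this
  linarith
end

/-! ### Part 21: estimates for almost minimizing paths -/
section
variable {s : ℝ} {n : ℕ}

def Good (A c M D : ℝ) (g v : ℝ → HS s n) : Prop :=
  HPath g v ∧ ∀ t ∈ Icc (0:ℝ) 1, g t ∈ KK s n A c ∧ ‖v t‖ ≤ M ∧ ‖TT (g t) (v t)‖ ≤ D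

theorem Good.lip {A c M D : ℝ} {g v : ℝ → HS s n} (h : Good A c M D g v) {p q : ℝ}
    (hp : p ∈ Icc (0:ℝ) 1) (hq : q ∈ Icc (0:ℝ) 1) : ‖g q - g p‖ ≤ M * |q - p| :=
  (convex_Icc (0:ℝ) 1).norm_image_sub_le_of_norm_hasDerivWithin_le h.1.1
    (fun t ht => (h.2 t ht).2.1) hp hq

/-- The map `u ↦ TT γ u` as a continuous linear map. -/
theorem TT_clm (hs : s ∈ Ioo (3 / 2 : ℝ) 2) {A c C : ℝ} (hc : 0 < c) (hC : ∀ γ γ' : HS s n,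
    γ ∈ KK s n A c → γ' ∈ KK s n A c → ∀ u, ‖TT γ u‖ ≤ C * ‖u‖ ∧
      ‖TT γ u - TT γ' u‖ ≤ C * ‖γ - γ'‖ * ‖u‖) {γ : HS s n} (h : γ ∈ KK s n A c) :
    ∃ L : HS s n →L[ℝ] Lp (W6 n) 2 mu2, ∀ u, L u = TT γ u :=
  ⟨LinearMap.mkContinuous ⟨⟨TT γ, TT_add hs (KK.inM hc h)⟩, TT_smul hs (KK.inM hc h)⟩ C
    (fun u => (hC γ γ h h u).1), fun _ => rfl⟩

theorem Good.incr (hs : s ∈ Ioo (3 / 2 : ℝ) 2) {A c C : ℝ} (hc : 0 < c) (hC0 : 0 < C) (hC : ∀ γ γ' : HS s n,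
    γ ∈ KK s n A c → γ' ∈ KK s n A c → ∀ u, ‖TT γ u‖ ≤ C * ‖u‖ ∧
      ‖TT γ u - TT γ' u‖ ≤ C * ‖γ - γ'‖ * ‖u‖) {M D : ℝ} (hM : 0 ≤ M) {g v : ℝ → HS s n} (h : Good A c M D g v)
    {a p q b : ℝ} (ha : 0 ≤ a) (hap : a ≤ p) (hpq : p ≤ q) (hqb : q ≤ b) (hb : b ≤ 1) :
    ‖TT (g a) (g q - g p)‖ ≤ (D + C * M ^ 2 * (b - a)) * (q - p) := by
  have ham : a ∈ Icc (0:ℝ) 1 := ⟨ha, by linarith⟩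
  obtain ⟨L, hL⟩ := TT_clm hs hc hC (h.2 a ham).1
  rw [← hL, map_sub]
  have hsub : Icc p q ⊆ Icc 0 1 := Icc_subset_Icc (ha.trans hap) (hqb.trans hb)
  have := (convex_Icc p q).norm_image_sub_le_of_norm_hasDerivWithin_le (f := fun t => L (g t))
    (f' := fun t => L (v t)) (C := D + C * M ^ 2 * (b - a))
    (fun t ht => L.hasFDerivAt.comp_hasDerivWithinAt t ((h.1.1 t (hsub ht)).mono hsub))
    (fun t ht => ?_) (left_mem_Icc.2 hpq) (right_mem_Icc.2 hpq)
  · rwa [Real.norm_eq_abs, abs_of_nonneg (sub_nonneg.2 hpq)] at this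
  · rw [hL]
    have ht1 := hsub ht
    have e1 := TT_sub' hC (h.2 a ham).1 (h.2 t ht1).1 (v t)
    have e2 := h.lip ht1 ham
    rw [abs_sub_comm, abs_of_nonneg (by linarith [ht.1])] at e2
    have e3 := (h.2 t ht1).2
    have : C * ‖g a - g t‖ * ‖v t‖ ≤ C * (M * (b - a)) * M := by
      have : M * (t - a) ≤ M * (b - a) := by gcongr; linarith [ht.2]
      have := this.trans' e2
      have := norm_nonneg (v t)
      have : 0 ≤ M * (b - a) := mul_nonneg hM (by linarith)
      gcongr
      exact e3.1
    linarith [e3.2]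

theorem Good.surg (hs : s ∈ Ioo (3 / 2 : ℝ) 2) {A c C : ℝ} (hc : 0 < c) (hC0 : 0 < C) (hC : ∀ γ γ' : HS s n,
    γ ∈ KK s n (A+1) (c/2) → γ' ∈ KK s n (A+1) (c/2) → ∀ u, ‖TT γ u‖ ≤ C * ‖u‖ ∧
      ‖TT γ u - TT γ' u‖ ≤ C * ‖γ - γ'‖ * ‖u‖) {M D D₀ : ℝ} (hM : 0 ≤ M) {g v : ℝ → HS s n}
    (h : Good A c M D g v) (hD : 0 ≤ D) (hd : geodDist s (g 0).f (g 1).f = ENNReal.ofReal D₀)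
    {a b : ℝ} (ha : 0 ≤ a) (hab : a ≤ b) (hb : b ≤ 1) (h1 : M * (b - a) ≤ 1)
    (h2 : Cs s * (M * (b - a)) ≤ c / 2) :
    D₀ ≤ D * (1 - (b - a)) + ‖TT (g a) (g b - g a)‖ + C * M ^ 2 * (b - a) ^ 2 := by
  have ham : a ∈ Icc (0:ℝ) 1 := ⟨ha, by linarith⟩
  have hbm : b ∈ Icc (0:ℝ) 1 := ⟨by linarith, hb⟩
  have hl := h.lip ham hbm
  rw [abs_of_nonneg (sub_nonneg.2 hab)] at hl
  have hk := (h.2 a ham).1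
  have hk' : g a ∈ KK s n (A+1) (c/2) := KK.mono hk (by linarith) (by linarith)
  have hpos : 0 ≤ M * (b - a) := mul_nonneg hM (sub_nonneg.2 hab)
  have key := h.1.surgery hs ha hab hb (D := D) (M := ‖TT (g a) (g b - g a)‖ + C * M ^ 2 * (b - a) ^ 2)
    (fun t ht => (h.2 t ht).2.2) (fun θ hθ => by
      have hθn : ‖θ • (g b - g a)‖ ≤ M * (b - a) := by
        rw [norm_smul, Real.norm_eq_abs, abs_of_nonneg hθ.1]
        nlinarith [hθ.2, norm_nonneg (g b - g a)]
      have hm : g a + θ • (g b - g a) ∈ KK s n (A+1) (c/2) :=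
        KK.mono (KK.pert hs (γ' := g a + θ • (g b - g a)) (ρ := M * (b - a)) hk (by rwa [add_sub_cancel_left]))
          (by linarith) (by linarith)
      refine ⟨KK.inM (by positivity) hm, ?_⟩
      have := TT_sub' hC hm hk' (g b - g a)
      rw [add_sub_cancel_left] at this
      have h3 : C * ‖θ • (g b - g a)‖ * ‖g b - g a‖ ≤ C * (M * (b - a)) * (M * (b - a)) := by gcongr
      linarith)
  rw [hd] at key
  have hnn : 0 ≤ D * a + (‖TT (g a) (g b - g a)‖ + C * M ^ 2 * (b - a) ^ 2) + D * (1 - b) := by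
    have : 0 ≤ 1 - b := by linarith
    positivity
  have := (ENNReal.ofReal_le_ofReal_iff hnn).1 key
  linarith

/-- Parallelogram computation. -/
theorem para {F : Type*} [NormedAddCommGroup F] [InnerProductSpace ℝ F] {x y : F} {p q S : ℝ}
    (hp : 0 ≤ p) (hq : 0 ≤ q) (hx : ‖x‖ ≤ S) (hy : ‖y‖ ≤ S) :
    p * q * ‖y - x‖ ^ 2 ≤ 2 * ((q + p) * S) * ((q + p) * S - ‖q • x + p • y‖) := by
  have e1 : ‖q • x + p • y‖ ^ 2 = q ^ 2 * ‖x‖ ^ 2 + 2 * (q * p * inner ℝ x y) + p ^ 2 * ‖y‖ ^ 2 := by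
    rw [norm_add_sq_real, norm_smul, norm_smul, inner_smul_left, inner_smul_right, mul_pow, mul_pow]
    simp; ring
  have e2 : ‖y - x‖ ^ 2 = ‖y‖ ^ 2 - 2 * inner ℝ x y + ‖x‖ ^ 2 := by
    rw [norm_sub_sq_real, real_inner_comm]
  have hw : ‖q • x + p • y‖ ≤ (q + p) * S := by
    refine (norm_add_le _ _).trans ?_
    rw [norm_smul, norm_smul, Real.norm_eq_abs, Real.norm_eq_abs, abs_of_nonneg hp, abs_of_nonneg hq]
    nlinarith
  have hx2 : ‖x‖ ^ 2 ≤ S ^ 2 := by gcongr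
  have hy2 : ‖y‖ ^ 2 ≤ S ^ 2 := by gcongr
  have : p * q * ‖y - x‖ ^ 2 = (q + p) * (q * ‖x‖ ^ 2 + p * ‖y‖ ^ 2) - ‖q • x + p • y‖ ^ 2 := by
    rw [e1, e2]; ring
  have h3 : (q + p) * (q * ‖x‖ ^ 2 + p * ‖y‖ ^ 2) ≤ (q + p) * (q * S ^ 2 + p * S ^ 2) := by gcongr
  nlinarith [norm_nonneg (q • x + p • y)]

theorem Good.sd (hs : s ∈ Ioo (3 / 2 : ℝ) 2) (n : ℕ) {A c : ℝ} (hc : 0 < c) {M D₁ : ℝ} (hM : 0 < M)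
    (hD₁ : 0 ≤ D₁) :
    ∃ K C : ℝ, 0 ≤ K ∧ 0 < C ∧ ∀ (g v : ℝ → HS s n) (D D₀ : ℝ), Good A c M D g v → 0 ≤ D → D ≤ D₁ →
      D₀ ≤ D → geodDist s (g 0).f (g 1).f = ENNReal.ofReal D₀ →
      (∀ a m b, 0 ≤ a → a < m → m < b → b ≤ 1 → (b - m) * (m - a) *
        ‖slope g m b - slope g a m‖ ^ 2 ≤ K * ((b - a) ^ 3 + (D - D₀))) ∧
      (∀ a b, 0 ≤ a → a < b → b ≤ 1 → ‖TT (g a) (slope g a b)‖ ≤ D + C * (b - a)) := by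
  obtain ⟨C, hC0, hC⟩ := TT_est hs n hc A
  obtain ⟨C', hC0', hC'⟩ := TT_est hs n (half_pos hc) (A+1)
  obtain ⟨C₂, hC20, hC2⟩ := coerKK hs n hc A
  have hCs := Cs_ge hs
  obtain ⟨ρ, hρ, hρ1, hρ2⟩ : ∃ ρ : ℝ, 0 < ρ ∧ M * ρ ≤ 1 ∧ Cs s * (M * ρ) ≤ c / 2 := by
    refine ⟨min (1/M) (c / 2 / (Cs s * M)), by positivity, ?_, ?_⟩
    · calc M * _ ≤ M * (1/M) := by gcongr; exact min_le_left _ _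
        _ = 1 := by field_simp
    · calc Cs s * (M * _) ≤ Cs s * (M * (c / 2 / (Cs s * M))) := by gcongr; exact min_le_right _ _
        _ = c / 2 := by field_simp
  set S₁ := D₁ + C * M ^ 2
  have hS₁ : 0 ≤ S₁ := by positivity
  set K₁ := C₂ ^ 2 * (2 * S₁ * ((C + C') * M ^ 2 + 1)) with hK1
  have hK₁ : 0 ≤ K₁ := by positivity
  refine ⟨K₁ + 4 * M ^ 2 / ρ, C * M ^ 2, by positivity, by positivity, ?_⟩
  intro g v D D₀ h hD hD1 hD0 hd
  have sl : ∀ a b, 0 ≤ a → a < b → b ≤ 1 → ‖slope g a b‖ ≤ M := by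
    intro a b ha hab hb
    have := h.lip (p := a) (q := b) ⟨ha, by linarith⟩ ⟨by linarith, hb⟩
    have hp : 0 < b - a := by linarith
    rw [slope_def_module, norm_smul, norm_inv, Real.norm_eq_abs, inv_mul_le_iff₀ (abs_pos.2 hp.ne')]
    linarith
  have tsl : ∀ a p q b, 0 ≤ a → a ≤ p → p < q → q ≤ b → b ≤ 1 →
      ‖TT (g a) (slope g p q)‖ ≤ D + C * M ^ 2 * (b - a) := by
    intro a p q b ha hap hpq hqb hb
    have := h.incr hs hc hC0 hC hM.le ha hap hpq.le hqb hb
    have hp : 0 < q - p := by linarith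
    rw [slope_def_module, TT_smul hs (KK.inM hc (h.2 a ⟨ha, by linarith⟩).1), norm_smul, norm_inv,
      Real.norm_eq_abs, abs_of_pos hp, inv_mul_le_iff₀ hp]
    linarith
  refine ⟨fun a m b ha ham hmb hb => ?_, fun a b ha hab hb => tsl a a b b ha le_rfl hab le_rfl hb⟩
  have hh : 0 < b - a := by linarith
  have hp : 0 < b - m := by linarith
  have hq : 0 < m - a := by linarith
  have he : 0 ≤ D - D₀ := by linarith
  rw [add_mul]
  rcases le_total (b - a) ρ with hr | hr
  · refine le_add_of_le_of_nonneg ?_ (by positivity)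
    have sg := h.surg hs hc hC0' hC' hM.le hD hd ha (by linarith : a ≤ b) hb
      (hρ1.trans' (by gcongr)) (hρ2.trans' (by gcongr))
    have hin := (h.2 a ⟨ha, by linarith⟩).1
    have hinM := KK.inM hc hin
    have pr := para (x := TT (g a) (slope g a m)) (y := TT (g a) (slope g m b)) hp.le hq.le
      (S := D + C * M ^ 2 * (b - a))
      (tsl a a m b ha le_rfl ham hmb.le hb) (tsl a m b b ha ham.le hmb le_rfl hb)
    have e1 : (m - a) • TT (g a) (slope g a m) + (b - m) • TT (g a) (slope g m b)
        = TT (g a) (g b - g a) := by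
      rw [← TT_smul hs hinM, ← TT_smul hs hinM, ← TT_add hs hinM, sub_smul_slope, sub_smul_slope]
      congr 1
      simp [vsub_eq_sub]
    obtain ⟨L, hL⟩ := TT_clm hs hc hC hin
    have e2 : TT (g a) (slope g m b) - TT (g a) (slope g a m) = TT (g a) (slope g m b - slope g a m) := by
      rw [← hL, ← hL, ← hL, map_sub]
    rw [e1, e2, show m - a + (b - m) = b - a by ring] at pr
    have co := hC2 _ hin (slope g m b - slope g a m)
    have hS : D + C * M ^ 2 * (b - a) ≤ S₁ := by
      have : C * M ^ 2 * (b - a) ≤ C * M ^ 2 * 1 := by gcongr; linarith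
      linarith
    have r1 : (b - a) * (D + C * M ^ 2 * (b - a)) - ‖TT (g a) (g b - g a)‖ ≤
        (C + C') * M ^ 2 * (b - a) ^ 2 + (D - D₀) := by nlinarith
    calc (b - m) * (m - a) * ‖slope g m b - slope g a m‖ ^ 2
        ≤ (b - m) * (m - a) * (C₂ * ‖TT (g a) (slope g m b - slope g a m)‖) ^ 2 := by gcongr
      _ = C₂ ^ 2 * ((b - m) * (m - a) * ‖TT (g a) (slope g m b - slope g a m)‖ ^ 2) := by ring
      _ ≤ C₂ ^ 2 * (2 * ((b - a) * S₁) * ((C + C') * M ^ 2 * (b - a) ^ 2 + (D - D₀))) := by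
          refine mul_le_mul_of_nonneg_left (pr.trans ?_) (by positivity)
          refine (mul_le_mul_of_nonneg_left r1 (by positivity)).trans ?_
          gcongr
      _ ≤ K₁ * ((b - a) ^ 3 + (D - D₀)) := by
          have f1 : (b - a) * (D - D₀) ≤ 1 * (D - D₀) := by gcongr; linarith
          have f2 : 0 ≤ (C + C') * M ^ 2 := by positivity
          have f3 : (b - a) * ((C + C') * M ^ 2 * (b - a) ^ 2 + (D - D₀)) ≤
              ((C + C') * M ^ 2 + 1) * ((b - a) ^ 3 + (D - D₀)) := by
            have := mul_nonneg f2 he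
            have := pow_pos hh 3
            nlinarith
          have := mul_le_mul_of_nonneg_left f3 (show 0 ≤ C₂ ^ 2 * (2 * S₁) by positivity)
          rw [hK1]; linarith
  · refine le_add_of_nonneg_of_le (by positivity) ?_
    have n1 : ‖slope g m b - slope g a m‖ ≤ 2 * M := by
      have := norm_sub_le (slope g m b) (slope g a m)
      linarith [sl m b (by linarith) hmb hb, sl a m ha ham (by linarith)]
    calc (b - m) * (m - a) * ‖slope g m b - slope g a m‖ ^ 2 ≤ (b - a) * (b - a) * (2 * M) ^ 2 := by
          gcongr <;> linarith
      _ ≤ 4 * M ^ 2 / ρ * (b - a) ^ 3 := by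
          rw [div_mul_eq_mul_div, le_div_iff₀ hρ]
          have : 4 * M ^ 2 * (b - a) ^ 2 * ρ ≤ 4 * M ^ 2 * (b - a) ^ 2 * (b - a) := by gcongr
          linarith
      _ ≤ _ := by gcongr; linarith
end

/-! ### Part 22: compactness and conclusion -/
section
variable {s : ℝ} {n : ℕ}

theorem diag_subseq {X Y : Type*} [PseudoMetricSpace X] [TopologicalSpace.SeparableSpace X] [Nonempty X]
    [NormedAddCommGroup Y] [ProperSpace Y] {F : ℕ → X → Y} {B : ℝ} (hB : ∀ k p, ‖F k p‖ ≤ B)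
    {ω : ℝ → ℝ} (hω : Tendsto ω (𝓝 0) (𝓝 0)) (hF : ∀ k p q, dist (F k p) (F k q) ≤ ω (dist p q)) :
    ∃ φ : ℕ → ℕ, StrictMono φ ∧ ∃ G : X → Y, ∀ p, Tendsto (fun k => F (φ k) p) atTop (𝓝 (G p)) := by
  set u := TopologicalSpace.denseSeq X
  obtain ⟨G, -, φ, hφ, hG⟩ := (isCompact_univ_pi fun _ : ℕ => isCompact_closedBall (0 : Y) B).tendsto_subseq
    (x := fun k i => F k (u i)) (fun k i _ => by simpa using hB k (u i))
  rw [tendsto_pi_nhds] at hG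
  have : ∀ p, ∃ y, Tendsto (fun k => F (φ k) p) atTop (𝓝 y) := by
    intro p
    refine cauchySeq_tendsto_of_complete (Metric.cauchySeq_iff'.2 fun ε hε => ?_)
    obtain ⟨δ, hδ, h2⟩ := Metric.eventually_nhds_iff.1 (hω.eventually (gt_mem_nhds (show 0 < ε/4 by linarith)))
    obtain ⟨_, hi, i, rfl⟩ := Metric.dense_iff.1 (TopologicalSpace.denseRange_denseSeq X) p δ hδ
    rw [Metric.mem_ball] at hi
    obtain ⟨N, hN⟩ := Metric.cauchySeq_iff'.1 (hG i).cauchySeq (ε/4) (by linarith)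
    refine ⟨N, fun k hk => ?_⟩
    have w : ω (dist (u i) p) < ε / 4 := h2 (by rwa [Real.dist_0_eq_abs, abs_of_nonneg dist_nonneg])
    have a1 := hF (φ k) (u i) p
    have a2 := hF (φ N) (u i) p
    have a3 := hN k hk
    have := dist_triangle4_left (F (φ k) (u i)) (F (φ N) (u i)) (F (φ k) p) (F (φ N) p)
    simp only [Function.comp] at a3
    linarith
  choose G' hG' using this
  exact ⟨φ, hφ, G', hG'⟩

/-- Pointwise C¹ convergence. -/
def PC (U : ℕ → HS s n) (u : HS s n) : Prop := ∀ x,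
  Tendsto (fun k => (U k).f x) atTop (𝓝 (u.f x)) ∧
  Tendsto (fun k => deriv (U k).f x) atTop (𝓝 (deriv u.f x))

theorem PC.sub {U V : ℕ → HS s n} {u v : HS s n} (h : PC U u) (h' : PC V v) :
    PC (fun k => U k - V k) (u - v) := fun x => by
  simp only [HS.dsub]
  exact ⟨(h x).1.sub (h' x).1, (h x).2.sub (h' x).2⟩

theorem PC.slope {g : ℕ → ℝ → HS s n} {G : ℝ → HS s n} {a b : ℝ} (ha : PC (fun k => g k a) (G a))
    (hb : PC (fun k => g k b) (G b)) : PC (fun k => slope (g k) a b) (slope G a b) := fun x => by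
  simp only [slope_def_module, HS.dsmul]
  exact ⟨((hb.sub ha) x).1.const_smul (b - a)⁻¹, ((hb.sub ha) x).2.const_smul _⟩

theorem PC.lsc (hs : s ∈ Ioo (3 / 2 : ℝ) 2) {U : ℕ → HS s n} {u : HS s n} (h : PC U u) {b : ℕ → ℝ} {B : ℝ}
    (hb : ∀ k, ‖U k‖ ≤ b k) (hB : Tendsto b atTop (𝓝 B)) : ‖u‖ ≤ B := by
  refine le_of_forall_pos_le_add fun ε hε => ?_
  obtain ⟨N, hN⟩ := eventually_atTop.1 (hB.eventually (gt_mem_nhds (show B < B + ε by linarith)))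
  obtain ⟨V, hV, -, hn⟩ := HS.compact hs (U := fun k => U (k + N)) (A := B + ε)
    (fun k => (hb _).trans (hN _ (by omega)).le)
    (fun x => ((tendsto_add_atTop_iff_nat (f := fun k => (U k).f x) N).2 (h x).1))
    (fun x => ((tendsto_add_atTop_iff_nat (f := fun k => deriv (U k).f x) N).2 (h x).2))
  rwa [HS.ext' hV] at hn

theorem path_limit (hs : s ∈ Ioo (3 / 2 : ℝ) 2) {A c M : ℝ} (hA : 0 ≤ A) (hM : 0 ≤ M) {g v : ℕ → ℝ → HS s n} {D : ℕ → ℝ}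
    (h : ∀ k, Good A c M (D k) (g k) (v k)) :
    ∃ φ : ℕ → ℕ, StrictMono φ ∧ ∃ G : ℝ → HS s n, ∀ t ∈ Icc (0:ℝ) 1,
      PC (fun k => g (φ k) t) (G t) ∧ G t ∈ KK s n A c := by
  have hCs := Cs_ge hs
  set pr : ℝ → ℝ := fun t => projIcc (0:ℝ) 1 zero_le_one t with hpr
  have prm : ∀ t, pr t ∈ Icc (0:ℝ) 1 := fun t => (projIcc (0:ℝ) 1 zero_le_one t).2
  have prl : ∀ t t', |pr t' - pr t| ≤ |t' - t| := fun t t' => by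
    have := (LipschitzWith.projIcc (zero_le_one' ℝ)).dist_le_mul t' t
    rwa [NNReal.coe_one, one_mul, Subtype.dist_eq, Real.dist_eq, Real.dist_eq] at this
  have pre : ∀ t ∈ Icc (0:ℝ) 1, pr t = t := fun t ht => by rw [hpr]; simp only [projIcc_of_mem _ ht]
  have hσ : 0 < s - 3/2 := by linarith [hs.1]
  set ω : ℝ → ℝ := fun r => Cs s * (M * r) + (Cs s * A * r + Cs s * A * r ^ (s - 3/2)) with hω'
  have hω : Tendsto ω (𝓝 0) (𝓝 0) := by
    have : ContinuousAt ω 0 := by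
      refine ContinuousAt.add (by fun_prop) (ContinuousAt.add (by fun_prop) ?_)
      exact continuousAt_const.mul (continuousAt_id.rpow_const (Or.inr hσ.le))
    have h2 := this.tendsto
    simp only [hω', mul_zero, Real.zero_rpow hσ.ne', add_zero] at h2
    exact h2
  have nA : ∀ k t, ‖g k (pr t)‖ ≤ A := fun k t => ((h k).2 _ (prm t)).1.1
  obtain ⟨φ, hφ, G, hG⟩ := diag_subseq (X := ℝ × ℝ) (Y := En n × En n)
    (F := fun k p => ((g k (pr p.1)).f p.2, deriv (g k (pr p.1)).f p.2)) (B := Cs s * A) (fun k p => by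
      refine max_le ?_ ?_
      · exact (HS.sup_f hs _ _).trans (by gcongr; exact nA k _)
      · exact (HS.sup_d hs _ _).trans (by gcongr; exact nA k _)) hω (fun k p q => by
      have d1 : |q.1 - p.1| ≤ dist p q := by rw [abs_sub_comm, ← Real.dist_eq]; exact le_max_left _ _
      have d2 : dT q.2 p.2 ≤ dist p q := by
        refine (dT_le_abs _ _).trans ?_
        rw [← Real.dist_eq]; exact le_max_right _ _
      have d3 := dT_nonneg q.2 p.2
      have l1 : ‖g k (pr p.1) - g k (pr q.1)‖ ≤ M * dist p q := by
        refine ((h k).lip (prm _) (prm _)).trans ?_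
        gcongr
        rw [abs_sub_comm]; exact (prl _ _).trans d1
      have z1 : 0 ≤ Cs s * A * dist p q := by positivity
      have z2 : 0 ≤ Cs s * A * dist p q ^ (s - 3/2) := by positivity
      refine max_le ?_ ?_
      · rw [dist_eq_norm]
        dsimp only
        have a1 := HS.sup_f hs (g k (pr p.1) - g k (pr q.1)) p.2
        have a2 : ‖(g k (pr q.1)).f p.2 - (g k (pr q.1)).f q.2‖ ≤ Cs s * A * dist p q := by
          refine (HS.lip hs (g k (pr q.1)) q.2 p.2).trans ?_
          gcongr; exact nA k _
        have a3 : Cs s * ‖g k (pr p.1) - g k (pr q.1)‖ ≤ Cs s * (M * dist p q) := by gcongr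
        have := norm_sub_le_norm_sub_add_norm_sub ((g k (pr p.1)).f p.2) ((g k (pr q.1)).f p.2) ((g k (pr q.1)).f q.2)
        simp only [HS.sub_f, Pi.sub_apply] at a1
        simp only [hω']
        linarith
      · rw [dist_eq_norm]
        dsimp only
        have a1 := HS.sup_d hs (g k (pr p.1) - g k (pr q.1)) p.2
        have a2 : ‖deriv (g k (pr q.1)).f p.2 - deriv (g k (pr q.1)).f q.2‖ ≤ Cs s * A * dist p q ^ (s - 3/2) := by
          refine (HS.hol hs (g k (pr q.1)) q.2 p.2).trans ?_
          gcongr; exact nA k _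
        have a3 : Cs s * ‖g k (pr p.1) - g k (pr q.1)‖ ≤ Cs s * (M * dist p q) := by gcongr
        have := norm_sub_le_norm_sub_add_norm_sub (deriv (g k (pr p.1)).f p.2) (deriv (g k (pr q.1)).f p.2) (deriv (g k (pr q.1)).f q.2)
        rw [HS.dsub] at a1
        simp only [hω']
        linarith)
  refine ⟨φ, hφ, ?_⟩
  have key : ∀ t ∈ Icc (0:ℝ) 1, ∃ V : HS s n, PC (fun k => g (φ k) t) V ∧ V ∈ KK s n A c := by
    intro t ht
    have c1 : ∀ x, Tendsto (fun k => (g (φ k) t).f x) atTop (𝓝 (G (t, x)).1) := fun x => by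
      have := (hG (t, x)).fst_nhds
      simpa only [pre t ht] using this
    have c2 : ∀ x, Tendsto (fun k => deriv (g (φ k) t).f x) atTop (𝓝 (G (t, x)).2) := fun x => by
      have := (hG (t, x)).snd_nhds
      simpa only [pre t ht] using this
    obtain ⟨V, hV, hd, hn⟩ := HS.compact hs (U := fun k => g (φ k) t) (A := A)
      (fun k => ((h (φ k)).2 t ht).1.1) (u := fun x => (G (t, x)).1) (w := fun x => (G (t, x)).2) c1 c2
    refine ⟨V, fun x => ?_, hn, fun x y => ?_⟩
    · rw [hV, hd]; exact ⟨c1 x, c2 x⟩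
    · rw [hV]
      exact ge_of_tendsto ((c1 y).sub (c1 x)).norm (Eventually.of_forall fun k => ((h (φ k)).2 t ht).1.2 x y)
  choose! G' hG' using key
  exact ⟨G', hG'⟩

theorem SD_of {g : ℝ → HS s n} {K : ℝ} (hK : 0 ≤ K) (h : ∀ a m b, 0 ≤ a → a < m → m < b → b ≤ 1 →
    (b - m) * (m - a) * ‖slope g m b - slope g a m‖ ^ 2 ≤ K * (b - a) ^ 3) : SD g (√K) := by
  have key : ∀ a b, 0 ≤ a → a < b → b ≤ 1 → ∀ θ ∈ Ioo (0:ℝ) 1, θ * (1 - θ) *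
    ‖slope g (a + θ * (b - a)) b - slope g a (a + θ * (b - a))‖ ^ 2 ≤ K * (b - a) := by
    intro a b ha hab hb θ hθ
    have hp : 0 < b - a := by linarith
    have := h a (a + θ * (b - a)) b ha (by nlinarith [hθ.1]) (by nlinarith [hθ.2]) hb
    rw [show b - (a + θ * (b - a)) = (1 - θ) * (b - a) by ring, add_sub_cancel_left] at this
    refine le_of_mul_le_mul_left (a := (b - a) ^ 2) ?_ (by positivity)
    linarith
  intro a ha b hb hab θ hθ
  rw [Real.sq_sqrt hK]
  rcases lt_or_gt_of_ne hab with hl | hl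
  · rw [abs_of_pos (by linarith)]
    exact key a b ha.1 hl hb.2 θ hθ
  · have := key b a hb.1 hl ha.2 (1 - θ) ⟨by linarith [hθ.2], by linarith [hθ.1]⟩
    rw [show b + (1 - θ) * (a - b) = a + θ * (b - a) by ring, norm_sub_rev, slope_comm g b, slope_comm g _ a] at this
    rw [abs_of_neg (by linarith)]
    linarith
end

/-! ### Part 23: conclusion -/
section
variable {s : ℝ} {n : ℕ}

theorem min_path (hs : s ∈ Ioo (3 / 2 : ℝ) 2) {γ₀ γ₁ : ℝ → En n} (h0 : InM s γ₀) {D₀ : ℝ}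
    (hD₀ : 0 ≤ D₀) (hd : geodDist s γ₀ γ₁ = ENNReal.ofReal D₀) :
    ∃ g v : ℝ → HS s n, HPath g v ∧ (g 0).f = γ₀ ∧ (g 1).f = γ₁ ∧
      ∀ t ∈ Icc (0:ℝ) 1, ‖TT (g t) (v t)‖ ≤ D₀ := by
  have ex : ∀ k : ℕ, ∃ g v : ℝ → HS s n, HPath g v ∧ (g 0).f = γ₀ ∧ (g 1).f = γ₁ ∧
      ∀ t ∈ Icc (0:ℝ) 1, ‖TT (g t) (v t)‖ ≤ D₀ + 1 / ((k:ℝ) + 1) := by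
    intro k
    have hε : (0:ℝ) < 1 / ((k:ℝ) + 1) := by positivity
    have hlt : geodDist s γ₀ γ₁ < ENNReal.ofReal (D₀ + 1 / ((k:ℝ) + 1) / 2) := by
      rw [hd]; exact (ENNReal.ofReal_lt_ofReal_iff (by linarith)).2 (by linarith)
    unfold geodDist at hlt
    simp only [iInf_lt_iff] at hlt
    obtain ⟨P, ⟨hP0, hP1⟩, hP⟩ := hlt
    obtain ⟨g, v, h, e⟩ := P.toH
    obtain ⟨g', v', h', e0, e1, hsp⟩ := h.reparam hs (half_pos hε)
    have hl := (ENNReal.ofReal_lt_ofReal_iff (by linarith)).1 hP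
    rw [len_of hs h e] at hl
    refine ⟨g', v', h', ?_, ?_, fun t ht => (hsp t ht).trans (by linarith)⟩
    · rw [e0, (e 0 (by simp)).1, hP0]
    · rw [e1, (e 1 (by simp)).1, hP1]
  choose g v hh hg0 hg1 hsp using ex
  have hle1 : ∀ k : ℕ, D₀ + 1 / ((k:ℝ) + 1) ≤ D₀ + 1 := fun k => by
    have : 1 / ((k:ℝ) + 1) ≤ 1 := by rw [div_le_one (by positivity)]; linarith [(Nat.cast_nonneg k : (0:ℝ) ≤ k)]
    linarith
  obtain ⟨A, c, hc, hKK⟩ := path_control hs (γ₀ := HS.mk γ₀ h0.1) h0 (show 0 ≤ D₀ + 1 by linarith)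
  have hK : ∀ k, ∀ t ∈ Icc (0:ℝ) 1, g k t ∈ KK s n A c := fun k =>
    hKK _ _ (hh k) (HS.ext' (hg0 k)) fun t ht => (hsp k t ht).trans (hle1 k)
  have hA : 0 ≤ A := (norm_nonneg _).trans (hK 0 0 (by simp)).1
  obtain ⟨C₂, hC₂, hco⟩ := coerKK hs n hc A
  set M := C₂ * (D₀ + 1)
  have hM : 0 < M := by positivity
  have hgood : ∀ k : ℕ, Good A c M (D₀ + 1 / ((k:ℝ) + 1)) (g k) (v k) := fun k => ⟨hh k, fun t ht =>
    ⟨hK k t ht, (hco _ (hK k t ht) _).trans (by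
      exact mul_le_mul_of_nonneg_left ((hsp k t ht).trans (hle1 k)) hC₂.le), hsp k t ht⟩⟩
  obtain ⟨φ, hφ, G, hG⟩ := path_limit hs hA hM.le hgood
  obtain ⟨K, C, hK0, hC0, hest⟩ := Good.sd hs n (A := A) hc hM (show 0 ≤ D₀ + 1 by linarith)
  have hest' := fun k => hest (g k) (v k) _ D₀ (hgood k) (by positivity) (hle1 k)
    (by have : 0 < 1 / ((k:ℝ) + 1) := by positivity
        linarith) (by rw [hg0, hg1, hd])
  have htz : Tendsto (fun k : ℕ => 1 / (((φ k : ℕ) : ℝ) + 1)) atTop (𝓝 0) :=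
    tendsto_one_div_add_atTop_nhds_zero_nat.comp hφ.tendsto_atTop
  have hsd : SD G (√K) := by
    refine SD_of hK0 fun a m b ha ham hmb hb => ?_
    have hp : 0 < (b - m) * (m - a) := mul_pos (by linarith) (by linarith)
    have hbm : b ∈ Icc (0:ℝ) 1 := ⟨by linarith, hb⟩
    have hmm : m ∈ Icc (0:ℝ) 1 := ⟨by linarith, by linarith⟩
    have ham' : a ∈ Icc (0:ℝ) 1 := ⟨ha, by linarith⟩
    have hpc := ((hG m hmm).1.slope (hG b hbm).1).sub ((hG a ham').1.slope (hG m hmm).1)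
    have hB : Tendsto (fun k => √(K * ((b - a) ^ 3 + 1 / (((φ k : ℕ) : ℝ) + 1)) / ((b - m) * (m - a)))) atTop
        (𝓝 √(K * ((b - a) ^ 3 + 0) / ((b - m) * (m - a)))) :=
      (((htz.const_add _).const_mul K).div_const _).sqrt
    have := hpc.lsc hs (fun k => ?_) hB
    · rw [add_zero] at this
      have h3 : 0 ≤ (b - a) ^ 3 := pow_nonneg (by linarith) 3
      have := pow_le_pow_left₀ (norm_nonneg _) this 2
      rw [Real.sq_sqrt (by positivity), le_div_iff₀ hp] at this
      linarith
    · refine Real.le_sqrt_of_sq_le ?_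
      rw [le_div_iff₀ hp]
      have := (hest' (φ k)).1 a m b ha ham hmb hb
      rw [add_sub_cancel_left] at this
      linarith
  haveI := HS.complete (s := s) (n := n) hs
  obtain ⟨V, hV, hVc⟩ := hsd.deriv (Real.sqrt_nonneg K)
  have hp : HPath G V := ⟨hV, hVc, fun t ht => KK.inM hc (hG t ht).2⟩
  have hz : (0:ℝ) ∈ Icc (0:ℝ) 1 := by simp
  have ho : (1:ℝ) ∈ Icc (0:ℝ) 1 := by simp
  refine ⟨G, V, hp, ?_, ?_, ?_⟩
  · funext x
    refine tendsto_nhds_unique ((hG 0 hz).1 x).1 ?_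
    simp only [hg0]; exact tendsto_const_nhds
  · funext x
    refine tendsto_nhds_unique ((hG 1 ho).1 x).1 ?_
    simp only [hg1]; exact tendsto_const_nhds
  have lt1 : ∀ t ∈ Ico (0:ℝ) 1, ‖TT (G t) (V t)‖ ≤ D₀ := by
    intro t ht
    have htm : t ∈ Icc (0:ℝ) 1 := ⟨ht.1, ht.2.le⟩
    have hsl : ∀ b, t < b → b ≤ 1 → ‖TT (G t) (slope G t b)‖ ≤ D₀ + C * (b - t) := by
      intro b htb hb
      have hbm : b ∈ Icc (0:ℝ) 1 := ⟨by linarith [ht.1], hb⟩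
      have hpc := (hG t htm).1.slope (hG b hbm).1
      have hB : Tendsto (fun k => D₀ + 1 / (((φ k : ℕ) : ℝ) + 1) + C * (b - t)) atTop
          (𝓝 (D₀ + 0 + C * (b - t))) := (htz.const_add _).add_const _
      rw [add_zero] at hB
      exact TT_lsc hs (fun k => (hh (φ k)).2.2 t htm) (hp.2.2 t htm) (fun x => ((hG t htm).1 x).1)
        (fun x => ((hG t htm).1 x).2) (fun x => (hpc x).1) (fun x => (hpc x).2)
        (fun k => (hest' (φ k)).2 t b ht.1 htb hb) hB
    have hIoc : Ioc t 1 ⊆ Icc (0:ℝ) 1 \ {t} := fun b hb =>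
      ⟨⟨by linarith [ht.1, hb.1], hb.2⟩, fun e => hb.1.ne' e⟩
    have h1 : Tendsto (slope G t) (𝓝[Ioc t 1] t) (𝓝 (V t)) :=
      (hasDerivWithinAt_iff_tendsto_slope.1 (hV t htm)).mono_left (nhdsWithin_mono _ hIoc)
    haveI : (𝓝[Ioc t 1] t).NeBot := by rw [nhdsWithin_Ioc_eq_nhdsGT ht.2]; infer_instance
    have h2 : Tendsto (fun b => D₀ + C * (b - t)) (𝓝[Ioc t 1] t) (𝓝 D₀) := by
      have : Continuous fun b => D₀ + C * (b - t) := by fun_prop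
      have := this.tendsto t
      simp only [sub_self, mul_zero, add_zero] at this
      exact this.mono_left nhdsWithin_le_nhds
    refine le_of_tendsto_of_tendsto (TT_cont hs (hp.2.2 t htm) tendsto_const_nhds h1) h2 ?_
    filter_upwards [self_mem_nhdsWithin] with b hb using hsl b hb.1 hb.2
  have hcl : Icc (0:ℝ) 1 = closure (Ico 0 1) := (closure_Ico (zero_ne_one' ℝ)).symm
  intro t ht
  have hsc := hp.spd hs
  rw [hcl] at hsc ht
  exact le_on_closure lt1 hsc continuousOn_const ht

theorem HPath.energy_ge (hs : s ∈ Ioo (3 / 2 : ℝ) 2) {D₀ : ℝ} (hD₀ : 0 ≤ D₀) {Q : C1Path s n}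
    (hQ : D₀ ≤ pathLen Q) : 1 / 2 * D₀ ^ 2 ≤ pathEnergy Q := by
  obtain ⟨g, v, h, e⟩ := Q.toH
  have hi : IntervalIntegrable (fun t => ‖TT (g t) (v t)‖) volume 0 1 :=
    (h.spd hs).intervalIntegrable_of_Icc zero_le_one
  have hi2 : IntervalIntegrable (fun t => ‖TT (g t) (v t)‖ ^ 2) volume 0 1 :=
    ((h.spd hs).pow 2).intervalIntegrable_of_Icc zero_le_one
  have e1 : pathEnergy Q = 1 / 2 * ∫ t in (0:ℝ)..1, ‖TT (g t) (v t)‖ ^ 2 := by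
    unfold pathEnergy; congr 1
    refine intervalIntegral.integral_congr fun t ht => ?_
    rw [uIcc_of_le zero_le_one] at ht
    simp only [← (e t ht).1, ← (e t ht).2, Gmet_eq hs (h.2.2 t ht)]
  have e2 : ∫ t in (0:ℝ)..1, (2 * D₀ * ‖TT (g t) (v t)‖ - D₀ ^ 2) = 2 * D₀ * pathLen Q - D₀ ^ 2 := by
    rw [intervalIntegral.integral_sub (hi.const_mul _) (by simp), intervalIntegral.integral_const_mul,
      ← len_of hs h e]
    simp
  have := intervalIntegral.integral_mono_on zero_le_one ((hi.const_mul (2 * D₀)).sub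
    (intervalIntegrable_const (c := D₀ ^ 2))) hi2 (fun t _ => by
      nlinarith [sq_nonneg (‖TT (g t) (v t)‖ - D₀)])
  rw [e2] at this
  rw [e1]
  nlinarith
end

/-- existence of minimizing geodesics: if `γ₀, γ₁ ∈ 𝓜` lie in the
same path component of `𝓜` (equivalently `d_G(γ₀,γ₁) < ∞`), then there is a path `Γ`
in `𝓜` from `γ₀` to `γ₁` minimizing the path energy
`𝓔(Γ) = ½∫₀¹ G_{Γ(t)}(Γ̇,Γ̇) dt` among all such paths; it has constant speed and its
length equals `d_G(γ₀,γ₁)`, i.e. it is a length-minimizing geodesic. -/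
theorem statement19 (s : ℝ) (hs : s ∈ Set.Ioo (3 / 2 : ℝ) 2) (n : ℕ) (hn : 2 ≤ n)
    (γ₀ γ₁ : ℝ → En n) (hγ₀ : InM s γ₀) (hγ₁ : InM s γ₁)
    (hconn : geodDist s γ₀ γ₁ < ⊤) :
    ∃ P : C1Path s n, P.Γ 0 = γ₀ ∧ P.Γ 1 = γ₁ ∧
      (∀ Q : C1Path s n, Q.Γ 0 = γ₀ → Q.Γ 1 = γ₁ → pathEnergy P ≤ pathEnergy Q) ∧
      (∀ t₁ ∈ Set.Icc (0 : ℝ) 1, ∀ t₂ ∈ Set.Icc (0 : ℝ) 1,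
        Gmet s (P.Γ t₁) (P.V t₁) (P.V t₁) = Gmet s (P.Γ t₂) (P.V t₂) (P.V t₂)) ∧
      ENNReal.ofReal (pathLen P) = geodDist s γ₀ γ₁ := by
  have hd := (ENNReal.ofReal_toReal hconn.ne).symm
  set D₀ := (geodDist s γ₀ γ₁).toReal with hD
  have hD₀ : 0 ≤ D₀ := ENNReal.toReal_nonneg
  have hge : ∀ Q : C1Path s n, Q.Γ 0 = γ₀ → Q.Γ 1 = γ₁ → D₀ ≤ pathLen Q := by
    intro Q h0 h1
    have hle : geodDist s γ₀ γ₁ ≤ ENNReal.ofReal (pathLen Q) := iInf₂_le Q ⟨h0, h1⟩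
    have hnn : 0 ≤ pathLen Q :=
      intervalIntegral.integral_nonneg zero_le_one fun t _ => Real.sqrt_nonneg _
    exact ENNReal.toReal_le_of_le_ofReal hnn hle
  obtain ⟨g, v, hp, h0, h1, hsp⟩ := min_path hs hγ₀ hD₀ hd
  have hlen : pathLen hp.toC = ∫ t in (0:ℝ)..1, ‖TT (g t) (v t)‖ := len_of hs hp fun t _ => ⟨rfl, rfl⟩
  have hl1 := hge hp.toC h0 h1
  have heq : ∀ t ∈ Icc (0:ℝ) 1, ‖TT (g t) (v t)‖ = D₀ := by
    intro t ht
    by_contra hne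
    have := intervalIntegral.integral_lt_integral_of_continuousOn_of_le_of_exists_lt zero_lt_one
      (hp.spd hs) (continuousOn_const (c := D₀)) (fun x hx => hsp x ⟨hx.1.le, hx.2⟩)
      ⟨t, ht, lt_of_le_of_ne (hsp t ht) hne⟩
    rw [← hlen] at this
    simp at this
    linarith
  have hG : ∀ t ∈ Icc (0:ℝ) 1, Gmet s (hp.toC.Γ t) (hp.toC.V t) (hp.toC.V t) = D₀ ^ 2 := fun t ht => by
    rw [← heq t ht]; exact Gmet_eq hs (hp.2.2 t ht) (v t)
  refine ⟨hp.toC, h0, h1, fun Q hQ0 hQ1 => ?_, fun t₁ ht₁ t₂ ht₂ => by rw [hG t₁ ht₁, hG t₂ ht₂], ?_⟩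
  · refine le_trans (le_of_eq ?_) (HPath.energy_ge hs hD₀ (hge Q hQ0 hQ1))
    unfold pathEnergy
    rw [intervalIntegral.integral_congr (g := fun _ => D₀ ^ 2) fun t ht => hG t (by
      rwa [uIcc_of_le zero_le_one] at ht)]
    simp
  · rw [hd, hlen, intervalIntegral.integral_congr (g := fun _ => D₀) fun t ht => heq t (by
      rwa [uIcc_of_le zero_le_one] at ht)]
    simp
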